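/- arXiv:2305.10076 — 8 statements merged into one kernel-verified Lean document; each statement's English description precedes it below -/
import Mathlib

section
/- Let c(ρ) = 1 + α·ρ with α ≥ 0, and assume v : [0,ρ_max] → [0,v_max] is C², satisfies (H2), and is such that f(ρ) = ρ·v(ρ) is strictly concave on [0,ρ_max]. Let (ρ₁,ξ₁) and (ρ₂,ξ₂) be two BV-regular entropy solutions of Hughes' model with the same initial datum ρ̄ ∈ BV((−1,1);[0,ρ_max]), and suppose that for a.e. t > 0 and for i = 1,2 the one-sided essential limits of ρ_i(t,·) at x = ξ_i(t) exist and vanish, i.e. ρ_i(t,ξ_i(t)⁻) = ρ_i(t,ξ_i(t)⁺) = 0. Then ξ₁ = ξ₂ on [0,∞) and ρ₁ = ρ₂ a.e. on (0,∞)×ℝ. -/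
open MeasureTheory Set Filter

noncomputable section

/-- The flux `f(ρ) = ρ·v(ρ)`. -/
def hughesFlux (v : ℝ → ℝ) (r : ℝ) : ℝ := r * v r

/-- The discontinuous flux `F(t,x,ρ,ξ) = sign(x − ξ(t))·f(ρ)`. -/
def hughesF (v : ℝ → ℝ) (ξ : ℝ → ℝ) (t x r : ℝ) : ℝ :=
  Real.sign (x - ξ t) * hughesFlux v r

/-- The Kruzhkov-type entropy flux `𝓕(t,x,ρ,k,ξ)`. -/
def hughesKruzhkov (v : ℝ → ℝ) (ξ : ℝ → ℝ) (t x r k : ℝ) : ℝ :=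
  Real.sign (r - k) * (hughesF v ξ t x r - hughesF v ξ t x k)

/-- Entropy solution of Hughes' model on `C = (−1,1)` with speed `v`, cost `c`,
maximal density `ρmax` and initial datum `ρ₀` (extended by `0` outside `C`). -/
structure IsEntropySol (ρmax : ℝ) (v c : ℝ → ℝ) (ρ₀ : ℝ → ℝ)
    (ρ : ℝ → ℝ → ℝ) (ξ : ℝ → ℝ) : Prop where
  meas : Measurable (Function.uncurry ρ)
  range : ∀ t x : ℝ, 0 ≤ t → ρ t x ∈ Icc 0 ρmax
  integrable : ∀ t : ℝ, 0 ≤ t → Integrable (ρ t)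
  timeCont : ∀ s : ℝ, 0 ≤ s →
    Tendsto (fun t => ∫ x : ℝ, |ρ t x - ρ s x|) (nhdsWithin s (Ici 0)) (nhds 0)
  init : ∀ᵐ x : ℝ, ρ 0 x = if x ∈ Ioo (-1 : ℝ) 1 then ρ₀ x else 0
  xi_mem : ∀ t : ℝ, ξ t ∈ Ioo (-1 : ℝ) 1
  xi_lip : ∃ L : NNReal, LipschitzOnWith L ξ (Ici 0)
  balance : ∀ᵐ t ∂(volume.restrict (Ioi (0 : ℝ))),
    ∫ y in Ioo (-1 : ℝ) (ξ t), c (ρ t y) = ∫ y in Ioo (ξ t) 1, c (ρ t y)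
  entropy : ∀ k ∈ Icc (0 : ℝ) ρmax, ∀ φ : ℝ × ℝ → ℝ,
    ContDiff ℝ (⊤ : ℕ∞) φ → HasCompactSupport φ →
    (∀ p : ℝ × ℝ, p.1 ≤ 0 → φ p = 0) → (∀ p : ℝ × ℝ, 0 ≤ φ p) →
    0 ≤ (∫ t in Ioi (0 : ℝ), ∫ x : ℝ,
          (|ρ t x - k| * (fderiv ℝ φ (t, x)) (1, 0)
            + hughesKruzhkov v ξ t x (ρ t x) k * (fderiv ℝ φ (t, x)) (0, 1)))
        + 2 * ∫ t in Ioi (0 : ℝ), hughesFlux v k * φ (t, ξ t)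

/-- BV-regular entropy solution: in addition `ρ ∈ L^∞([0,T]; BV((−1,1)))` for all `T > 0`. -/
def IsBVEntropySol (ρmax : ℝ) (v c : ℝ → ℝ) (ρ₀ : ℝ → ℝ)
    (ρ : ℝ → ℝ → ℝ) (ξ : ℝ → ℝ) : Prop :=
  IsEntropySol ρmax v c ρ₀ ρ ξ ∧
    ∀ T > (0 : ℝ), ∃ V : ENNReal, V < ⊤ ∧
      ∀ t ∈ Icc (0 : ℝ) T, eVariationOn (ρ t) (Ioo (-1 : ℝ) 1) ≤ V

/-- Assumption (H2) on the speed map, with explicit derivative `v'` on `[0, ρmax]`. -/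
structure SpeedH2 (ρmax vmax : ℝ) (v v' : ℝ → ℝ) : Prop where
  vmax_pos : 0 < vmax
  hasDeriv : ∀ x ∈ Icc (0 : ℝ) ρmax, HasDerivWithinAt v (v' x) (Icc 0 ρmax) x
  cont : ContinuousOn v' (Icc 0 ρmax)
  anti : StrictAntiOn v (Icc 0 ρmax)
  range : ∀ x ∈ Icc (0 : ℝ) ρmax, v x ∈ Icc 0 vmax
  at_zero : v 0 = vmax
  at_max : v ρmax = 0
  hump : ∃ ρhat ∈ Ioo (0 : ℝ) ρmax, ∀ x ∈ Ioo (0 : ℝ) ρmax, x ≠ ρhat →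
    0 < (v x + x * v' x) * (ρhat - x)

/-- The one-sided essential limit of `g` at `a` from the left (resp. right) equals `0`:
convergence along the one-sided neighbourhood filter meeting the a.e. filter. -/
def EssLimZero (g : ℝ → ℝ) (a : ℝ) (S : Set ℝ) : Prop :=
  Tendsto g ((nhdsWithin a S) ⊓ (MeasureTheory.ae volume)) (nhds 0)


/-- The Kruzhkov entropy flux `sign(a − b)·(g(a) − g(b))` associated with the flux `g`. -/
def kruzhkovFlux (g : ℝ → ℝ) (a b : ℝ) : ℝ := g (max a b) - g (min a b)

/-- `U` satisfies the Kruzhkov entropy inequalities for `∂ₜU + ∂ₓ g(U) = 0` on the half-plane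
`t > 0`, for the constants `k ∈ [0, R]`. -/
def SatisfiesKruzhkov (R : ℝ) (g : ℝ → ℝ) (U : ℝ × ℝ → ℝ) : Prop :=
  ∀ k ∈ Icc (0 : ℝ) R, ∀ φ : ℝ × ℝ → ℝ,
    ContDiff ℝ (⊤ : ℕ∞) φ → HasCompactSupport φ →
    (∀ p : ℝ × ℝ, p.1 ≤ 0 → φ p = 0) → (∀ p : ℝ × ℝ, 0 ≤ φ p) →
    0 ≤ ∫ p, (|U p - k| * fderiv ℝ φ p (1, 0) + kruzhkovFlux g (U p) k * fderiv ℝ φ p (0, 1))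

lemma kruzhkovFlux_comm (g : ℝ → ℝ) (a b : ℝ) : kruzhkovFlux g a b = kruzhkovFlux g b a := by
  simp [kruzhkovFlux, max_comm, min_comm]

lemma kruzhkovFlux_eq_sign (g : ℝ → ℝ) (a b : ℝ) :
    kruzhkovFlux g a b = Real.sign (a - b) * (g a - g b) := by
  rcases lt_trichotomy a b with h | h | h
  · rw [Real.sign_of_neg (sub_neg.2 h), kruzhkovFlux, max_eq_right h.le, min_eq_left h.le]; ring
  · simp [h, kruzhkovFlux]
  · rw [Real.sign_of_pos (sub_pos.2 h), kruzhkovFlux, max_eq_left h.le, min_eq_right h.le]; ring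

lemma abs_sub_le_of_lipschitzWith {M : NNReal} {g : ℝ → ℝ} (hg : LipschitzWith M g) (a b : ℝ) :
    |g a - g b| ≤ M * |a - b| := by
  simpa [Real.dist_eq] using hg.dist_le_mul a b

lemma abs_kruzhkovFlux_le {M : NNReal} {g : ℝ → ℝ} (hg : LipschitzWith M g) (a b : ℝ) :
    |kruzhkovFlux g a b| ≤ M * |a - b| := by
  refine (abs_sub_le_of_lipschitzWith hg _ _).trans_eq ?_
  rw [abs_of_nonneg (sub_nonneg.2 min_le_max), max_sub_min_eq_abs, abs_sub_comm]

lemma abs_kruzhkovFlux_sub_le {M : NNReal} {g : ℝ → ℝ} (hg : LipschitzWith M g) (a b c : ℝ) :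
    |kruzhkovFlux g a b - kruzhkovFlux g a c| ≤ 2 * M * |b - c| := by
  have h1 := abs_sub_le_of_lipschitzWith hg (max a b) (max a c)
  have h2 := abs_sub_le_of_lipschitzWith hg (min a b) (min a c)
  have h3 : |max a b - max a c| ≤ |b - c| := abs_max_sub_max_le_max a b a c |>.trans (by simp)
  have h4 : |min a b - min a c| ≤ |b - c| := abs_min_sub_min_le_max a b a c |>.trans (by simp)
  have h5 := mul_le_mul_of_nonneg_left h3 M.2
  have h6 := mul_le_mul_of_nonneg_left h4 M.2
  have h7 := abs_sub (g (max a b) - g (max a c)) (g (min a b) - g (min a c))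
  simp only [kruzhkovFlux]
  rw [show g (max a b) - g (min a b) - (g (max a c) - g (min a c)) =
    (g (max a b) - g (max a c)) - (g (min a b) - g (min a c)) by ring]
  simp only [NNReal.val_eq_coe] at h5 h6
  linarith

lemma continuous_kruzhkovFlux {g : ℝ → ℝ} (hg : Continuous g) :
    Continuous (fun p : ℝ × ℝ => kruzhkovFlux g p.1 p.2) := by
  unfold kruzhkovFlux; fun_prop

lemma abs_le_of_mem_Icc {R a b : ℝ} (ha : a ∈ Icc 0 R) (hb : b ∈ Icc 0 R) : |a - b| ≤ R :=
  abs_le.2 ⟨by linarith [ha.1, hb.2], by linarith [ha.2, hb.1]⟩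

lemma ContDiff.continuous_fderiv_const {φ : ℝ × ℝ → ℝ} (hφ : ContDiff ℝ (⊤ : ℕ∞) φ) (w : ℝ × ℝ) :
    Continuous (fun p => fderiv ℝ φ p w) :=
  (hφ.continuous_fderiv (by simp)).clm_apply continuous_const

lemma HasCompactSupport.fderiv_const {φ : ℝ × ℝ → ℝ} (hφ : HasCompactSupport φ) (w : ℝ × ℝ) :
    HasCompactSupport (fun p => fderiv ℝ φ p w) :=
  (hφ.fderiv ℝ).comp_left (g := fun A : ℝ × ℝ →L[ℝ] ℝ => A w) (by simp)

lemma integrable_fderiv_const {φ : ℝ × ℝ → ℝ} (hφ : ContDiff ℝ (⊤ : ℕ∞) φ)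
    (hc : HasCompactSupport φ) (w : ℝ × ℝ) : Integrable (fun p => fderiv ℝ φ p w) :=
  (hφ.continuous_fderiv_const w).integrable_of_hasCompactSupport (hc.fderiv_const w)

/-- Integrability of the integrand in the doubling of variables. -/
lemma integrable_doubled {B : ℝ} {H : (ℝ × ℝ) × (ℝ × ℝ) → ℝ} (hH : Measurable H)
    (hB : ∀ z, |H z| ≤ B) {a b : ℝ × ℝ → ℝ} (ha : Integrable a) (hb : Integrable b) :
    Integrable (fun z : (ℝ × ℝ) × (ℝ × ℝ) => H z * (a z.2 * b (z.1 - z.2))) :=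
  (ha.convolution_integrand (ContinuousLinearMap.mul ℝ ℝ) hb).bdd_mul (c := B)
    hH.aestronglyMeasurable (Eventually.of_forall hB)

lemma fderiv_mul_comp_const_sub {ψ K : ℝ × ℝ → ℝ} (hψ : ContDiff ℝ (⊤ : ℕ∞) ψ)
    (hK : ContDiff ℝ (⊤ : ℕ∞) K) (q p w : ℝ × ℝ) :
    fderiv ℝ (fun p => ψ p * K (q - p)) p w
      = fderiv ℝ ψ p w * K (q - p) - ψ p * fderiv ℝ K (q - p) w := by
  have h1 : HasFDerivAt ψ (fderiv ℝ ψ p) p := (hψ.differentiable (by simp) p).hasFDerivAt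
  have h2 : HasFDerivAt K (fderiv ℝ K (q - p)) (q - p) :=
    (hK.differentiable (by simp) _).hasFDerivAt
  have h3 : HasFDerivAt (fun p : ℝ × ℝ => q - p) (-ContinuousLinearMap.id ℝ (ℝ × ℝ)) p :=
    (hasFDerivAt_id p).const_sub q
  have h4 := (h1.mul (h2.comp p h3)).fderiv
  have h5 : (fun p => ψ p * K (q - p)) = ψ * (K ∘ fun p => q - p) := rfl
  rw [h5, h4]
  simp
  ring

lemma fderiv_const_mul_comp_sub_const {K : ℝ × ℝ → ℝ}
    (hK : ContDiff ℝ (⊤ : ℕ∞) K) (c : ℝ) (q p w : ℝ × ℝ) :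
    fderiv ℝ (fun q => c * K (q - p)) q w = c * fderiv ℝ K (q - p) w := by
  have h2 : HasFDerivAt K (fderiv ℝ K (q - p)) (q - p) :=
    (hK.differentiable (by simp) _).hasFDerivAt
  have h3 : HasFDerivAt (fun q : ℝ × ℝ => q - p) (ContinuousLinearMap.id ℝ (ℝ × ℝ)) q :=
    (hasFDerivAt_id q).sub_const p
  have h4 := ((h2.comp q h3).const_mul c).fderiv
  have h5 : (fun q => c * K (q - p)) = fun q => c * (K ∘ fun q => q - p) q := rfl
  rw [h5, h4]
  simp

/-- Doubling of variables with a fixed smoothing kernel `K`. -/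
lemma kruzhkov_doubled_kernel {R τ : ℝ} {M : NNReal} {g : ℝ → ℝ} (hg : LipschitzWith M g)
    {U W : ℝ × ℝ → ℝ} (hUm : Measurable U) (hWm : Measurable W)
    (hUR : ∀ p, U p ∈ Icc 0 R) (hWR : ∀ p, W p ∈ Icc 0 R)
    (hU : SatisfiesKruzhkov R g U) (hW : SatisfiesKruzhkov R g W)
    {ψ K : ℝ × ℝ → ℝ} (hψ : ContDiff ℝ (⊤ : ℕ∞) ψ) (hψc : HasCompactSupport ψ)
    (hψ0 : ∀ p, 0 ≤ ψ p) (hτ : 0 < τ) (hψτ : ∀ p : ℝ × ℝ, p.1 < τ → ψ p = 0)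
    (hK : ContDiff ℝ (⊤ : ℕ∞) K) (hKc : HasCompactSupport K) (hK0 : ∀ p, 0 ≤ K p)
    (hKτ : ∀ p : ℝ × ℝ, τ ≤ |p.1| → K p = 0) :
    0 ≤ ∫ z : (ℝ × ℝ) × (ℝ × ℝ),
      (|U z.2 - W z.1| * (fderiv ℝ ψ z.2 (1, 0) * K (z.1 - z.2))
        + kruzhkovFlux g (U z.2) (W z.1) * (fderiv ℝ ψ z.2 (0, 1) * K (z.1 - z.2))) := by
  have iψ := hψ.continuous.integrable_of_hasCompactSupport (μ := volume) hψc
  have iK := hK.continuous.integrable_of_hasCompactSupport (μ := volume) hKc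
  have iψt := integrable_fderiv_const hψ hψc
  have iKt := integrable_fderiv_const hK hKc
  set A : (ℝ × ℝ) × (ℝ × ℝ) → ℝ := fun z => |U z.2 - W z.1| with hA
  set Q : (ℝ × ℝ) × (ℝ × ℝ) → ℝ := fun z => kruzhkovFlux g (U z.2) (W z.1) with hQ
  have mA : Measurable A := by fun_prop
  have mQ : Measurable Q := (continuous_kruzhkovFlux hg.continuous).measurable.comp
    ((hUm.comp measurable_snd).prodMk (hWm.comp measurable_fst))
  have bA : ∀ z, |A z| ≤ R := fun z => by
    rw [hA, abs_abs]; exact abs_le_of_mem_Icc (hUR _) (hWR _)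
  have bQ : ∀ z, |Q z| ≤ M * R := fun z => (abs_kruzhkovFlux_le hg _ _).trans
    (mul_le_mul_of_nonneg_left (abs_le_of_mem_Icc (hUR _) (hWR _)) M.2)
  have i1 := fun w => integrable_doubled mA bA (iψt w) iK
  have i2 := fun w => integrable_doubled mQ bQ (iψt w) iK
  have i3 := fun w => integrable_doubled mA bA iψ (iKt w)
  have i4 := fun w => integrable_doubled mQ bQ iψ (iKt w)
  have j1 : Integrable (fun z : (ℝ × ℝ) × (ℝ × ℝ) => A z * (fderiv ℝ ψ z.2 (1, 0) * K (z.1 - z.2))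
      + Q z * (fderiv ℝ ψ z.2 (0, 1) * K (z.1 - z.2))) := (i1 _).add (i2 _)
  have j2 : Integrable (fun z : (ℝ × ℝ) × (ℝ × ℝ) =>
      A z * (ψ z.2 * fderiv ℝ K (z.1 - z.2) (1, 0))
        + Q z * (ψ z.2 * fderiv ℝ K (z.1 - z.2) (0, 1))) := (i3 _).add (i4 _)
  have e1 : 0 ≤ ∫ z : (ℝ × ℝ) × (ℝ × ℝ), ((A z * (fderiv ℝ ψ z.2 (1, 0) * K (z.1 - z.2))
      + Q z * (fderiv ℝ ψ z.2 (0, 1) * K (z.1 - z.2)))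
      - (A z * (ψ z.2 * fderiv ℝ K (z.1 - z.2) (1, 0))
        + Q z * (ψ z.2 * fderiv ℝ K (z.1 - z.2) (0, 1)))) := by
    rw [Measure.volume_eq_prod, integral_prod _ (by exact j1.sub j2)]
    refine integral_nonneg fun q => ?_
    refine (hU (W q) (hWR q) (fun p => ψ p * K (q - p))
      (hψ.mul (hK.comp (contDiff_const.sub contDiff_id))) hψc.mul_right
      (fun p hp => by simp [hψτ p (hp.trans_lt hτ)])
      (fun p => mul_nonneg (hψ0 _) (hK0 _))).trans_eq ?_
    refine integral_congr_ae (Eventually.of_forall fun p => ?_)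
    simp only [fderiv_mul_comp_const_sub hψ hK, hA, hQ]
    ring
  have e2 : 0 ≤ ∫ z : (ℝ × ℝ) × (ℝ × ℝ), (A z * (ψ z.2 * fderiv ℝ K (z.1 - z.2) (1, 0))
        + Q z * (ψ z.2 * fderiv ℝ K (z.1 - z.2) (0, 1))) := by
    rw [Measure.volume_eq_prod, integral_prod_symm _ (by exact j2)]
    refine integral_nonneg fun p => ?_
    refine (hW (U p) (hUR p) (fun q => ψ p * K (q - p))
      (contDiff_const.mul (hK.comp (contDiff_id.sub contDiff_const)))
      ((hKc.comp_homeomorph (Homeomorph.subRight p)).mul_left)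
      (fun q hq => ?_)
      (fun q => mul_nonneg (hψ0 _) (hK0 _))).trans_eq ?_
    · by_cases h : p.1 < τ
      · simp [hψτ p h]
      · rw [hKτ, mul_zero]
        rw [Prod.fst_sub, abs_sub_comm]
        exact le_trans (by linarith) (le_abs_self _)
    refine integral_congr_ae (Eventually.of_forall fun q => ?_)
    simp only [fderiv_const_mul_comp_sub_const hK, hA, hQ, abs_sub_comm (W q),
      kruzhkovFlux_comm g (W q)]
  have e3 := add_nonneg e1 e2
  rw [← integral_add (by exact j1.sub j2) j2] at e3
  simpa only [sub_add_cancel] using e3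

/-- Kato's inequality for two solutions of the Kruzhkov entropy inequalities. -/
lemma kruzhkov_kato {R τ : ℝ} {M : NNReal} {g : ℝ → ℝ} (hg : LipschitzWith M g)
    {U W : ℝ × ℝ → ℝ} (hUm : Measurable U) (hWm : Measurable W)
    (hUR : ∀ p, U p ∈ Icc 0 R) (hWR : ∀ p, W p ∈ Icc 0 R)
    (hU : SatisfiesKruzhkov R g U) (hW : SatisfiesKruzhkov R g W)
    {ψ : ℝ × ℝ → ℝ} (hψ : ContDiff ℝ (⊤ : ℕ∞) ψ) (hψc : HasCompactSupport ψ)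
    (hψ0 : ∀ p, 0 ≤ ψ p) (hτ : 0 < τ) (hψτ : ∀ p : ℝ × ℝ, p.1 < τ → ψ p = 0) :
    0 ≤ ∫ p, (|U p - W p| * fderiv ℝ ψ p (1, 0)
        + kruzhkovFlux g (U p) (W p) * fderiv ℝ ψ p (0, 1)) := by
  let b : ℕ → ContDiffBump (0 : ℝ × ℝ) := fun n =>
    ⟨τ / (n + 1) / 2, τ / (n + 1), by positivity, half_lt_self (by positivity)⟩
  have hb0 : Tendsto (fun n => (b n).rOut) atTop (nhds 0) :=
    tendsto_const_div_atTop_nhds_zero_nat τ |>.comp (tendsto_add_atTop_nat 1) |>.congr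
      fun n => by simp [b]
  have hbτ : ∀ n, (b n).rOut ≤ τ := fun n =>
    div_le_self hτ.le (by linarith [(Nat.cast_nonneg n : (0:ℝ) ≤ n)])
  let H : ℝ × ℝ → ℝ × ℝ → ℝ := fun p q =>
    |U p - W q| * fderiv ℝ ψ p (1, 0) + kruzhkovFlux g (U p) (W q) * fderiv ℝ ψ p (0, 1)
  let c : ℝ × ℝ → ℝ := fun p => |fderiv ℝ ψ p (1, 0)| + 2 * M * |fderiv ℝ ψ p (0, 1)|
  have hc : Integrable c :=
    (integrable_fderiv_const hψ hψc _).abs.add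
      ((integrable_fderiv_const hψ hψc _).abs.const_mul _)
  have mQ : Measurable (fun z : (ℝ × ℝ) × (ℝ × ℝ) => kruzhkovFlux g (U z.2) (W z.1)) :=
    (continuous_kruzhkovFlux hg.continuous).measurable.comp
      ((hUm.comp measurable_snd).prodMk (hWm.comp measurable_fst))
  have mψ := fun w => (hψ.continuous_fderiv_const w).measurable
  have mH : Measurable (fun z : (ℝ × ℝ) × (ℝ × ℝ) => H z.2 z.1) := by
    have := mψ (1, 0)
    have := mψ (0, 1)
    simp only [H]
    fun_prop
  have hHlip : ∀ p q q', |H p q - H p q'| ≤ c p * |W q - W q'| := by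
    intro p q q'
    have h1 : |(|U p - W q| - |U p - W q'|)| ≤ |W q - W q'| := by
      refine (abs_abs_sub_abs_le_abs_sub _ _).trans_eq ?_
      rw [sub_sub_sub_cancel_left, abs_sub_comm]
    have h2 := abs_kruzhkovFlux_sub_le hg (U p) (W q) (W q')
    calc |H p q - H p q'|
        = |(|U p - W q| - |U p - W q'|) * fderiv ℝ ψ p (1, 0)
          + (kruzhkovFlux g (U p) (W q) - kruzhkovFlux g (U p) (W q')) * fderiv ℝ ψ p (0, 1)| := by
          congr 1; simp only [H]; ring
      _ ≤ |W q - W q'| * |fderiv ℝ ψ p (1, 0)|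
          + 2 * M * |W q - W q'| * |fderiv ℝ ψ p (0, 1)| := by
          refine (abs_add_le _ _).trans ?_
          rw [abs_mul, abs_mul]
          gcongr
      _ = c p * |W q - W q'| := by simp only [c]; ring
  have hHb : ∀ p q, |H p q| ≤ c p * R := by
    intro p q
    have h0 := abs_le_of_mem_Icc (hUR p) (hWR q)
    have h1 := abs_kruzhkovFlux_le hg (U p) (W q)
    have h2 : (M : ℝ) * |U p - W q| ≤ M * R := mul_le_mul_of_nonneg_left h0 M.2
    have hR : 0 ≤ R := (hUR p).1.trans (hUR p).2
    calc |H p q| ≤ |U p - W q| * |fderiv ℝ ψ p (1, 0)|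
          + |kruzhkovFlux g (U p) (W q)| * |fderiv ℝ ψ p (0, 1)| := by
          refine (abs_add_le _ _).trans ?_
          rw [abs_mul, abs_mul, abs_abs]
      _ ≤ R * |fderiv ℝ ψ p (1, 0)| + (2 * (M * R)) * |fderiv ℝ ψ p (0, 1)| := by
          have : 0 ≤ (M : ℝ) * R := mul_nonneg M.2 hR
          gcongr
          linarith
      _ = c p * R := by simp only [c]; ring
  have hc0 : ∀ p, 0 ≤ c p := fun p => by positivity
  have key : ∀ n, 0 ≤ ∫ p, ∫ q, (b n).normed volume (q - p) • H p q := by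
    intro n
    have hbt : ∀ p : ℝ × ℝ, τ ≤ |p.1| → (b n).normed volume p = 0 := by
      intro p hp
      rw [← Function.notMem_support, (b n).support_normed_eq, Metric.mem_ball, dist_zero_right,
        not_lt]
      exact (hbτ n).trans (hp.trans (norm_fst_le p))
    have h := kruzhkov_doubled_kernel hg hUm hWm hUR hWR hU hW hψ hψc hψ0 hτ hψτ
      ((b n).contDiff_normed (μ := volume)) (b n).hasCompactSupport_normed
      (fun p => (b n).nonneg_normed p) hbt
    have iK := ((b n).continuous_normed (μ := volume)).integrable_of_hasCompactSupport
      (μ := volume) (b n).hasCompactSupport_normed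
    rw [Measure.volume_eq_prod, integral_prod_symm] at h
    · refine h.trans_eq (integral_congr_ae (Eventually.of_forall fun p => ?_))
      refine integral_congr_ae (Eventually.of_forall fun q => ?_)
      simp only [H, smul_eq_mul]
      ring
    · refine (integrable_doubled (B := R) (by fun_prop) (fun z => ?_)
        (integrable_fderiv_const hψ hψc _) iK).add (integrable_doubled (B := M * R) mQ (fun z => ?_)
        (integrable_fderiv_const hψ hψc _) iK)
      · rw [abs_abs]; exact abs_le_of_mem_Icc (hUR _) (hWR _)
      · exact (abs_kruzhkovFlux_le hg _ _).trans
          (mul_le_mul_of_nonneg_left (abs_le_of_mem_Icc (hUR _) (hWR _)) M.2)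
  have hWloc : LocallyIntegrable W := by
    refine (locallyIntegrable_const R).mono hWm.aestronglyMeasurable
      (Eventually.of_forall fun p => ?_)
    rw [Real.norm_of_nonneg (hWR p).1]
    exact (hWR p).2.trans (le_abs_self R)
  refine ge_of_tendsto' (tendsto_integral_of_dominated_convergence (fun p => c p * R) ?_
    (hc.mul_const R) ?_ ?_) key
  · intro n
    have := (b n).continuous_normed (μ := volume) |>.measurable
    have hm : StronglyMeasurable (fun z : (ℝ × ℝ) × (ℝ × ℝ) =>
        (b n).normed volume (z.2 - z.1) • H z.1 z.2) := by
      refine Measurable.stronglyMeasurable ?_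
      refine (this.comp (measurable_snd.sub measurable_fst)).smul ?_
      exact mH.comp measurable_swap
    exact hm.integral_prod_right'.aestronglyMeasurable
  · intro n
    refine Eventually.of_forall fun p => ?_
    have h1 : ∫ q, (b n).normed volume (q - p) = 1 := by
      rw [integral_sub_right_eq_self (fun q => (b n).normed volume q)]
      exact (b n).integral_normed
    have iK : Integrable (fun q => (b n).normed volume (q - p)) :=
      ((b n).continuous_normed.integrable_of_hasCompactSupport
      (μ := volume) (b n).hasCompactSupport_normed).comp_sub_right p
    calc ‖∫ q, (b n).normed volume (q - p) • H p q‖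
        ≤ ∫ q, (b n).normed volume (q - p) * (c p * R) := by
          refine norm_integral_le_of_norm_le (iK.mul_const _) (Eventually.of_forall fun q => ?_)
          rw [norm_smul, Real.norm_of_nonneg ((b n).nonneg_normed _)]
          exact mul_le_mul_of_nonneg_left (hHb p q) ((b n).nonneg_normed _)
      _ = c p * R := by rw [integral_mul_const, h1, one_mul]
  · filter_upwards [(Besicovitch.vitaliFamily
      (volume : Measure (ℝ × ℝ))).ae_tendsto_average_norm_sub hWloc] with p hp
    have hb' : Tendsto (fun n => (b n).rOut) atTop (nhdsWithin 0 (Ioi 0)) :=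
      tendsto_nhdsWithin_iff.2 ⟨hb0, Eventually.of_forall fun n => (b n).rOut_pos⟩
    have hp' := (hp.comp (Besicovitch.tendsto_filterAt volume p)).comp hb'
    have mHp : Measurable (H p) := mH.comp (measurable_id.prodMk measurable_const)
    have iH : ∀ n, IntegrableOn (H p) (Metric.closedBall p (b n).rOut) := fun n =>
      Measure.integrableOn_of_bounded (M := c p * R)
        (isCompact_closedBall p _).measure_lt_top.ne mHp.aestronglyMeasurable
        (Eventually.of_forall fun q => hHb p q)
    have iW : ∀ n, IntegrableOn W (Metric.closedBall p (b n).rOut) := fun n =>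
      hWloc.integrableOn_isCompact (isCompact_closedBall p _)
    refine tendsto_integral_smul_of_tendsto_average_norm_sub (2 ^ (Module.finrank ℝ (ℝ × ℝ)))
      (a := fun n => Metric.closedBall p (b n).rOut) ?_ (Eventually.of_forall iH) ?_ ?_ ?_
    · refine squeeze_zero (fun n => ?_) (fun n => ?_) (by simpa using hp'.const_mul (c p))
      · exact integral_nonneg fun q => norm_nonneg _
      · change _ ≤ c p * ⨍ y in Metric.closedBall p (b n).rOut, ‖W y - W p‖
        rw [average_eq, average_eq, smul_eq_mul, smul_eq_mul, mul_left_comm,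
          ← integral_const_mul (c p)]
        refine mul_le_mul_of_nonneg_left ?_ (inv_nonneg.2 measureReal_nonneg)
        have hcb : volume (Metric.closedBall p (b n).rOut) ≠ ⊤ :=
          (isCompact_closedBall p _).measure_lt_top.ne
        refine integral_mono ((iH n).sub (integrableOn_const hcb)).norm
          (((iW n).sub (integrableOn_const hcb)).norm.const_mul _) fun q => ?_
        exact hHlip p q p
    · refine tendsto_const_nhds.congr fun n => ?_
      rw [integral_sub_right_eq_self (fun q => (b n).normed volume q)]
      exact (b n).integral_normed.symm
    · refine Eventually.of_forall fun n q hq => ?_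
      have : q - p ∈ Function.support ((b n).normed volume) := hq
      rw [(b n).support_normed_eq, Metric.mem_ball, dist_zero_right] at this
      rw [Metric.mem_closedBall, dist_eq_norm]
      exact this.le
    · refine Eventually.of_forall fun n q => ?_
      rw [abs_of_nonneg ((b n).nonneg_normed _), Measure.addHaar_real_closedBall_center]
      exact (b n).normed_le_div_measure_closedBall_rOut _ _ (by
        simp only [b]; linarith) _

lemma fderiv_mul_fst_snd {a b : ℝ → ℝ} (ha : Differentiable ℝ a) (hb : Differentiable ℝ b)
    (p w : ℝ × ℝ) : fderiv ℝ (fun p : ℝ × ℝ => a p.1 * b p.2) p w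
      = w.1 * deriv a p.1 * b p.2 + w.2 * a p.1 * deriv b p.2 := by
  have h1 : HasFDerivAt (fun p : ℝ × ℝ => a p.1) _ p :=
    (ha p.1).hasDerivAt.hasFDerivAt.comp p hasFDerivAt_fst
  have h2 : HasFDerivAt (fun p : ℝ × ℝ => b p.2) _ p :=
    (hb p.2).hasDerivAt.hasFDerivAt.comp p hasFDerivAt_snd
  rw [(h1.fun_mul h2).fderiv]
  simp
  ring

lemma deriv_expNegInvGlue (x : ℝ) : deriv expNegInvGlue x = (x⁻¹) ^ 2 * expNegInvGlue x := by
  have h := (expNegInvGlue.hasDerivAt_polynomial_eval_inv_mul 1 x).deriv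
  simpa using h

lemma contDiff_comp_mul_fst_snd {a b : ℝ → ℝ} (ha : ContDiff ℝ (⊤ : ℕ∞) a)
    (hb : ContDiff ℝ (⊤ : ℕ∞) b) : ContDiff ℝ (⊤ : ℕ∞) (fun p : ℝ × ℝ => a p.1 * b p.2) :=
  (ha.comp contDiff_fst).mul (hb.comp contDiff_snd)

lemma contDiff_smoothTransition_sub_one :
    ContDiff ℝ (⊤ : ℕ∞) (fun s : ℝ => Real.smoothTransition (s - 1)) :=
  Real.smoothTransition.contDiff.comp (contDiff_id.sub contDiff_const)

/-- The derivative of the cutoff `s ↦ smoothTransition (s - 1)` is bounded and supported in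
`[1, 2]`. -/
lemma exists_abs_deriv_smoothTransition_sub_one_le :
    ∃ C : ℝ, 0 ≤ C ∧ ∀ s : ℝ, |deriv (fun s : ℝ => Real.smoothTransition (s - 1)) s|
      ≤ (Icc (1 : ℝ) 2).indicator (fun _ => C) s := by
  have hc : ContinuousOn (deriv (fun s : ℝ => Real.smoothTransition (s - 1))) (Icc 1 2) :=
    (contDiff_smoothTransition_sub_one.continuous_deriv (by simp)).continuousOn
  obtain ⟨C, hC⟩ := isCompact_Icc.exists_bound_of_continuousOn hc
  refine ⟨C, (norm_nonneg _).trans (hC 1 (by simp)), fun s => ?_⟩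
  by_cases hs : s ∈ Icc (1 : ℝ) 2
  · simpa [hs] using hC s hs
  · rw [indicator_of_notMem hs]
    rw [mem_Icc, not_and_or, not_le, not_le] at hs
    have : deriv (fun s : ℝ => Real.smoothTransition (s - 1)) s = 0 := by
      rcases hs with hs | hs
      · have : (fun s : ℝ => Real.smoothTransition (s - 1)) =ᶠ[nhds s] fun _ => 0 := by
          filter_upwards [Iio_mem_nhds hs] with y hy
          exact Real.smoothTransition.zero_of_nonpos (by linarith [mem_Iio.1 hy])
        rw [this.deriv_eq, deriv_const]
      · have : (fun s : ℝ => Real.smoothTransition (s - 1)) =ᶠ[nhds s] fun _ => 1 := by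
          filter_upwards [Ioi_mem_nhds hs] with y hy
          exact Real.smoothTransition.one_of_one_le (by linarith [mem_Ioi.1 hy])
        rw [this.deriv_eq, deriv_const]
    simp [this]

/-- Uniqueness for the Kruzhkov entropy inequalities: two solutions whose `L¹` distance
vanishes as `t → 0⁺` coincide. -/
lemma kruzhkov_unique {R : ℝ} {M : NNReal} {g : ℝ → ℝ} (hg : LipschitzWith M g)
    {U W : ℝ × ℝ → ℝ} (hUm : Measurable U) (hWm : Measurable W)
    (hUR : ∀ p, U p ∈ Icc 0 R) (hWR : ∀ p, W p ∈ Icc 0 R)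
    (hU : SatisfiesKruzhkov R g U) (hW : SatisfiesKruzhkov R g W)
    (hint : ∀ T, IntegrableOn (fun p => U p - W p) (Ioo 0 T ×ˢ univ))
    (hinit : Tendsto (fun t => ∫ x, |U (t, x) - W (t, x)|) (nhdsWithin 0 (Ioi 0)) (nhds 0)) :
    ∀ᵐ p : ℝ × ℝ, 0 < p.1 → U p = W p := by
  suffices key : ∀ T : ℕ, ∀ᵐ p : ℝ × ℝ, p.1 ∈ Ioo (0 : ℝ) T → U p = W p by
    filter_upwards [ae_all_iff.2 key] with p hp hp0
    obtain ⟨T, hT⟩ := exists_nat_gt p.1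
    exact hp T ⟨hp0, hT⟩
  intro T
  let S : Set (ℝ × ℝ) := Ioo 0 (T : ℝ) ×ˢ univ
  have hS : MeasurableSet S := measurableSet_Ioo.prod MeasurableSet.univ
  let w : ℝ × ℝ → ℝ := S.indicator fun p => |U p - W p|
  have hw : Integrable w := (integrable_indicator_iff hS).2 (hint T).abs
  have hw0 : ∀ p, 0 ≤ w p := fun p => indicator_nonneg (fun _ _ => abs_nonneg _) p
  have hwm : Measurable w := ((hUm.sub hWm).abs).indicator hS
  let η : ℝ → ℝ := fun s => Real.smoothTransition (s - 1)
  have hη : ContDiff ℝ (⊤ : ℕ∞) η := contDiff_smoothTransition_sub_one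
  obtain ⟨C, hC0, hC⟩ := exists_abs_deriv_smoothTransition_sub_one_le
  have hη0 : ∀ s, 0 ≤ η s := fun s => Real.smoothTransition.nonneg _
  have hη1 : ∀ s, η s ≤ 1 := fun s => Real.smoothTransition.le_one _
  let ζ : ℝ → ℝ := fun t => expNegInvGlue (T - t)
  have hζ : ContDiff ℝ (⊤ : ℕ∞) ζ := expNegInvGlue.contDiff.comp (contDiff_const.sub contDiff_id)
  have hζ' : ∀ t, deriv ζ t = -(((T - t)⁻¹) ^ 2 * expNegInvGlue (T - t)) := fun t => by
    rw [← deriv_expNegInvGlue, ← deriv_comp_const_sub]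
  have hζ0 : ∀ t, 0 ≤ ζ t := fun t => expNegInvGlue.nonneg _
  obtain ⟨Z, hZ⟩ := isCompact_Icc.exists_bound_of_continuousOn
    (hζ.continuous.continuousOn (s := Icc 0 (T : ℝ)))
  obtain ⟨Z', hZ'⟩ := isCompact_Icc.exists_bound_of_continuousOn
    ((hζ.continuous_deriv (by simp)).continuousOn (s := Icc 0 (T : ℝ)))
  let χ : ContDiffBump (0 : ℝ) := ⟨1, 2, one_pos, one_lt_two⟩
  have hχ : ContDiff ℝ (⊤ : ℕ∞) χ := χ.contDiff
  obtain ⟨X, hX⟩ := (hχ.continuous_deriv (by simp)).bounded_above_of_compact_support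
    χ.hasCompactSupport.deriv
  have hZ0 : 0 ≤ (max Z 0) := le_max_right _ _
  let N : ℕ → ℝ := fun n => n + 1
  have hN : ∀ n, 0 < N n := fun n => by positivity
  have hNlim : Tendsto N atTop atTop :=
    tendsto_atTop_add_const_right _ _ tendsto_natCast_atTop_atTop
  let a : ℕ → ℝ → ℝ := fun n t => η (N n * t) * ζ t
  let b : ℕ → ℝ → ℝ := fun n x => χ (x / N n)
  have ha : ∀ n, ContDiff ℝ (⊤ : ℕ∞) (a n) := fun n =>
    (hη.comp (contDiff_const.mul contDiff_id)).mul hζ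
  have hb : ∀ n, ContDiff ℝ (⊤ : ℕ∞) (b n) := fun n => hχ.comp (contDiff_id.div_const _)
  have ha' : ∀ n t, deriv (a n) t = N n * deriv η (N n * t) * ζ t + η (N n * t) * deriv ζ t := by
    intro n t
    have h1 : HasDerivAt (fun t => η (N n * t)) (deriv η (N n * t) * (N n * 1)) t :=
      ((hη.differentiable (by simp) _).hasDerivAt).comp t ((hasDerivAt_id t).const_mul _)
    rw [(h1.fun_mul ((hζ.differentiable (by simp) t).hasDerivAt)).deriv]
    ring
  have hb' : ∀ n x, deriv (b n) x = deriv χ (x / N n) / N n := by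
    intro n x
    have h1 : HasDerivAt (b n) (deriv χ (x / N n) * (1 / N n)) x :=
      ((hχ.differentiable (by simp) _).hasDerivAt).comp x ((hasDerivAt_id x).div_const _)
    rw [h1.deriv]
    ring
  have hηz : ∀ s ≤ 1, η s = 0 := fun s hs =>
    Real.smoothTransition.zero_of_nonpos (by linarith)
  let I : ℕ → ℝ × ℝ → ℝ := fun n p =>
    w p * (C * max Z 0 * N n * (Icc (1 : ℝ) 2).indicator 1 (N n * p.1))
      + w p * (η (N n * p.1) * b n p.2 * deriv ζ p.1) + w p * (M * max Z 0 * X / N n)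
  have hψ : ∀ n, ContDiff ℝ (⊤ : ℕ∞) (fun p : ℝ × ℝ => a n p.1 * b n p.2) := fun n =>
    contDiff_comp_mul_fst_snd (ha n) (hb n)
  have hψc : ∀ n, HasCompactSupport (fun p : ℝ × ℝ => a n p.1 * b n p.2) := by
    intro n
    refine HasCompactSupport.intro
      ((isCompact_Icc (a := (0 : ℝ)) (b := T)).prod
        (isCompact_Icc (a := -(2 * N n)) (b := 2 * N n))) fun p hp => ?_
    rw [mem_prod, not_and_or] at hp
    rcases hp with hp | hp
    · rw [mem_Icc, not_and_or, not_le, not_le] at hp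
      rcases hp with hp | hp
      · simp only [a]
        rw [hηz _ ((mul_nonpos_of_nonneg_of_nonpos (hN n).le hp.le).trans zero_le_one)]
        simp
      · simp only [a, ζ]
        rw [expNegInvGlue.zero_of_nonpos (by linarith)]
        simp
    · have : b n p.2 = 0 := by
        refine χ.zero_of_le_dist ?_
        rw [Real.dist_0_eq_abs, abs_div, abs_of_pos (hN n), le_div_iff₀ (hN n)]
        by_contra hlt
        exact hp (abs_le.1 (not_le.1 hlt).le)
      simp [this]
  have hψd : ∀ n (p : ℝ × ℝ), fderiv ℝ (fun p : ℝ × ℝ => a n p.1 * b n p.2) p (1, 0)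
        = deriv (a n) p.1 * b n p.2 ∧
      fderiv ℝ (fun p : ℝ × ℝ => a n p.1 * b n p.2) p (0, 1) = a n p.1 * deriv (b n) p.2 := by
    intro n p
    simp [fderiv_mul_fst_snd ((ha n).differentiable (by simp)) ((hb n).differentiable (by simp))]
  have hineq : ∀ n, 0 ≤ ∫ p, (|U p - W p| * (deriv (a n) p.1 * b n p.2)
      + kruzhkovFlux g (U p) (W p) * (a n p.1 * deriv (b n) p.2)) := by
    intro n
    have h := kruzhkov_kato (τ := (N n)⁻¹) hg hUm hWm hUR hWR hU hW (hψ n) (hψc n) ?_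
      (inv_pos.2 (hN n)) ?_
    · simpa only [hψd] using h
    · exact fun p => mul_nonneg (mul_nonneg (hη0 _) (hζ0 _)) χ.nonneg
    · intro p hp
      simp only [a]
      rw [hηz _ ?_]
      · simp
      · have := mul_lt_mul_of_pos_left hp (hN n)
        rw [mul_inv_cancel₀ (hN n).ne'] at this
        exact this.le
  have hint0 : ∀ n, Integrable fun p => |U p - W p| * (deriv (a n) p.1 * b n p.2)
      + kruzhkovFlux g (U p) (W p) * (a n p.1 * deriv (b n) p.2) := by
    intro n
    have h1 := integrable_fderiv_const (hψ n) (hψc n) (1, 0)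
    have h2 := integrable_fderiv_const (hψ n) (hψc n) (0, 1)
    simp only [hψd] at h1 h2
    refine (h1.bdd_mul (c := R) (hUm.sub hWm).abs.aestronglyMeasurable
      (Eventually.of_forall fun p => ?_)).add (h2.bdd_mul (c := M * R)
      ((continuous_kruzhkovFlux hg.continuous).measurable.comp
        (hUm.prodMk hWm)).aestronglyMeasurable (Eventually.of_forall fun p => ?_))
    · simpa using abs_le_of_mem_Icc (hUR p) (hWR p)
    · exact (abs_kruzhkovFlux_le hg _ _).trans
        (mul_le_mul_of_nonneg_left (abs_le_of_mem_Icc (hUR p) (hWR p)) M.2)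
  have hI1 : ∀ n, Integrable fun p =>
      w p * (C * max Z 0 * N n * (Icc (1 : ℝ) 2).indicator 1 (N n * p.1)) := by
    intro n
    refine hw.mul_bdd (c := C * max Z 0 * N n) ?_ (Eventually.of_forall fun p => ?_)
    · refine Measurable.aestronglyMeasurable (measurable_const.mul ?_)
      exact (measurable_one.indicator measurableSet_Icc).comp (measurable_fst.const_mul _)
    · have h0 : 0 ≤ C * max Z 0 * N n := mul_nonneg (mul_nonneg hC0 hZ0) (hN n).le
      have h1 : 0 ≤ (Icc (1 : ℝ) 2).indicator (1 : ℝ → ℝ) (N n * p.1) :=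
        indicator_nonneg (fun _ _ => zero_le_one) _
      have h2 : (Icc (1 : ℝ) 2).indicator (1 : ℝ → ℝ) (N n * p.1) ≤ 1 :=
        indicator_le_self' (f := (1 : ℝ → ℝ)) (fun _ _ => zero_le_one) _
      rw [Real.norm_of_nonneg (mul_nonneg h0 h1)]
      exact mul_le_of_le_one_right h0 h2
  have hb01 : ∀ n x, 0 ≤ b n x ∧ b n x ≤ 1 := fun n x => ⟨χ.nonneg, χ.le_one⟩
  have hwS : ∀ p ∉ S, w p = 0 := fun p hp => indicator_of_notMem hp _
  have hwS' : ∀ p ∈ S, w p = |U p - W p| := fun p hp => indicator_of_mem hp _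
  have hζbd : ∀ (p : ℝ × ℝ) (c : ℝ), |c| ≤ 1 → ‖w p * (c * deriv ζ p.1)‖ ≤ w p * Z' := by
    intro p c hc
    by_cases hp : p ∈ S
    · rw [norm_mul, Real.norm_of_nonneg (hw0 p), norm_mul]
      refine mul_le_mul_of_nonneg_left ?_ (hw0 p)
      exact (mul_le_of_le_one_left (norm_nonneg _) hc).trans (hZ' _ (Ioo_subset_Icc_self hp.1))
    · simp [hwS p hp]
  have hηb : ∀ n (p : ℝ × ℝ), |η (N n * p.1) * b n p.2| ≤ 1 := fun n p => by
    rw [abs_of_nonneg (mul_nonneg (hη0 _) (hb01 _ _).1)]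
    exact mul_le_one₀ (hη1 _) (hb01 _ _).1 (hb01 _ _).2
  have hζ'm : Measurable fun p : ℝ × ℝ => deriv ζ p.1 :=
    (hζ.continuous_deriv (by simp)).measurable.comp measurable_fst
  have hm2 : ∀ n, Measurable fun p => w p * (η (N n * p.1) * b n p.2 * deriv ζ p.1) := fun n =>
    hwm.mul ((((hη.continuous.measurable).comp (measurable_fst.const_mul _)).mul
      ((hb n).continuous.measurable.comp measurable_snd)).mul hζ'm)
  have hI2 : ∀ n, Integrable fun p => w p * (η (N n * p.1) * b n p.2 * deriv ζ p.1) := fun n =>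
    (hw.mul_const Z').mono' (hm2 n).aestronglyMeasurable
      (Eventually.of_forall fun p => hζbd p _ (hηb n p))
  have hI3 : ∀ n, Integrable fun p => w p * (M * max Z 0 * X / N n) := fun n =>
    hw.mul_const _
  have hle : ∀ n p, |U p - W p| * (deriv (a n) p.1 * b n p.2)
      + kruzhkovFlux g (U p) (W p) * (a n p.1 * deriv (b n) p.2) ≤ I n p := by
    intro n p
    by_cases hp : p ∈ S
    · have hpT := Ioo_subset_Icc_self hp.1
      have hζZ : ζ p.1 ≤ max Z 0 := (le_abs_self _).trans ((hZ _ hpT).trans (le_max_left _ _))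
      have hind : 0 ≤ (Icc (1 : ℝ) 2).indicator (1 : ℝ → ℝ) (N n * p.1) :=
        indicator_nonneg (fun _ _ => zero_le_one) _
      have h1 : N n * deriv η (N n * p.1) * ζ p.1 * b n p.2
          ≤ C * max Z 0 * N n * (Icc (1 : ℝ) 2).indicator 1 (N n * p.1) := by
        have hd : deriv η (N n * p.1) ≤ C * (Icc (1 : ℝ) 2).indicator 1 (N n * p.1) := by
          refine (le_abs_self _).trans ((hC _).trans_eq ?_)
          by_cases h : N n * p.1 ∈ Icc (1 : ℝ) 2 <;> simp [h]
        calc N n * deriv η (N n * p.1) * ζ p.1 * b n p.2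
            = deriv η (N n * p.1) * (N n * ζ p.1 * b n p.2) := by ring
          _ ≤ (C * (Icc (1 : ℝ) 2).indicator 1 (N n * p.1)) * (N n * ζ p.1 * b n p.2) :=
            mul_le_mul_of_nonneg_right hd
              (mul_nonneg (mul_nonneg (hN n).le (hζ0 _)) (hb01 _ _).1)
          _ ≤ (C * (Icc (1 : ℝ) 2).indicator 1 (N n * p.1)) * (N n * max Z 0 * 1) := by
            refine mul_le_mul_of_nonneg_left ?_ (mul_nonneg hC0 hind)
            exact mul_le_mul (mul_le_mul_of_nonneg_left hζZ (hN n).le) (hb01 _ _).2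
              (hb01 _ _).1 (mul_nonneg (hN n).le hZ0)
          _ = _ := by ring
      have h2 : kruzhkovFlux g (U p) (W p) * (a n p.1 * deriv (b n) p.2)
          ≤ w p * (M * max Z 0 * X / N n) := by
        refine (le_abs_self _).trans ?_
        rw [abs_mul, abs_mul, hb', abs_div, abs_of_pos (hN n), hwS' p hp]
        have h3 := abs_kruzhkovFlux_le hg (U p) (W p)
        have h4 : |a n p.1| ≤ max Z 0 := by
          rw [abs_of_nonneg (mul_nonneg (hη0 _) (hζ0 _))]
          exact (mul_le_of_le_one_left (hζ0 _) (hη1 _)).trans hζZ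
        have h5 : |deriv χ (p.2 / N n)| ≤ X := hX _
        have h6 : 0 ≤ X := (abs_nonneg _).trans h5
        have h7 := hN n
        have h8 : 0 ≤ (M : ℝ) * |U p - W p| := mul_nonneg M.2 (abs_nonneg _)
        calc |kruzhkovFlux g (U p) (W p)| * (|a n p.1| * (|deriv χ (p.2 / N n)| / N n))
            ≤ (M * |U p - W p|) * (max Z 0 * (X / N n)) := by gcongr
          _ = _ := by ring
      have h9 := mul_le_mul_of_nonneg_left h1 (hw0 p)
      simp only [I]
      rw [← hwS' p hp, ha']
      refine add_le_add ?_ h2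
      calc w p * ((N n * deriv η (N n * p.1) * ζ p.1 + η (N n * p.1) * deriv ζ p.1) * b n p.2)
          = w p * (N n * deriv η (N n * p.1) * ζ p.1 * b n p.2)
            + w p * (η (N n * p.1) * b n p.2 * deriv ζ p.1) := by ring
        _ ≤ _ := by gcongr
    · have h0 : a n p.1 = 0 ∧ deriv (a n) p.1 = 0 := by
        rw [ha']
        by_cases h : p.1 ≤ 0
        · have h1 : N n * p.1 ≤ 0 := mul_nonpos_of_nonneg_of_nonpos (hN n).le h
          have h2 : η (N n * p.1) = 0 := hηz _ (h1.trans zero_le_one)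
          have h3 : deriv η (N n * p.1) = 0 := by
            have := hC (N n * p.1)
            rw [indicator_of_notMem (fun h => by linarith [h.1])] at this
            exact abs_nonpos_iff.1 this
          exact ⟨by simp only [a]; rw [h2, zero_mul], by rw [h2, h3]; ring⟩
        · have h1 : T - p.1 ≤ 0 := by
            by_contra hlt
            exact hp ⟨⟨not_le.1 h, by linarith⟩, mem_univ _⟩
          have h2 : ζ p.1 = 0 := expNegInvGlue.zero_of_nonpos h1
          have h3 : deriv ζ p.1 = 0 := by
            rw [hζ', expNegInvGlue.zero_of_nonpos h1]; ring
          exact ⟨by simp only [a]; rw [h2, mul_zero], by rw [h2, h3]; ring⟩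
      simp [I, hwS p hp, h0.1, h0.2]
  have hA : ∀ δ > 0, ∀ᶠ n in atTop, ∫ p, w p * (C * max Z 0 * N n *
      (Icc (1 : ℝ) 2).indicator 1 (N n * p.1)) ≤ C * max Z 0 * δ := by
    intro δ hδ
    obtain ⟨r, hr0, hr⟩ := mem_nhdsGT_iff_exists_Ioo_subset.1 (hinit.eventually_le_const hδ)
    have hmδ : ∀ t ∈ Ioo 0 r, ∫ x, w (t, x) ≤ δ := by
      intro t ht
      by_cases htT : t ∈ Ioo (0 : ℝ) T
      · have : (fun x => w (t, x)) = fun x => |U (t, x) - W (t, x)| :=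
          funext fun x => hwS' _ ⟨htT, mem_univ _⟩
        rw [this]
        exact hr ht
      · have : (fun x => w (t, x)) = fun x => 0 := funext fun x => hwS _ fun h => htT h.1
        rw [this]
        simpa using hδ.le
    filter_upwards [hNlim.eventually_gt_atTop (2 / r)] with n hn
    have hc : 0 ≤ C * max Z 0 * N n := mul_nonneg (mul_nonneg hC0 hZ0) (hN n).le
    have hind : ∀ t, 0 ≤ (Icc (1 : ℝ) 2).indicator (1 : ℝ → ℝ) t :=
      fun t => indicator_nonneg (fun _ _ => zero_le_one) _
    have hii : Integrable ((Icc (1 : ℝ) 2).indicator (1 : ℝ → ℝ)) :=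
      (integrable_indicator_iff measurableSet_Icc).2 (integrableOn_const (by simp))
    have hint1 : ∫ t, (Icc (1 : ℝ) 2).indicator (1 : ℝ → ℝ) (N n * t) = (N n)⁻¹ := by
      rw [Measure.integral_comp_mul_left, integral_indicator_one measurableSet_Icc,
        abs_of_pos (inv_pos.2 (hN n))]
      norm_num
    rw [Measure.volume_eq_prod, integral_prod _ (hI1 n)]
    simp only [integral_mul_const]
    calc ∫ t, (∫ x, w (t, x)) * (C * max Z 0 * N n * (Icc (1 : ℝ) 2).indicator 1 (N n * t))
        ≤ ∫ t, δ * (C * max Z 0 * N n * (Icc (1 : ℝ) 2).indicator 1 (N n * t)) := by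
          refine integral_mono_of_nonneg (Eventually.of_forall fun t => ?_) ?_
            (Eventually.of_forall fun t => ?_)
          · exact mul_nonneg (integral_nonneg fun x => hw0 _) (mul_nonneg hc (hind _))
          · exact ((hii.comp_mul_left' (hN n).ne').const_mul _).const_mul _
          · by_cases h : N n * t ∈ Icc (1 : ℝ) 2
            · refine mul_le_mul_of_nonneg_right (hmδ t ⟨?_, ?_⟩) (mul_nonneg hc (hind _))
              · exact pos_of_mul_pos_right (zero_lt_one.trans_le h.1) (hN n).le
              · rw [div_lt_iff₀ hr0] at hn
                exact lt_of_mul_lt_mul_left (h.2.trans_lt hn) (hN n).le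
            · simp [h]
      _ = C * max Z 0 * δ := by
          rw [integral_const_mul, integral_const_mul, hint1]
          have := (hN n).ne'
          field_simp
  have hB : Tendsto (fun n => ∫ p, w p * (η (N n * p.1) * b n p.2 * deriv ζ p.1)) atTop
      (nhds (∫ p, w p * deriv ζ p.1)) := by
    refine tendsto_integral_of_dominated_convergence (fun p => w p * Z')
      (fun n => (hm2 n).aestronglyMeasurable) (hw.mul_const _)
      (fun n => Eventually.of_forall fun p => hζbd p _ (hηb n p))
      (Eventually.of_forall fun p => ?_)
    by_cases hp : p ∈ S
    · refine tendsto_const_nhds.congr' ?_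
      filter_upwards [hNlim.eventually_ge_atTop (2 / p.1), hNlim.eventually_ge_atTop |p.2|]
        with n h1 h2
      rw [div_le_iff₀ hp.1.1] at h1
      have h3 : η (N n * p.1) = 1 := Real.smoothTransition.one_of_one_le (by linarith)
      have h4 : b n p.2 = 1 := by
        refine χ.one_of_mem_closedBall ?_
        rw [mem_closedBall_zero_iff, Real.norm_eq_abs, abs_div, abs_of_pos (hN n)]
        exact (div_le_one (hN n)).2 h2
      rw [h3, h4]
      ring
    · simp [hwS p hp]
  have hD : Tendsto (fun n => ∫ p, w p * (M * max Z 0 * X / N n)) atTop (nhds 0) := by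
    simp only [integral_mul_const]
    simpa using (hNlim.const_div_atTop (M * max Z 0 * X)).const_mul (∫ p, w p)
  have hfin : 0 ≤ ∫ p, w p * deriv ζ p.1 := by
    have hδ : ∀ δ > 0, 0 ≤ C * max Z 0 * δ + (∫ p, w p * deriv ζ p.1) + 0 := by
      intro δ hδ
      refine ge_of_tendsto ((tendsto_const_nhds.add hB).add hD) ?_
      filter_upwards [hA δ hδ] with n hn
      have h12 := integral_add (hI1 n) (hI2 n)
      have h123 := integral_add ((hI1 n).add (hI2 n)) (hI3 n)
      simp only [Pi.add_apply] at h123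
      rw [h12] at h123
      have hI : 0 ≤ ∫ p, I n p :=
        (hineq n).trans
          (integral_mono (hint0 n) (((hI1 n).add (hI2 n)).add (hI3 n)) (hle n))
      linarith
    have hlim : Tendsto (fun δ : ℝ => C * max Z 0 * δ + (∫ p, w p * deriv ζ p.1) + 0)
        (nhdsWithin 0 (Ioi 0)) (nhds (C * max Z 0 * 0 + (∫ p, w p * deriv ζ p.1) + 0)) :=
      ((by fun_prop : Continuous fun δ : ℝ =>
        C * max Z 0 * δ + (∫ p, w p * deriv ζ p.1) + 0).tendsto 0).mono_left nhdsWithin_le_nhds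
    have := ge_of_tendsto hlim (eventually_mem_nhdsWithin.mono hδ)
    simpa using this
  have hIi : Integrable fun p => w p * deriv ζ p.1 :=
    (hw.mul_const Z').mono' (hwm.mul hζ'm).aestronglyMeasurable
      (Eventually.of_forall fun p => by simpa using hζbd p 1 (by simp))
  have hζn : ∀ p, w p * deriv ζ p.1 ≤ 0 := fun p => by
    refine mul_nonpos_of_nonneg_of_nonpos (hw0 p) ?_
    rw [hζ']
    exact neg_nonpos.2 (mul_nonneg (sq_nonneg _) (expNegInvGlue.nonneg _))
  have hz : (fun p => -(w p * deriv ζ p.1)) =ᵐ[volume] 0 := by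
    rw [← integral_eq_zero_iff_of_nonneg (fun p => neg_nonneg.2 (hζn p)) hIi.neg, integral_neg]
    exact le_antisymm (neg_nonpos.2 hfin) (by
      rw [← integral_neg]; exact integral_nonneg fun p => neg_nonneg.2 (hζn p))
  filter_upwards [hz] with p hp hpT
  have hlt : deriv ζ p.1 ≠ 0 := by
    rw [hζ']
    have h1 : 0 < T - p.1 := sub_pos.2 hpT.2
    have := expNegInvGlue.pos_of_pos h1
    have : 0 < ((T - p.1)⁻¹) ^ 2 * expNegInvGlue (T - p.1) := by positivity
    linarith
  have hwz : w p = 0 := by simpa [hlt] using hp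
  have hpS : p ∈ S := ⟨hpT, mem_univ _⟩
  simp only [w, indicator_of_mem hpS, abs_eq_zero] at hwz
  exact sub_eq_zero.1 hwz

/-- A Lipschitz function is uniformly approximated by smooth functions with the same Lipschitz
bound. -/
lemma LipschitzWith.exists_contDiff_approx {L : NNReal} {f : ℝ → ℝ} (hf : LipschitzWith L f)
    {ε : ℝ} (hε : 0 < ε) :
    ∃ h : ℝ → ℝ, ContDiff ℝ (⊤ : ℕ∞) h ∧ (∀ t, |h t - f t| ≤ ε) ∧ ∀ t, |deriv h t| ≤ L := by
  let r : ℝ := ε / (L + 1)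
  have hL : (0 : ℝ) < L + 1 := by positivity
  have hr : 0 < r := div_pos hε hL
  let β : ContDiffBump (0 : ℝ) := ⟨r / 2, r, half_pos hr, half_lt_self hr⟩
  let h : ℝ → ℝ := convolution (β.normed volume) f (ContinuousLinearMap.lsmul ℝ ℝ) volume
  have hval : ∀ t, h t = ∫ s, β.normed volume s * f (t - s) := fun t => by
    simp [h, convolution_def]
  have hint : ∀ t, Integrable fun s => β.normed volume s * f (t - s) := fun t =>
    ((β.continuous_normed).mul (hf.continuous.comp (by fun_prop))).integrable_of_hasCompactSupport
      β.hasCompactSupport_normed.mul_right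
  have hlip : LipschitzWith L h := by
    refine LipschitzWith.of_dist_le_mul fun t u => ?_
    rw [Real.dist_eq, hval, hval, ← integral_sub (hint t) (hint u)]
    have hb : ∀ s, ‖β.normed volume s * f (t - s) - β.normed volume s * f (u - s)‖
        ≤ β.normed volume s * (L * dist t u) := fun s => by
      rw [← mul_sub, norm_mul, Real.norm_of_nonneg (β.nonneg_normed s)]
      refine mul_le_mul_of_nonneg_left ?_ (β.nonneg_normed s)
      simpa [Real.dist_eq] using hf.dist_le_mul (t - s) (u - s)
    have := norm_integral_le_of_norm_le (β.integrable_normed.mul_const _)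
      (Eventually.of_forall hb)
    rwa [integral_mul_const, β.integral_normed, one_mul] at this
  refine ⟨h, ?_, fun t => ?_, fun t => ?_⟩
  · exact β.hasCompactSupport_normed.contDiff_convolution_left _ β.contDiff_normed
      hf.continuous.locallyIntegrable
  · have := β.dist_normed_convolution_le (μ := volume) (x₀ := t) (ε := ε) (g := f)
      hf.continuous.aestronglyMeasurable fun x hx => ?_
    · simpa [Real.dist_eq] using this
    · refine (hf.dist_le_mul _ _).trans ?_
      have h1 : dist x t ≤ ε / (L + 1) := (Metric.mem_ball.1 hx).le
      calc (L : ℝ) * dist x t ≤ (L + 1) * (ε / (L + 1)) := by gcongr; linarith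
        _ = ε := by field_simp
  · simpa using norm_deriv_le_of_lipschitz hlip (x₀ := t)

lemma integral_fderiv_const_eq_zero {φ : ℝ × ℝ → ℝ} (hφ : ContDiff ℝ (⊤ : ℕ∞) φ)
    (hc : HasCompactSupport φ) (w : ℝ × ℝ) : ∫ p, fderiv ℝ φ p w = 0 := by
  have h := integral_mul_fderiv_eq_neg_fderiv_mul_of_integrable (μ := volume) (v := w)
    (f := fun _ : ℝ × ℝ => (1 : ℝ)) (g := φ) (by simp)
    (by simpa using integrable_fderiv_const hφ hc w)
    (by simpa using hφ.continuous.integrable_of_hasCompactSupport (μ := volume) hc)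
    (by simp) (fun x _ => hφ.differentiable (by simp) x)
  simpa using h

/-- The mean value of a bounded function over shrinking strips around a curve, along which its
essential limit vanishes, tends to zero. -/
lemma tendsto_integral_strip {R T : ℝ} {U : ℝ × ℝ → ℝ} {ξ : ℝ → ℝ} (hUm : Measurable U)
    (hUR : ∀ p, U p ∈ Icc 0 R) (hξ : Continuous ξ)
    (htr : ∀ᵐ t, 0 < t → ∀ δ > 0, ∀ᶠ x in nhds (ξ t) ⊓ ae volume, U (t, x) ≤ δ) :
    (∀ n : ℕ, Integrable fun p : ℝ × ℝ => (Icc 0 T).indicator (1 : ℝ → ℝ) p.1 *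
      (U p * ((n + 1) * (Icc (-3) 3).indicator (1 : ℝ → ℝ) ((n + 1) * (p.2 - ξ p.1))))) ∧
    Tendsto (fun n : ℕ => ∫ p : ℝ × ℝ, (Icc 0 T).indicator (1 : ℝ → ℝ) p.1 *
      (U p * ((n + 1) * (Icc (-3) 3).indicator (1 : ℝ → ℝ) ((n + 1) * (p.2 - ξ p.1)))))
      atTop (nhds 0) := by
  have hind : ∀ s : ℝ, 0 ≤ (Icc (-3) 3).indicator (1 : ℝ → ℝ) s := fun s =>
    indicator_nonneg (fun _ _ => zero_le_one) _
  have hindm : Measurable ((Icc (-3) 3).indicator (1 : ℝ → ℝ)) :=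
    measurable_one.indicator measurableSet_Icc
  have hindT : Measurable ((Icc 0 T).indicator (1 : ℝ → ℝ)) :=
    measurable_one.indicator measurableSet_Icc
  have hR : 0 ≤ R := (hUR 0).1.trans (hUR 0).2
  have hii : Integrable ((Icc (-3 : ℝ) 3).indicator (1 : ℝ → ℝ)) :=
    (integrable_indicator_iff measurableSet_Icc).2 (integrableOn_const (by simp))
  have hpos : ∀ n : ℕ, (0 : ℝ) < n + 1 := fun n => by positivity
  have hiin : ∀ (n : ℕ) (t : ℝ), Integrable fun x : ℝ =>
      (Icc (-3) 3).indicator (1 : ℝ → ℝ) ((n + 1) * (x - ξ t)) := fun n t =>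
    (hii.comp_mul_left' (hpos n).ne').comp_sub_right (ξ t)
  have hival : ∀ (n : ℕ) (t : ℝ),
      ∫ x : ℝ, (n + 1) * (Icc (-3) 3).indicator (1 : ℝ → ℝ) ((n + 1) * (x - ξ t)) = 6 := by
    intro n t
    rw [integral_const_mul, integral_sub_right_eq_self
      (fun x => (Icc (-3) 3).indicator (1 : ℝ → ℝ) ((n + 1) * x)),
      Measure.integral_comp_mul_left, integral_indicator_one measurableSet_Icc,
      abs_of_pos (inv_pos.2 (hpos n))]
    have := (hpos n).ne'
    simp
    field_simp
    norm_num
  have hmeas : ∀ n : ℕ, Measurable fun p : ℝ × ℝ => (Icc 0 T).indicator (1 : ℝ → ℝ) p.1 *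
      (U p * ((n + 1) * (Icc (-3) 3).indicator (1 : ℝ → ℝ) ((n + 1) * (p.2 - ξ p.1)))) := fun n =>
    (hindT.comp measurable_fst).mul (hUm.mul (measurable_const.mul (hindm.comp
      (measurable_const.mul (measurable_snd.sub (hξ.measurable.comp measurable_fst))))))
  have hJ : ∀ n : ℕ, Integrable fun p : ℝ × ℝ => (Icc 0 T).indicator (1 : ℝ → ℝ) p.1 *
      (U p * ((n + 1) * (Icc (-3) 3).indicator (1 : ℝ → ℝ) ((n + 1) * (p.2 - ξ p.1)))) := by
    intro n
    obtain ⟨X, hX⟩ := isCompact_Icc.exists_bound_of_continuousOn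
      (hξ.continuousOn (s := Icc 0 T))
    have hK : MeasurableSet (Icc 0 T ×ˢ Icc (-(X + 3)) (X + 3) : Set (ℝ × ℝ)) :=
      measurableSet_Icc.prod measurableSet_Icc
    refine Integrable.mono' (g := (Icc 0 T ×ˢ Icc (-(X + 3)) (X + 3)).indicator
      fun _ => R * (n + 1)) ((integrable_indicator_iff hK).2 (integrableOn_const
      (isCompact_Icc.prod isCompact_Icc).measure_lt_top.ne)) (hmeas n).aestronglyMeasurable
      (Eventually.of_forall fun p => ?_)
    by_cases hT : p.1 ∈ Icc 0 T
    · by_cases hx : (n + 1) * (p.2 - ξ p.1) ∈ Icc (-3 : ℝ) 3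
      · have h1 : |p.2 - ξ p.1| ≤ 3 := by
          have h2 : (n + 1) * |p.2 - ξ p.1| ≤ 3 := by
            rw [← abs_of_pos (hpos n), ← abs_mul]
            exact abs_le.2 hx
          exact (le_mul_of_one_le_left (abs_nonneg _) (by simp)).trans h2
        have h3 : |p.2| ≤ X + 3 := by
          have := abs_add_le (p.2 - ξ p.1) (ξ p.1)
          have := hX _ hT
          rw [Real.norm_eq_abs] at this
          rw [sub_add_cancel] at *
          linarith
        have hp : p ∈ Icc 0 T ×ˢ Icc (-(X + 3)) (X + 3) := ⟨hT, abs_le.1 h3⟩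
        rw [indicator_of_mem hp, indicator_of_mem hT, indicator_of_mem hx]
        simp only [Pi.one_apply, one_mul, mul_one]
        rw [Real.norm_of_nonneg (mul_nonneg (hUR p).1 (hpos n).le)]
        exact mul_le_mul_of_nonneg_right (hUR p).2 (hpos n).le
      · rw [indicator_of_notMem hx]
        simp only [mul_zero, norm_zero]
        exact indicator_nonneg (fun _ _ => mul_nonneg hR (hpos n).le) _
    · rw [indicator_of_notMem hT]
      simp only [zero_mul, norm_zero]
      exact indicator_nonneg (fun _ _ => mul_nonneg hR (hpos n).le) _
  refine ⟨hJ, ?_⟩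
  have hprod : ∀ n : ℕ, ∫ p : ℝ × ℝ, (Icc 0 T).indicator (1 : ℝ → ℝ) p.1 *
      (U p * ((n + 1) * (Icc (-3) 3).indicator (1 : ℝ → ℝ) ((n + 1) * (p.2 - ξ p.1))))
      = ∫ t, (Icc 0 T).indicator (1 : ℝ → ℝ) t *
        ∫ x, U (t, x) * ((n + 1) * (Icc (-3) 3).indicator (1 : ℝ → ℝ) ((n + 1) * (x - ξ t))) := by
    intro n
    rw [Measure.volume_eq_prod, integral_prod _ (hJ n)]
    simp only [integral_const_mul]
  simp only [hprod]
  have hbd : ∀ (n : ℕ) (t δ : ℝ), (∀ᵐ x, (n + 1) * (x - ξ t) ∈ Icc (-3 : ℝ) 3 → U (t, x) ≤ δ) →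
      ∫ x, U (t, x) * ((n + 1) * (Icc (-3) 3).indicator (1 : ℝ → ℝ) ((n + 1) * (x - ξ t)))
        ≤ δ * 6 := by
    intro n t δ h
    rw [← hival n t, ← integral_const_mul]
    refine integral_mono_of_nonneg (Eventually.of_forall fun x => mul_nonneg (hUR _).1
      (mul_nonneg (hpos n).le (hind _))) (((hiin n t).const_mul _).const_mul _) ?_
    filter_upwards [h] with x hx
    by_cases h' : (n + 1) * (x - ξ t) ∈ Icc (-3 : ℝ) 3
    · exact mul_le_mul_of_nonneg_right (hx h') (mul_nonneg (hpos n).le (hind _))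
    · simp [h']
  have hnn : ∀ (n : ℕ) (t : ℝ), 0 ≤ ∫ x, U (t, x) *
      ((n + 1) * (Icc (-3) 3).indicator (1 : ℝ → ℝ) ((n + 1) * (x - ξ t))) := fun n t =>
    integral_nonneg fun x => mul_nonneg (hUR _).1 (mul_nonneg (hpos n).le (hind _))
  have hlim := tendsto_integral_of_dominated_convergence (μ := volume)
    (F := fun (n : ℕ) t => (Icc 0 T).indicator (1 : ℝ → ℝ) t *
        ∫ x, U (t, x) * ((n + 1) * (Icc (-3) 3).indicator (1 : ℝ → ℝ) ((n + 1) * (x - ξ t))))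
    (f := fun _ => 0) (fun t => (Icc 0 T).indicator (1 : ℝ → ℝ) t * (R * 6))
    (fun n => ?_) ?_ (fun n => Eventually.of_forall fun t => ?_) ?_
  · simpa using hlim
  · simpa only [integral_const_mul] using (hJ n).integral_prod_left.aestronglyMeasurable
  · exact ((integrable_indicator_iff measurableSet_Icc).2
      (integrableOn_const (by simp))).mul_const _
  · have h0 : 0 ≤ (Icc 0 T).indicator (1 : ℝ → ℝ) t :=
      indicator_nonneg (fun _ _ => zero_le_one) _
    rw [Real.norm_of_nonneg (mul_nonneg h0 (hnn n t))]
    exact mul_le_mul_of_nonneg_left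
      (hbd n t R (Eventually.of_forall fun x _ => (hUR _).2)) h0
  · filter_upwards [htr, Measure.ae_ne volume (0 : ℝ)] with t ht ht0
    by_cases hT : t ∈ Icc 0 T
    · rw [indicator_of_mem hT]
      simp only [Pi.one_apply, one_mul]
      refine Metric.tendsto_atTop.2 fun ε hε => ?_
      obtain ⟨s, hs, s', hs', hss⟩ := mem_inf_iff_superset.1
        (ht (hT.1.lt_of_ne' ht0) (ε / 7) (by positivity))
      obtain ⟨r, hr, hrs⟩ := Metric.mem_nhds_iff.1 hs
      obtain ⟨n₀, hn₀⟩ := exists_nat_gt (3 / r)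
      refine ⟨n₀, fun n hn => ?_⟩
      rw [Real.dist_0_eq_abs, abs_of_nonneg (hnn n t)]
      refine (hbd n t (ε / 7) ?_).trans_lt (by linarith)
      filter_upwards [hs'] with x hx hmem
      refine hss ⟨hrs ?_, hx⟩
      rw [Metric.mem_ball, Real.dist_eq]
      have h2 : (n + 1) * |x - ξ t| ≤ 3 := by
        rw [← abs_of_pos (hpos n), ← abs_mul]
        exact abs_le.2 hmem
      have h3 : 3 < (n + 1) * r := by
        rw [div_lt_iff₀ hr] at hn₀
        have : (n₀ : ℝ) ≤ n := by exact_mod_cast hn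
        nlinarith
      exact lt_of_mul_lt_mul_left (h2.trans_lt h3) (hpos n).le
    · simp [indicator_of_notMem hT]

/-- A function which vanishes on one side of a Lipschitz curve, has vanishing trace on it, and
satisfies the entropy inequalities on the other side, satisfies them globally. -/
lemma satisfiesKruzhkov_of_trace_eq_zero {R σ : ℝ} {M L : NNReal} {g ξ : ℝ → ℝ} {U : ℝ × ℝ → ℝ}
    (hg : LipschitzWith M g) (hξ : LipschitzWith L ξ) (hσ : |σ| = 1) (hUm : Measurable U)
    (hUR : ∀ p, U p ∈ Icc 0 R) (hU0 : ∀ p : ℝ × ℝ, σ * (p.2 - ξ p.1) ≤ 0 → U p = 0)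
    (htr : ∀ᵐ t, 0 < t → ∀ δ > 0, ∀ᶠ x in nhds (ξ t) ⊓ ae volume, U (t, x) ≤ δ)
    (hloc : ∀ k ∈ Icc (0 : ℝ) R, ∀ φ : ℝ × ℝ → ℝ,
      ContDiff ℝ (⊤ : ℕ∞) φ → HasCompactSupport φ →
      (∀ p : ℝ × ℝ, p.1 ≤ 0 → φ p = 0) → (∀ p : ℝ × ℝ, 0 ≤ φ p) →
      (∃ ε > 0, ∀ p : ℝ × ℝ, σ * (p.2 - ξ p.1) < ε → φ p = 0) →
      0 ≤ ∫ p, (|U p - k| * fderiv ℝ φ p (1, 0)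
        + kruzhkovFlux g (U p) k * fderiv ℝ φ p (0, 1))) :
    SatisfiesKruzhkov R g U := by
  intro k hk φ hφ hφc hφt hφ0
  let η : ℝ → ℝ := fun s => Real.smoothTransition (s - 1)
  have hη : ContDiff ℝ (⊤ : ℕ∞) η := contDiff_smoothTransition_sub_one
  obtain ⟨C, hC0, hC⟩ := exists_abs_deriv_smoothTransition_sub_one_le
  have hη0 : ∀ s, 0 ≤ η s := fun s => Real.smoothTransition.nonneg _
  have hη1 : ∀ s, η s ≤ 1 := fun s => Real.smoothTransition.le_one _
  have hηz : ∀ s ≤ 1, η s = 0 := fun s hs => Real.smoothTransition.zero_of_nonpos (by linarith)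
  have hηo : ∀ s, 2 ≤ s → η s = 1 := fun s hs =>
    Real.smoothTransition.one_of_one_le (by linarith)
  let N : ℕ → ℝ := fun n => n + 1
  have hN : ∀ n, 0 < N n := fun n => by positivity
  have hNlim : Tendsto N atTop atTop :=
    tendsto_atTop_add_const_right _ _ tendsto_natCast_atTop_atTop
  choose h hh hhξ hhL using fun n =>
    hξ.exists_contDiff_approx (ε := (N n)⁻¹ / 2) (half_pos (inv_pos.2 (hN n)))
  let s : ℕ → ℝ × ℝ → ℝ := fun n p => N n * (σ * (p.2 - h n p.1))
  have hsd : ∀ n (p : ℝ × ℝ), HasFDerivAt (s n)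
      (N n • σ • (ContinuousLinearMap.snd ℝ ℝ ℝ
        - (ContinuousLinearMap.toSpanSingleton ℝ (deriv (h n) p.1)).comp
          (ContinuousLinearMap.fst ℝ ℝ ℝ))) p := by
    intro n p
    have h1 : HasFDerivAt (fun p : ℝ × ℝ => h n p.1) _ p :=
      ((hh n).differentiable (by simp) p.1).hasDerivAt.hasFDerivAt.comp p hasFDerivAt_fst
    exact ((hasFDerivAt_snd.sub h1).const_mul σ).const_mul (N n)
  have hs : ∀ n, ContDiff ℝ (⊤ : ℕ∞) (s n) := fun n =>
    contDiff_const.mul (contDiff_const.mul (contDiff_snd.sub ((hh n).comp contDiff_fst)))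
  have hssub : ∀ n (p : ℝ × ℝ), |s n p - N n * (σ * (p.2 - ξ p.1))| ≤ 1 / 2 := by
    intro n p
    have h1 : s n p - N n * (σ * (p.2 - ξ p.1)) = N n * (σ * (ξ p.1 - h n p.1)) := by
      simp only [s]; ring
    rw [h1, abs_mul, abs_mul, hσ, abs_of_pos (hN n), one_mul, abs_sub_comm]
    calc N n * |h n p.1 - ξ p.1| ≤ N n * ((N n)⁻¹ / 2) :=
          mul_le_mul_of_nonneg_left (hhξ n p.1) (hN n).le
      _ = 1 / 2 := by rw [mul_div_assoc', mul_inv_cancel₀ (hN n).ne']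
  let ψ : ℕ → ℝ × ℝ → ℝ := fun n p => φ p * η (s n p)
  have hψ : ∀ n, ContDiff ℝ (⊤ : ℕ∞) (ψ n) := fun n => hφ.mul (hη.comp (hs n))
  have hψc : ∀ n, HasCompactSupport (ψ n) := fun n => hφc.mul_right
  have hψd : ∀ n (p w : ℝ × ℝ), fderiv ℝ (ψ n) p w = fderiv ℝ φ p w * η (s n p)
      + φ p * (deriv η (s n p) * (N n * (σ * (w.2 - w.1 * deriv (h n) p.1)))) := by
    intro n p w
    have h1 : HasFDerivAt (fun p => η (s n p)) _ p :=
      ((hη.differentiable (by simp) (s n p)).hasDerivAt.hasFDerivAt).comp p (hsd n p)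
    have h2 : HasFDerivAt φ (fderiv ℝ φ p) p := (hφ.differentiable (by simp) p).hasFDerivAt
    rw [show ψ n = fun p => φ p * η (s n p) from rfl, (h2.fun_mul h1).fderiv]
    simp
    ring
  let A : ℝ × ℝ → ℝ := fun p => |U p - k| - k
  let B : ℝ × ℝ → ℝ := fun p => kruzhkovFlux g (U p) k - kruzhkovFlux g 0 k
  have hAm : Measurable A := (hUm.sub_const k).abs.sub_const k
  have hBm : Measurable B :=
    ((continuous_kruzhkovFlux hg.continuous).measurable.comp
      (hUm.prodMk measurable_const)).sub_const _
  have hA : ∀ p, |A p| ≤ U p := by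
    intro p
    have := abs_abs_sub_abs_le_abs_sub (U p - k) (0 - k)
    rw [sub_sub_sub_cancel_right, sub_zero, zero_sub, abs_neg, abs_of_nonneg hk.1,
      abs_of_nonneg (hUR p).1] at this
    exact this
  have hB : ∀ p, |B p| ≤ 2 * M * U p := by
    intro p
    have := abs_kruzhkovFlux_sub_le hg k (U p) 0
    rw [sub_zero, abs_of_nonneg (hUR p).1] at this
    simpa only [B, kruzhkovFlux_comm g (U p), kruzhkovFlux_comm g 0] using this
  have hAB : ∀ χ : ℝ × ℝ → ℝ, ContDiff ℝ (⊤ : ℕ∞) χ → HasCompactSupport χ →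
      Integrable (fun p => A p * fderiv ℝ χ p (1, 0) + B p * fderiv ℝ χ p (0, 1)) ∧
      ∫ p, (|U p - k| * fderiv ℝ χ p (1, 0) + kruzhkovFlux g (U p) k * fderiv ℝ χ p (0, 1))
        = ∫ p, (A p * fderiv ℝ χ p (1, 0) + B p * fderiv ℝ χ p (0, 1)) := by
    intro χ hχ hχc
    have i1 := integrable_fderiv_const hχ hχc (1, 0)
    have i2 := integrable_fderiv_const hχ hχc (0, 1)
    have hi : Integrable (fun p => A p * fderiv ℝ χ p (1, 0) + B p * fderiv ℝ χ p (0, 1)) :=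
      (i1.bdd_mul (c := R) hAm.aestronglyMeasurable
        (Eventually.of_forall fun p => (hA p).trans (hUR p).2)).add
      (i2.bdd_mul (c := 2 * M * R) hBm.aestronglyMeasurable
        (Eventually.of_forall fun p => (hB p).trans (by have := (hUR p).2; gcongr)))
    refine ⟨hi, ?_⟩
    have h0 : ∫ p, (k * fderiv ℝ χ p (1, 0) + kruzhkovFlux g 0 k * fderiv ℝ χ p (0, 1)) = 0 := by
      rw [integral_add (i1.const_mul _) (i2.const_mul _), integral_const_mul, integral_const_mul,
        integral_fderiv_const_eq_zero hχ hχc, integral_fderiv_const_eq_zero hχ hχc]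
      simp
    have h1 := integral_add hi ((i1.const_mul k).add (i2.const_mul (kruzhkovFlux g 0 k)))
    simp only [Pi.add_apply] at h1
    rw [h0, add_zero] at h1
    rw [← h1]
    refine integral_congr_ae (Eventually.of_forall fun p => ?_)
    simp only [A, B]
    ring
  obtain ⟨T, hT⟩ : ∃ T : ℝ, ∀ p, φ p ≠ 0 → p.1 ≤ T := by
    obtain ⟨T, hT⟩ := hφc.isCompact.exists_bound_of_continuousOn continuous_fst.continuousOn
    exact ⟨T, fun p hp => (le_abs_self _).trans (hT p (subset_tsupport φ hp))⟩
  obtain ⟨Φ, hΦ⟩ := hφ.continuous.bounded_above_of_compact_support hφc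
  obtain ⟨hJ, hJ0⟩ := tendsto_integral_strip (T := T) hUm hUR hξ.continuous htr
  let J : ℕ → ℝ × ℝ → ℝ := fun n p => (Icc 0 T).indicator (1 : ℝ → ℝ) p.1 *
      (U p * ((n + 1) * (Icc (-3) 3).indicator (1 : ℝ → ℝ) ((n + 1) * (p.2 - ξ p.1))))
  have hineq : ∀ n, 0 ≤ ∫ p, (A p * fderiv ℝ (ψ n) p (1, 0) + B p * fderiv ℝ (ψ n) p (0, 1)) := by
    intro n
    rw [← (hAB _ (hψ n) (hψc n)).2]
    refine hloc k hk (ψ n) (hψ n) (hψc n) (fun p hp => ?_) (fun p => mul_nonneg (hφ0 p) (hη0 _))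
      ⟨(N n)⁻¹ / 2, half_pos (inv_pos.2 (hN n)), fun p hp => ?_⟩
    · simp only [ψ]; rw [hφt p hp, zero_mul]
    · simp only [ψ]
      rw [hηz _ ?_, mul_zero]
      have h1 := mul_lt_mul_of_pos_left hp (hN n)
      rw [mul_div_assoc', mul_inv_cancel₀ (hN n).ne'] at h1
      have := (abs_le.1 (hssub n p)).2
      linarith
  let G : ℝ × ℝ → ℝ := fun p => A p * fderiv ℝ φ p (1, 0) + B p * fderiv ℝ φ p (0, 1)
  have hG : Integrable G := (hAB φ hφ hφc).1
  have hηsm : ∀ n, Measurable fun p => η (s n p) := fun n =>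
    (hη.continuous.comp (hs n).continuous).measurable
  have hGn : ∀ n, Integrable fun p => G p * η (s n p) := fun n =>
    hG.mul_bdd (c := 1) (hηsm n).aestronglyMeasurable
      (Eventually.of_forall fun p => by rw [Real.norm_of_nonneg (hη0 _)]; exact hη1 _)
  have hle : ∀ n p, A p * fderiv ℝ (ψ n) p (1, 0) + B p * fderiv ℝ (ψ n) p (0, 1)
      ≤ G p * η (s n p) + Φ * C * (L + 2 * M) * J n p := by
    intro n p
    rw [hψd, hψd]
    have hrem : φ p * (deriv η (s n p) * (N n * (σ * (B p - A p * deriv (h n) p.1))))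
        ≤ Φ * C * (L + 2 * M) * J n p := by
      have hJ0 : ∀ p, 0 ≤ J n p := fun p =>
        mul_nonneg (indicator_nonneg (fun _ _ => zero_le_one) _) (mul_nonneg (hUR p).1
          (mul_nonneg (hN n).le (indicator_nonneg (fun _ _ => zero_le_one) _)))
      have hΦ0 : 0 ≤ Φ := (norm_nonneg _).trans (hΦ p)
      have hr0 : 0 ≤ Φ * C * (L + 2 * M) * J n p := mul_nonneg (by positivity) (hJ0 p)
      have hCp := hC (s n p)
      by_cases hp : φ p = 0
      · simpa [hp] using hr0
      by_cases hsp : s n p ∈ Icc (1 : ℝ) 2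
      · rw [indicator_of_mem hsp] at hCp
        have hpT : p.1 ∈ Icc 0 T :=
          ⟨not_lt.1 fun hlt => hp (hφt p hlt.le), hT p hp⟩
        have hpx : (n + 1) * (p.2 - ξ p.1) ∈ Icc (-3 : ℝ) 3 := by
          have h1 := abs_le.1 (hssub n p)
          have h2 : |N n * (σ * (p.2 - ξ p.1))| ≤ 3 :=
            abs_le.2 ⟨by linarith [h1.2, hsp.1], by linarith [h1.1, hsp.2]⟩
          rw [abs_mul, abs_mul, hσ, one_mul, ← abs_mul] at h2
          exact abs_le.1 h2
        have hJv : J n p = U p * N n := by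
          simp only [J]
          rw [indicator_of_mem hpT, indicator_of_mem hpx]
          simp [N]
        have h1 : |B p - A p * deriv (h n) p.1| ≤ (L + 2 * M) * U p := by
          refine (abs_sub _ _).trans ?_
          rw [abs_mul]
          have := mul_le_mul (hA p) (hhL n p.1) (abs_nonneg _) (hUR p).1
          linarith [hB p]
        refine (le_abs_self _).trans ?_
        rw [abs_mul, abs_mul, abs_mul, abs_mul, hσ, abs_of_pos (hN n), one_mul, hJv]
        have h2 : |φ p| ≤ Φ := hΦ p
        have h3 := hN n
        have h4 := (hUR p).1
        calc |φ p| * (|deriv η (s n p)| * (N n * |B p - A p * deriv (h n) p.1|))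
            ≤ Φ * (C * (N n * ((L + 2 * M) * U p))) := by
              gcongr
          _ = _ := by ring
      · rw [indicator_of_notMem hsp] at hCp
        rw [show deriv η (s n p) = 0 from abs_nonpos_iff.1 hCp]
        simpa using hr0
    simp only [G]
    linarith
  have hlim : Tendsto (fun n => ∫ p, G p * η (s n p)) atTop (nhds (∫ p, G p)) := by
    refine tendsto_integral_of_dominated_convergence (fun p => ‖G p‖)
      (fun n => (hGn n).aestronglyMeasurable) hG.norm
      (fun n => Eventually.of_forall fun p => ?_) (Eventually.of_forall fun p => ?_)
    · rw [norm_mul, Real.norm_of_nonneg (hη0 _)]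
      exact mul_le_of_le_one_right (norm_nonneg _) (hη1 _)
    · by_cases hp : σ * (p.2 - ξ p.1) ≤ 0
      · have hA0 : A p = 0 := abs_nonpos_iff.1 ((hA p).trans_eq (hU0 p hp))
        have hB0 : B p = 0 := abs_nonpos_iff.1 ((hB p).trans_eq (by rw [hU0 p hp, mul_zero]))
        simp [G, hA0, hB0]
      · rw [not_le] at hp
        refine tendsto_const_nhds.congr' ?_
        filter_upwards [hNlim.eventually_ge_atTop (3 / (σ * (p.2 - ξ p.1)))] with n hn
        rw [div_le_iff₀ hp] at hn
        have := (abs_le.1 (hssub n p)).1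
        rw [hηo _ (by linarith), mul_one]
  have hlim2 : Tendsto (fun n => (∫ p, G p * η (s n p)) + Φ * C * (L + 2 * M) * ∫ p, J n p) atTop
      (nhds ((∫ p, G p) + Φ * C * (L + 2 * M) * 0)) := hlim.add (hJ0.const_mul _)
  rw [(hAB φ hφ hφc).2]
  have hfin := ge_of_tendsto' hlim2 (b := 0) fun n => by
    rw [← integral_const_mul, ← integral_add (hGn n) ((hJ n).const_mul _)]
    exact (hineq n).trans (integral_mono (hAB _ (hψ n) (hψc n)).1
      ((hGn n).add ((hJ n).const_mul _)) (hle n))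
  simpa using hfin

/-- The restriction of the density `ρ` to the side `σ·(x − ξ(t)) > 0` of the curve `ξ`, extended
by zero. -/
def oneSidedDensity (σ : ℝ) (ξ : ℝ → ℝ) (ρ : ℝ → ℝ → ℝ) (p : ℝ × ℝ) : ℝ :=
  if 0 < p.1 ∧ 0 < σ * (p.2 - ξ p.1) then ρ p.1 p.2 else 0

lemma measurable_oneSidedDensity {σ : ℝ} {ξ : ℝ → ℝ} {ρ : ℝ → ℝ → ℝ} (hξ : Measurable ξ)
    (hρ : Measurable (Function.uncurry ρ)) : Measurable (oneSidedDensity σ ξ ρ) := by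
  refine Measurable.ite ?_ hρ measurable_const
  exact (measurableSet_lt measurable_const measurable_fst).inter (measurableSet_lt measurable_const
    (measurable_const.mul (measurable_snd.sub (hξ.comp measurable_fst))))

lemma IsEntropySol.oneSidedDensity_mem_Icc {ρmax σ : ℝ} {v c ρ₀ ξ ξ' : ℝ → ℝ} {ρ : ℝ → ℝ → ℝ}
    (h : IsEntropySol ρmax v c ρ₀ ρ ξ) (p : ℝ × ℝ) :
    oneSidedDensity σ ξ' ρ p ∈ Icc 0 ρmax := by
  unfold oneSidedDensity
  split_ifs with hp
  · exact h.range _ _ hp.1.le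
  · exact ⟨le_rfl, (h.range 0 0 le_rfl).1.trans (h.range 0 0 le_rfl).2⟩

lemma fderiv_eq_zero_of_nonneg_of_eq_zero {φ : ℝ × ℝ → ℝ} (hφ : ∀ p, 0 ≤ φ p) {p : ℝ × ℝ}
    (hp : φ p = 0) : fderiv ℝ φ p = 0 :=
  IsLocalMin.fderiv_eq_zero (Eventually.of_forall fun q => hp.trans_le (hφ q))

/-- On each side of the turning curve, extended by zero, an entropy solution of Hughes' model
with vanishing trace solves a scalar conservation law on the whole space. -/
lemma IsEntropySol.satisfiesKruzhkov_oneSidedDensity {ρmax σ : ℝ} {M L : NNReal}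
    {v c ρ₀ ξ ξ' f : ℝ → ℝ} {ρ : ℝ → ℝ → ℝ} (h : IsEntropySol ρmax v c ρ₀ ρ ξ)
    (hf : LipschitzWith M f) (hfv : ∀ r ∈ Icc 0 ρmax, f r = hughesFlux v r)
    (hξ : LipschitzWith L ξ') (hξ' : ∀ t, 0 < t → ξ' t = ξ t) (hσ : σ = 1 ∨ σ = -1)
    (htr : ∀ᵐ t, 0 < t → EssLimZero (ρ t) (ξ t) {x | 0 < σ * (x - ξ t)}) :
    SatisfiesKruzhkov ρmax (fun r => σ * f r) (oneSidedDensity σ ξ' ρ) := by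
  have hσ1 : |σ| = 1 := by rcases hσ with rfl | rfl <;> simp
  have hg : LipschitzWith M fun r => σ * f r := by
    refine LipschitzWith.of_dist_le_mul fun a b => ?_
    rw [Real.dist_eq, ← mul_sub, abs_mul, hσ1, one_mul]
    exact hf.dist_le_mul a b
  have hUm := measurable_oneSidedDensity (σ := σ) hξ.continuous.measurable h.meas
  have hUR := fun p => h.oneSidedDensity_mem_Icc (σ := σ) (ξ' := ξ') p
  refine satisfiesKruzhkov_of_trace_eq_zero hg hξ hσ1 hUm hUR
    (fun p hp => if_neg fun hp' => absurd hp'.2 hp.not_gt) ?_ ?_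
  · filter_upwards [htr] with t ht ht0 δ hδ
    obtain ⟨s, hs, s', hs', hss⟩ := mem_inf_iff_superset.1 ((ht ht0).eventually_le_const hδ)
    obtain ⟨u, hu, hus⟩ := mem_nhdsWithin_iff_exists_mem_nhds_inter.1 hs
    rw [hξ' t ht0]
    refine mem_inf_iff_superset.2 ⟨u, hu, s', hs', fun x hx => ?_⟩
    simp only [mem_ofPred_eq, oneSidedDensity, hξ' t ht0]
    split_ifs with hp
    · exact hss ⟨hus ⟨hx.1, hp.2⟩, hx.2⟩
    · exact hδ.le
  · rintro k hk φ hφ hφc hφt hφ0 ⟨ε, hε, hφε⟩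
    have hent := h.entropy k hk φ hφ hφc hφt hφ0
    have hz : ∫ t in Ioi (0 : ℝ), hughesFlux v k * φ (t, ξ t) = 0 := by
      refine setIntegral_eq_zero_of_forall_eq_zero fun t ht => ?_
      rw [hφε (t, ξ t) (by simpa [hξ' t ht] using hε), mul_zero]
    rw [hz, mul_zero, add_zero] at hent
    let H : ℝ × ℝ → ℝ := fun p => |oneSidedDensity σ ξ' ρ p - k| * fderiv ℝ φ p (1, 0)
      + kruzhkovFlux (fun r => σ * f r) (oneSidedDensity σ ξ' ρ p) k * fderiv ℝ φ p (0, 1)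
    have hH : Integrable H := by
      refine ((integrable_fderiv_const hφ hφc (1, 0)).bdd_mul (c := ρmax)
        (hUm.sub_const k).abs.aestronglyMeasurable (Eventually.of_forall fun p => ?_)).add
        ((integrable_fderiv_const hφ hφc (0, 1)).bdd_mul (c := M * ρmax)
        ((continuous_kruzhkovFlux hg.continuous).measurable.comp
        (hUm.prodMk measurable_const)).aestronglyMeasurable (Eventually.of_forall fun p => ?_))
      · simpa using abs_le_of_mem_Icc (hUR p) hk
      · exact (abs_kruzhkovFlux_le hg _ _).trans
          (mul_le_mul_of_nonneg_left (abs_le_of_mem_Icc (hUR p) hk) M.2)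
    have hHz : ∀ p, φ p = 0 → H p = 0 := fun p hp => by
      simp [H, fderiv_eq_zero_of_nonneg_of_eq_zero hφ0 hp]
    refine hent.trans_eq ?_
    change _ = ∫ p, H p
    have hHi : ∫ p, H p = ∫ t in Ioi (0 : ℝ), ∫ x, H (t, x) := by
      rw [setIntegral_eq_integral_of_forall_compl_eq_zero fun t ht => ?_]
      · exact integral_prod _ hH
      · exact (integral_congr_ae (Eventually.of_forall fun x =>
          hHz (t, x) (hφt (t, x) (not_lt.1 ht)))).trans (integral_zero _ _)
    rw [hHi]
    refine setIntegral_congr_fun measurableSet_Ioi fun t (ht : 0 < t) => ?_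
    refine integral_congr_ae (Eventually.of_forall fun x => ?_)
    by_cases hp : φ (t, x) = 0
    · simp [hHz _ hp, fderiv_eq_zero_of_nonneg_of_eq_zero hφ0 hp]
    · have hpos : 0 < σ * (x - ξ t) := by
        rw [← hξ' t ht]
        exact hε.trans_le (not_lt.1 fun hlt => hp (hφε (t, x) hlt))
      have hU : oneSidedDensity σ ξ' ρ (t, x) = ρ t x :=
        if_pos ⟨ht, by rwa [hξ' t ht]⟩
      have hsign : Real.sign (x - ξ t) = σ := by
        rcases hσ with rfl | rfl
        · exact Real.sign_of_pos (by linarith)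
        · exact Real.sign_of_neg (by linarith)
      simp only [H, hU, kruzhkovFlux_eq_sign, hughesKruzhkov, hughesF, hsign, hfv k hk,
        hfv _ (h.range t x (le_of_lt ht))]

lemma SpeedH2.exists_lipschitzWith_flux {ρmax vmax : ℝ} {v v' : ℝ → ℝ}
    (hv : SpeedH2 ρmax vmax v v') :
    ∃ (M : NNReal) (f : ℝ → ℝ), LipschitzWith M f ∧ ∀ r ∈ Icc 0 ρmax, f r = hughesFlux v r := by
  have hvc : ContinuousOn v (Icc 0 ρmax) := fun x hx => (hv.hasDeriv x hx).continuousWithinAt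
  obtain ⟨C, hC⟩ := isCompact_Icc.exists_bound_of_continuousOn
    (hvc.add (continuousOn_id.mul hv.cont))
  have hlip : LipschitzOnWith C.toNNReal (hughesFlux v) (Icc 0 ρmax) := by
    refine (convex_Icc 0 ρmax).lipschitzOnWith_of_nnnorm_hasDerivWithin_le
      (f' := fun x => v x + x * v' x) (fun x hx => ?_) fun x hx => ?_
    · have : HasDerivWithinAt (hughesFlux v) (1 * v x + id x * v' x) (Icc 0 ρmax) x :=
        (hasDerivWithinAt_id x (Icc 0 ρmax)).fun_mul (hv.hasDeriv x hx)
      rwa [one_mul] at this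
    · rw [← NNReal.coe_le_coe, coe_nnnorm]
      exact (hC x hx).trans (Real.le_coe_toNNReal C)
  obtain ⟨f, hf, hfe⟩ := hlip.extend_real
  exact ⟨_, f, hf, fun r hr => (hfe hr).symm⟩

lemma frequently_nhdsGT_of_ae {P : ℝ → Prop} (h : ∀ᵐ t, P t) (a : ℝ) :
    ∃ᶠ t in nhdsWithin a (Ioi a), P t := by
  intro hn
  obtain ⟨r, hr, hrs⟩ := mem_nhdsGT_iff_exists_Ioo_subset.1 hn
  have h0 : volume (Ioo a r) = 0 := measure_mono_null hrs h
  simp only [Real.volume_Ioo, ENNReal.ofReal_eq_zero, sub_nonpos] at h0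
  exact absurd hr (not_lt.2 h0)

lemma ae_snd_ne_comp_fst {ξ : ℝ → ℝ} (hξ : Measurable ξ) : ∀ᵐ p : ℝ × ℝ, p.2 ≠ ξ p.1 := by
  have hm : MeasurableSet {p : ℝ × ℝ | p.2 ≠ ξ p.1} :=
    (measurableSet_eq_fun measurable_snd (hξ.comp measurable_fst)).compl
  rw [Measure.volume_eq_prod, Measure.ae_prod_iff_ae_ae hm]
  exact Eventually.of_forall fun t => Measure.ae_ne volume (ξ t)

/-- For the cost `1 + α·ρ`, the turning point depends in a Lipschitz way on the density. -/
lemma two_mul_sub_le_of_balance {α a b : ℝ} {r s : ℝ → ℝ} (hα : 0 ≤ α) (ha : a ∈ Ioo (-1 : ℝ) 1)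
    (hb : b ∈ Ioo (-1 : ℝ) 1) (hab : a ≤ b) (hr : Integrable r) (hs : Integrable s)
    (hs0 : ∀ x, 0 ≤ s x)
    (h1 : ∫ y in Ioo (-1 : ℝ) a, (1 + α * r y) = ∫ y in Ioo a 1, (1 + α * r y))
    (h2 : ∫ y in Ioo (-1 : ℝ) b, (1 + α * s y) = ∫ y in Ioo b 1, (1 + α * s y)) :
    2 * (b - a) ≤ α * ∫ x, |r x - s x| := by
  have hexp : ∀ (u : ℝ → ℝ), Integrable u → ∀ c d : ℝ, c ≤ d →
      ∫ y in Ioo c d, (1 + α * u y) = (d - c) + α * ∫ y in Ioo c d, u y := by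
    intro u hu c d hcd
    rw [integral_add (integrable_const 1) (hu.integrableOn.const_mul α),
      integral_const_mul, setIntegral_const]
    simp [hcd]
  rw [hexp r hr _ _ ha.1.le, hexp r hr _ _ ha.2.le] at h1
  rw [hexp s hs _ _ hb.1.le, hexp s hs _ _ hb.2.le] at h2
  have h3 : ∫ y in Ioo (-1 : ℝ) a, s y ≤ ∫ y in Ioo (-1 : ℝ) b, s y :=
    setIntegral_mono_set hs.integrableOn (Eventually.of_forall hs0)
      (Ioo_subset_Ioo_right hab).eventuallyLE
  have h4 : ∫ y in Ioo b 1, s y ≤ ∫ y in Ioo a 1, s y :=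
    setIntegral_mono_set hs.integrableOn (Eventually.of_forall hs0)
      (Ioo_subset_Ioo_left hab).eventuallyLE
  have h5 : (∫ y in Ioo (-1 : ℝ) a, r y) - ∫ y in Ioo (-1 : ℝ) a, s y
      ≤ ∫ y in Ioo (-1 : ℝ) a, |r y - s y| := by
    rw [← integral_sub hr.integrableOn hs.integrableOn]
    exact integral_mono (hr.sub hs).integrableOn (hr.sub hs).abs.integrableOn
      fun x => le_abs_self _
  have h6 : (∫ y in Ioo a 1, s y) - ∫ y in Ioo a 1, r y ≤ ∫ y in Ioo a 1, |r y - s y| := by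
    rw [← integral_sub hs.integrableOn hr.integrableOn]
    exact integral_mono (hs.sub hr).integrableOn (hr.sub hs).abs.integrableOn
      fun x => (le_abs_self _).trans_eq (abs_sub_comm _ _)
  have h7 : (∫ y in Ioo (-1 : ℝ) a, |r y - s y|) + ∫ y in Ioo a 1, |r y - s y|
      ≤ ∫ x, |r x - s x| := by
    have hd : Disjoint (Ioo (-1 : ℝ) a) (Ioo a 1) :=
      disjoint_left.2 fun x hx hx' => lt_asymm hx.2 hx'.1
    refine (setIntegral_union hd measurableSet_Ioo
      (hr.sub hs).abs.integrableOn (hr.sub hs).abs.integrableOn).ge.trans ?_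
    exact setIntegral_le_integral (hr.sub hs).abs (Eventually.of_forall fun x => abs_nonneg _)
  have h8 : 2 * (b - a) = α * (((∫ y in Ioo (-1 : ℝ) a, r y) - ∫ y in Ioo a 1, r y)
      - ((∫ y in Ioo (-1 : ℝ) b, s y) - ∫ y in Ioo b 1, s y)) := by linarith
  rw [h8]
  exact mul_le_mul_of_nonneg_left (by linarith) hα

lemma IsEntropySol.integrableOn_uncurry {ρmax : ℝ} {v c ρ₀ ξ : ℝ → ℝ} {ρ : ℝ → ℝ → ℝ}
    (h : IsEntropySol ρmax v c ρ₀ ρ ξ) (T : ℝ) :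
    IntegrableOn (fun p : ℝ × ℝ => ρ p.1 p.2) (Ioo 0 T ×ˢ univ) := by
  have hc : ContinuousOn (fun t => ∫ x, ‖ρ t x‖) (Icc 0 T) := by
    intro s hs
    refine ContinuousWithinAt.mono (t := Ici 0) ?_ Icc_subset_Ici_self
    refine tendsto_iff_dist_tendsto_zero.2 (squeeze_zero' (Eventually.of_forall fun t =>
      dist_nonneg) ?_ (h.timeCont s hs.1))
    filter_upwards [self_mem_nhdsWithin] with t ht
    have hi := h.integrable t ht
    have hi' := h.integrable s hs.1
    rw [Real.dist_eq, ← integral_sub hi.norm hi'.norm]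
    refine (abs_integral_le_integral_abs).trans
      (integral_mono (hi.norm.sub hi'.norm).abs (hi.sub hi').abs fun x => ?_)
    exact abs_abs_sub_abs_le_abs_sub _ _
  unfold IntegrableOn
  rw [Measure.volume_eq_prod, ← Measure.prod_restrict, Measure.restrict_univ,
    integrable_prod_iff (show Measurable fun p : ℝ × ℝ => ρ p.1 p.2 from
      h.meas).aestronglyMeasurable]
  refine ⟨?_, hc.integrableOn_Icc.mono_set Ioo_subset_Icc_self⟩
  filter_upwards [ae_restrict_mem measurableSet_Ioo] with t ht
  exact h.integrable t ht.1.le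

lemma abs_oneSidedDensity_sub_le {ρmax σ t x : ℝ} {ξ₁ ξ₂ : ℝ → ℝ} {ρ₁ ρ₂ : ℝ → ℝ → ℝ}
    (hσ : σ = 1 ∨ σ = -1) (h₁ : ρ₁ t x ∈ Icc 0 ρmax) (h₂ : ρ₂ t x ∈ Icc 0 ρmax) :
    |oneSidedDensity σ ξ₁ ρ₁ (t, x) - oneSidedDensity σ ξ₂ ρ₂ (t, x)|
      ≤ |ρ₁ t x - ρ₂ t x| + (uIcc (ξ₁ t) (ξ₂ t)).indicator (fun _ => ρmax) x := by
  have hR : 0 ≤ ρmax := h₁.1.trans h₁.2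
  have hi : 0 ≤ (uIcc (ξ₁ t) (ξ₂ t)).indicator (fun _ => ρmax) x :=
    indicator_nonneg (fun _ _ => hR) _
  have ha := abs_nonneg (ρ₁ t x - ρ₂ t x)
  have hx : ¬(0 < σ * (x - ξ₁ t) ↔ 0 < σ * (x - ξ₂ t)) → x ∈ uIcc (ξ₁ t) (ξ₂ t) := by
    intro hn
    rw [mem_uIcc]
    by_contra hc
    apply hn
    rcases hσ with rfl | rfl <;> constructor <;> intro h <;> by_contra h' <;> apply hc
    · left; constructor <;> linarith
    · right; constructor <;> linarith
    · right; constructor <;> linarith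
    · left; constructor <;> linarith
  unfold oneSidedDensity
  by_cases ht : 0 < t
  · by_cases p1 : 0 < σ * (x - ξ₁ t) <;> by_cases p2 : 0 < σ * (x - ξ₂ t)
    · simp only [ht, p1, p2, and_self, if_true]
      linarith
    · rw [indicator_of_mem (hx (by tauto))]
      simp only [ht, p1, p2, and_self, and_false, if_true, if_false, sub_zero]
      rw [abs_of_nonneg h₁.1]
      linarith [h₁.2]
    · rw [indicator_of_mem (hx (by tauto))]
      simp only [ht, p1, p2, and_self, and_false, if_true, if_false, zero_sub, abs_neg]
      rw [abs_of_nonneg h₂.1]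
      linarith [h₂.2]
    · simp only [p1, p2, and_false, if_false, sub_zero, abs_zero]
      linarith
  · simp only [ht, false_and, if_false, sub_zero, abs_zero]
    linarith

/-- Two solutions with vanishing traces along their turning curves have the same density on
corresponding sides of these curves, provided the turning curves issue from the same point. -/
lemma oneSidedDensity_ae_eq {ρmax σ : ℝ} {M L₁ L₂ : NNReal} {v c₁ c₂ ρ₀ ξ₁ ξ₂ ζ₁ ζ₂ f : ℝ → ℝ}
    {ρ₁ ρ₂ : ℝ → ℝ → ℝ} (h₁ : IsEntropySol ρmax v c₁ ρ₀ ρ₁ ξ₁)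
    (h₂ : IsEntropySol ρmax v c₂ ρ₀ ρ₂ ξ₂)
    (hf : LipschitzWith M f) (hfv : ∀ r ∈ Icc 0 ρmax, f r = hughesFlux v r)
    (hζ₁ : LipschitzWith L₁ ζ₁) (hζ₂ : LipschitzWith L₂ ζ₂) (he₁ : ∀ t, 0 < t → ζ₁ t = ξ₁ t)
    (he₂ : ∀ t, 0 < t → ζ₂ t = ξ₂ t) (h0 : ζ₁ 0 = ζ₂ 0) (hσ : σ = 1 ∨ σ = -1)
    (htr₁ : ∀ᵐ t, 0 < t → EssLimZero (ρ₁ t) (ξ₁ t) {x | 0 < σ * (x - ξ₁ t)})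
    (htr₂ : ∀ᵐ t, 0 < t → EssLimZero (ρ₂ t) (ξ₂ t) {x | 0 < σ * (x - ξ₂ t)})
    (hD : Tendsto (fun t => ∫ x, |ρ₁ t x - ρ₂ t x|) (nhdsWithin 0 (Ioi 0)) (nhds 0)) :
    ∀ᵐ p : ℝ × ℝ, 0 < p.1 → oneSidedDensity σ ζ₁ ρ₁ p = oneSidedDensity σ ζ₂ ρ₂ p := by
  have hσ1 : |σ| = 1 := by rcases hσ with rfl | rfl <;> simp
  have hg : LipschitzWith M fun r => σ * f r := by
    refine LipschitzWith.of_dist_le_mul fun a b => ?_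
    rw [Real.dist_eq, ← mul_sub, abs_mul, hσ1, one_mul]
    exact hf.dist_le_mul a b
  have hm₁ := measurable_oneSidedDensity (σ := σ) hζ₁.continuous.measurable h₁.meas
  have hm₂ := measurable_oneSidedDensity (σ := σ) hζ₂.continuous.measurable h₂.meas
  have hint : ∀ {c ξ ζ : ℝ → ℝ} {ρ : ℝ → ℝ → ℝ} (_ : IsEntropySol ρmax v c ρ₀ ρ ξ)
      (_ : Measurable (oneSidedDensity σ ζ ρ)) (T : ℝ),
      IntegrableOn (oneSidedDensity σ ζ ρ) (Ioo 0 T ×ˢ univ) := by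
    intro c ξ ζ ρ h hm T
    refine (h.integrableOn_uncurry T).mono' hm.aestronglyMeasurable ?_
    filter_upwards [ae_restrict_mem (measurableSet_Ioo.prod MeasurableSet.univ)] with p hp
    have hr := h.range p.1 p.2 hp.1.1.le
    unfold oneSidedDensity
    split_ifs
    · exact (Real.norm_of_nonneg hr.1).le
    · simpa using hr.1
  refine kruzhkov_unique hg hm₁ hm₂ (fun p => h₁.oneSidedDensity_mem_Icc p)
    (fun p => h₂.oneSidedDensity_mem_Icc p)
    (h₁.satisfiesKruzhkov_oneSidedDensity hf hfv hζ₁ he₁ hσ htr₁)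
    (h₂.satisfiesKruzhkov_oneSidedDensity hf hfv hζ₂ he₂ hσ htr₂)
    (fun T => (hint h₁ hm₁ T).sub (hint h₂ hm₂ T)) ?_
  have hlim : Tendsto (fun t => (∫ x, |ρ₁ t x - ρ₂ t x|) + |ζ₂ t - ζ₁ t| * ρmax)
      (nhdsWithin 0 (Ioi 0)) (nhds 0) := by
    have : Tendsto (fun t => |ζ₂ t - ζ₁ t| * ρmax) (nhdsWithin 0 (Ioi 0))
        (nhds (|ζ₂ 0 - ζ₁ 0| * ρmax)) :=
      (((hζ₂.continuous.sub hζ₁.continuous).abs.mul continuous_const).tendsto 0).mono_left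
        nhdsWithin_le_nhds
    simpa [h0] using hD.add this
  refine squeeze_zero' (Eventually.of_forall fun t => integral_nonneg fun x => abs_nonneg _) ?_ hlim
  filter_upwards [self_mem_nhdsWithin] with t (ht : 0 < t)
  have hi : Integrable fun x => |ρ₁ t x - ρ₂ t x| :=
    ((h₁.integrable t ht.le).sub (h₂.integrable t ht.le)).abs
  have hi' : Integrable ((uIcc (ζ₁ t) (ζ₂ t)).indicator fun _ => ρmax) :=
    (integrable_indicator_iff measurableSet_uIcc).2
      (integrableOn_const isCompact_uIcc.measure_lt_top.ne)
  calc ∫ x, |oneSidedDensity σ ζ₁ ρ₁ (t, x) - oneSidedDensity σ ζ₂ ρ₂ (t, x)|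
      ≤ ∫ x, (|ρ₁ t x - ρ₂ t x| + (uIcc (ζ₁ t) (ζ₂ t)).indicator (fun _ => ρmax) x) :=
        integral_mono_of_nonneg (Eventually.of_forall fun x => abs_nonneg _) (hi.add hi')
          (Eventually.of_forall fun x => abs_oneSidedDensity_sub_le hσ (h₁.range t x ht.le)
            (h₂.range t x ht.le))
    _ = _ := by
        rw [integral_add hi hi', integral_indicator_const _ measurableSet_uIcc]
        simp [Measure.real]

/-- Theorem 4 of Andreianov–Rosini–Stivaletta (uniqueness): with the linear cost
`c(ρ) = 1 + α·ρ`, `α ≥ 0`, and `v` C² satisfying (H2) with `f = ρ·v(ρ)` strictly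
concave, two BV-regular entropy solutions with the same BV initial datum whose
one-sided essential limits at the respective turning curves vanish coincide. -/
theorem hughes_uniqueness_zero_traces
    (ρmax vmax α : ℝ) (hρmax : 0 < ρmax) (hα : 0 ≤ α)
    (v v' v'' : ℝ → ℝ) (hv : SpeedH2 ρmax vmax v v')
    (hv2 : ∀ x ∈ Icc (0 : ℝ) ρmax, HasDerivWithinAt v' (v'' x) (Icc 0 ρmax) x)
    (hv2cont : ContinuousOn v'' (Icc 0 ρmax))
    (hconc : StrictConcaveOn ℝ (Icc 0 ρmax) (fun r => r * v r))
    (ρ₀ : ℝ → ℝ) (hmeas : Measurable ρ₀)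
    (hrange : ∀ x ∈ Ioo (-1 : ℝ) 1, ρ₀ x ∈ Icc (0 : ℝ) ρmax)
    (hBV : BoundedVariationOn ρ₀ (Ioo (-1 : ℝ) 1))
    (ρ₁ ρ₂ : ℝ → ℝ → ℝ) (ξ₁ ξ₂ : ℝ → ℝ)
    (h₁ : IsBVEntropySol ρmax v (fun r => 1 + α * r) ρ₀ ρ₁ ξ₁)
    (h₂ : IsBVEntropySol ρmax v (fun r => 1 + α * r) ρ₀ ρ₂ ξ₂)
    (htrace₁ : ∀ᵐ t ∂(volume.restrict (Ioi (0 : ℝ))),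
      EssLimZero (ρ₁ t) (ξ₁ t) (Iio (ξ₁ t)) ∧ EssLimZero (ρ₁ t) (ξ₁ t) (Ioi (ξ₁ t)))
    (htrace₂ : ∀ᵐ t ∂(volume.restrict (Ioi (0 : ℝ))),
      EssLimZero (ρ₂ t) (ξ₂ t) (Iio (ξ₂ t)) ∧ EssLimZero (ρ₂ t) (ξ₂ t) (Ioi (ξ₂ t))) :
    (∀ t : ℝ, 0 ≤ t → ξ₁ t = ξ₂ t) ∧
    ∀ᵐ p : ℝ × ℝ, 0 < p.1 → ρ₁ p.1 p.2 = ρ₂ p.1 p.2 := by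
  obtain ⟨h₁, -⟩ := h₁
  obtain ⟨h₂, -⟩ := h₂
  obtain ⟨M, f, hf, hfv⟩ := hv.exists_lipschitzWith_flux
  obtain ⟨L₁, hL₁⟩ := h₁.xi_lip
  obtain ⟨L₂, hL₂⟩ := h₂.xi_lip
  obtain ⟨ζ₁, hζ₁, he₁⟩ := hL₁.extend_real
  obtain ⟨ζ₂, hζ₂, he₂⟩ := hL₂.extend_real
  have hbal : ∀ᵐ t, 0 < t → 2 * |ζ₁ t - ζ₂ t| ≤ α * ∫ x, |ρ₁ t x - ρ₂ t x| := by
    filter_upwards [(ae_restrict_iff' measurableSet_Ioi).1 h₁.balance,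
      (ae_restrict_iff' measurableSet_Ioi).1 h₂.balance] with t hb₁ hb₂ ht
    rw [← he₁ (le_of_lt ht), ← he₂ (le_of_lt ht)]
    have hi₁ := h₁.integrable t ht.le
    have hi₂ := h₂.integrable t ht.le
    rcases le_total (ξ₁ t) (ξ₂ t) with hle | hle
    · rw [abs_sub_comm, abs_of_nonneg (sub_nonneg.2 hle)]
      exact two_mul_sub_le_of_balance hα (h₁.xi_mem t) (h₂.xi_mem t) hle hi₁ hi₂
        (fun x => (h₂.range t x ht.le).1) (hb₁ ht) (hb₂ ht)
    · rw [abs_of_nonneg (sub_nonneg.2 hle)]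
      simp only [abs_sub_comm (ρ₁ t _)]
      exact two_mul_sub_le_of_balance hα (h₂.xi_mem t) (h₁.xi_mem t) hle hi₂ hi₁
        (fun x => (h₁.range t x ht.le).1) (hb₂ ht) (hb₁ ht)
  have hD : Tendsto (fun t => ∫ x, |ρ₁ t x - ρ₂ t x|) (nhdsWithin 0 (Ioi 0)) (nhds 0) := by
    have hlim := ((h₁.timeCont 0 le_rfl).add (h₂.timeCont 0 le_rfl)).mono_left
      (nhdsWithin_mono 0 Ioi_subset_Ici_self)
    rw [add_zero] at hlim
    refine squeeze_zero' (Eventually.of_forall fun t => integral_nonneg fun x => abs_nonneg _)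
      ?_ hlim
    filter_upwards [self_mem_nhdsWithin] with t (ht : 0 < t)
    have hi₁ := ((h₁.integrable t ht.le).sub (h₁.integrable 0 le_rfl)).abs
    have hi₂ := ((h₂.integrable t ht.le).sub (h₂.integrable 0 le_rfl)).abs
    refine (integral_mono_of_nonneg (Eventually.of_forall fun x => abs_nonneg _) (hi₁.add hi₂)
      ?_).trans_eq (integral_add hi₁ hi₂)
    filter_upwards [h₁.init, h₂.init] with x hx₁ hx₂
    have h0 : ρ₁ t x - ρ₂ t x = (ρ₁ t x - ρ₁ 0 x) - (ρ₂ t x - ρ₂ 0 x) := by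
      rw [hx₁, hx₂]; ring
    rw [h0]
    exact abs_sub _ _
  have h0 : ζ₁ 0 = ζ₂ 0 := by
    have hl : Tendsto (fun t => 2 * |ζ₁ t - ζ₂ t| - α * ∫ x, |ρ₁ t x - ρ₂ t x|)
        (nhdsWithin 0 (Ioi 0)) (nhds (2 * |ζ₁ 0 - ζ₂ 0| - α * 0)) :=
      (((continuous_const.mul (hζ₁.continuous.sub hζ₂.continuous).abs).tendsto 0).mono_left
        nhdsWithin_le_nhds).sub (hD.const_mul α)
    have hle : 2 * |ζ₁ 0 - ζ₂ 0| - α * 0 ≤ 0 := by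
      by_contra hlt
      obtain ⟨t, ht, ht', ht0⟩ := ((frequently_nhdsGT_of_ae hbal 0).and_eventually
        ((hl.eventually_const_lt (not_le.1 hlt)).and self_mem_nhdsWithin)).exists
      exact absurd (ht ht0) (not_le.2 (sub_pos.1 ht'))
    have := abs_nonneg (ζ₁ 0 - ζ₂ 0)
    exact sub_eq_zero.1 (abs_eq_zero.1 (by linarith))
  have hset : ∀ a : ℝ, {x | 0 < (1 : ℝ) * (x - a)} = Ioi a ∧
      {x | 0 < (-1 : ℝ) * (x - a)} = Iio a := fun a =>
    ⟨by ext x; simp, by ext x; simp⟩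
  have htr₁ := (ae_restrict_iff' measurableSet_Ioi).1 htrace₁
  have htr₂ := (ae_restrict_iff' measurableSet_Ioi).1 htrace₂
  have hp := oneSidedDensity_ae_eq (σ := 1) h₁ h₂ hf hfv hζ₁ hζ₂ (fun t ht => (he₁ ht.le).symm)
    (fun t ht => (he₂ ht.le).symm) h0 (Or.inl rfl)
    (by filter_upwards [htr₁] with t h ht; rw [(hset _).1]; exact (h ht).2)
    (by filter_upwards [htr₂] with t h ht; rw [(hset _).1]; exact (h ht).2) hD
  have hn := oneSidedDensity_ae_eq (σ := -1) h₁ h₂ hf hfv hζ₁ hζ₂ (fun t ht => (he₁ ht.le).symm)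
    (fun t ht => (he₂ ht.le).symm) h0 (Or.inr rfl)
    (by filter_upwards [htr₁] with t h ht; rw [(hset _).2]; exact (h ht).1)
    (by filter_upwards [htr₂] with t h ht; rw [(hset _).2]; exact (h ht).1) hD
  have hsum : ∀ (ζ : ℝ → ℝ) (ρ : ℝ → ℝ → ℝ) (p : ℝ × ℝ), 0 < p.1 → p.2 ≠ ζ p.1 →
      ρ p.1 p.2 = oneSidedDensity 1 ζ ρ p + oneSidedDensity (-1) ζ ρ p := by
    intro ζ ρ p hp0 hne
    unfold oneSidedDensity
    rcases lt_or_gt_of_ne hne with h | h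
    · simp [hp0, h, h.le]
    · simp [hp0, h, h.le]
  have hρ : ∀ᵐ p : ℝ × ℝ, 0 < p.1 → ρ₁ p.1 p.2 = ρ₂ p.1 p.2 := by
    filter_upwards [hp, hn, ae_snd_ne_comp_fst hζ₁.continuous.measurable,
      ae_snd_ne_comp_fst hζ₂.continuous.measurable] with p hp hn hne₁ hne₂ hp0
    rw [hsum ζ₁ ρ₁ p hp0 hne₁, hsum ζ₂ ρ₂ p hp0 hne₂, hp hp0, hn hp0]
  refine ⟨?_, hρ⟩
  have hae : ζ₁ =ᵐ[volume.restrict (Ioi 0)] ζ₂ := by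
    rw [EventuallyEq, ae_restrict_iff' measurableSet_Ioi]
    filter_upwards [hbal, Measure.ae_ae_of_ae_prod hρ] with t ht hx ht0
    have hz : ∫ x, |ρ₁ t x - ρ₂ t x| = 0 := by
      refine integral_eq_zero_of_ae ?_
      filter_upwards [hx] with x hx
      simp [hx ht0]
    have h1 := ht ht0
    rw [hz, mul_zero] at h1
    have h2 := abs_nonneg (ζ₁ t - ζ₂ t)
    exact sub_eq_zero.1 (abs_eq_zero.1 (by linarith))
  have heq := Measure.eqOn_open_of_ae_eq hae isOpen_Ioi hζ₁.continuous.continuousOn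
    hζ₂.continuous.continuousOn
  intro t ht
  rw [he₁ ht, he₂ ht]
  rcases ht.eq_or_lt with rfl | ht
  · exact h0
  · exact heq ht

end
end

section
/- Let T > 0, α > 0, ρ_max > 0 and c(ρ) = 1 + α·ρ. Let ρ : [0,T]×ℝ → [0,ρ_max] be measurable and suppose there exists C > 0 such that for all a,b ∈ ℝ and all s,t ∈ [0,T] one has |∫_a^b (ρ(t,x) − ρ(s,x)) dx| ≤ C·|t − s|. For each t ∈ [0,T] let ξ(t) be the unique point of (−1,1) satisfying ∫_{−1}^{ξ(t)} (1 + α·ρ(t,x)) dx = ∫_{ξ(t)}^{1} (1 + α·ρ(t,x)) dx. Then ξ is Lipschitz continuous on [0,T] with Lipschitz constant at most α·C. -/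
open MeasureTheory Set Filter

/-- The balance relation for the cost `1 + α * f`, rewritten in terms of interval integrals of
`f`. -/
lemma two_mul_add_of_balance {α z : ℝ} {f : ℝ → ℝ}
    (hf : ∀ a b : ℝ, IntervalIntegrable f volume a b) (hz : z ∈ Ioo (-1 : ℝ) 1)
    (hbal : ∫ x in Ioo (-1 : ℝ) z, (1 + α * f x) = ∫ x in Ioo z 1, (1 + α * f x)) :
    2 * z + α * ((∫ x in (-1 : ℝ)..z, f x) - ∫ x in z..1, f x) = 0 := by
  have key (a b : ℝ) (hab : a ≤ b) :
      ∫ x in Ioo a b, (1 + α * f x) = (b - a) + α * ∫ x in a..b, f x := by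
    rw [← integral_Ioc_eq_integral_Ioo, ← intervalIntegral.integral_of_le hab,
      intervalIntegral.integral_add intervalIntegrable_const ((hf a b).const_mul α),
      intervalIntegral.integral_const_mul]
    simp
  rw [key _ _ hz.1.le, key _ _ hz.2.le] at hbal
  linarith

/-- Proposition (Andreianov–Girard): with the linear cost `c(ρ) = 1 + α·ρ`, `α > 0`,
if the density `ρ : [0,T]×ℝ → [0,ρmax]` satisfies the weak time-equicontinuity
`|∫_a^b (ρ(t,x) − ρ(s,x)) dx| ≤ C·|t − s|`, then the turning curve `ξ`, defined by
the balance relation, is Lipschitz on `[0,T]` with constant at most `α·C`. -/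
theorem turning_curve_lipschitz
    (T α ρmax C : ℝ) (hT : 0 < T) (hα : 0 < α) (hρmax : 0 < ρmax) (hC : 0 < C)
    (ρ : ℝ → ℝ → ℝ) (hmeas : Measurable (Function.uncurry ρ))
    (hrange : ∀ t ∈ Icc (0 : ℝ) T, ∀ x : ℝ, ρ t x ∈ Icc 0 ρmax)
    (hint : ∀ t ∈ Icc (0 : ℝ) T, ∀ a b : ℝ, IntervalIntegrable (ρ t) volume a b)
    (hcont : ∀ a b : ℝ, ∀ s ∈ Icc (0 : ℝ) T, ∀ t ∈ Icc (0 : ℝ) T,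
      |∫ x in a..b, (ρ t x - ρ s x)| ≤ C * |t - s|)
    (ξ : ℝ → ℝ) (hξ : ∀ t ∈ Icc (0 : ℝ) T, ξ t ∈ Ioo (-1 : ℝ) 1)
    (hbal : ∀ t ∈ Icc (0 : ℝ) T,
      ∫ x in Ioo (-1 : ℝ) (ξ t), (1 + α * ρ t x) = ∫ x in Ioo (ξ t) 1, (1 + α * ρ t x)) :
    LipschitzOnWith (Real.toNNReal (α * C)) ξ (Icc 0 T) := by
  have one_sided : ∀ s ∈ Icc (0 : ℝ) T, ∀ t ∈ Icc (0 : ℝ) T,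
      ξ t - ξ s ≤ α * C * |t - s| := by
    intro s hs t ht
    rcases le_total (ξ t) (ξ s) with h | h
    · have : 0 ≤ α * C * |t - s| := by positivity
      linarith
    have hbt := two_mul_add_of_balance (hint t ht) (hξ t ht) (hbal t ht)
    have hbs := two_mul_add_of_balance (hint s hs) (hξ s hs) (hbal s hs)
    have hleft := hcont (-1) (ξ s) s hs t ht
    have hright := hcont (ξ s) 1 s hs t ht
    rw [intervalIntegral.integral_sub (hint t ht _ _) (hint s hs _ _)] at hleft hright
    have hsplit_left := intervalIntegral.integral_add_adjacent_intervals
      (hint t ht (-1) (ξ s)) (hint t ht (ξ s) (ξ t))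
    have hsplit_right := intervalIntegral.integral_add_adjacent_intervals
      (hint t ht (ξ s) (ξ t)) (hint t ht (ξ t) 1)
    have hnonneg : 0 ≤ ∫ x in (ξ s)..(ξ t), ρ t x :=
      intervalIntegral.integral_nonneg h fun x _ => (hrange t ht x).1
    have hmul := mul_nonneg hα.le hnonneg
    have hl := mul_le_mul_of_nonneg_left (abs_le.1 hleft).1 hα.le
    have hr := mul_le_mul_of_nonneg_left (abs_le.1 hright).2 hα.le
    rw [← hsplit_left] at hbt
    rw [← hsplit_right] at hr
    linarith
  refine LipschitzOnWith.of_dist_le_mul fun t ht s hs => ?_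
  rw [Real.coe_toNNReal _ (by positivity), Real.dist_eq, Real.dist_eq, abs_le]
  have hts := one_sided s hs t ht
  have hst := one_sided t ht s hs
  rw [abs_sub_comm] at hst
  constructor <;> linarith
end

section
/- Let ρ_max > 0 and let c : [0,ρ_max] → [1,∞) be Lipschitz continuous with Lipschitz constant L. Let ρ₁, ρ₂ : (−1,1) → [0,ρ_max] be measurable, and let ξ₁, ξ₂ ∈ (−1,1) be their respective turning points, i.e. ∫_{−1}^{ξ_i} c(ρ_i(y)) dy = ∫_{ξ_i}^{1} c(ρ_i(y)) dy for i = 1,2. Then |ξ₁ − ξ₂| ≤ (L/2)·∫_{−1}^{1} |ρ₁(y) − ρ₂(y)| dy. -/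
open MeasureTheory Set

/-- A measurable bounded real function is interval integrable on every interval. -/
lemma intervalIntegrable_of_measurable_of_abs_le {f : ℝ → ℝ} {C : ℝ} (hf : Measurable f)
    (hC : ∀ x, |f x| ≤ C) (s t : ℝ) : IntervalIntegrable f volume s t :=
  (intervalIntegrable_const (c := C)).mono_fun hf.aestronglyMeasurable
    (Filter.Eventually.of_forall fun x => (hC x).trans (le_abs_self C))

/-- A function satisfying a Lipschitz estimate on `[0, R]` is measurable after composition with a
measurable function valued in `[0, R]`. -/
lemma measurable_comp_of_abs_sub_le {R L : ℝ} (hR : 0 ≤ R) (hL : 0 ≤ L) {c ρ : ℝ → ℝ}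
    (hc : ∀ r ∈ Icc (0 : ℝ) R, ∀ s ∈ Icc (0 : ℝ) R, |c r - c s| ≤ L * |r - s|)
    (hρ : Measurable ρ) (hr : ∀ x, ρ x ∈ Icc (0 : ℝ) R) : Measurable fun x => c (ρ x) := by
  have hcont : ContinuousOn c (Icc 0 R) :=
    (LipschitzOnWith.of_dist_le_mul (K := ⟨L, hL⟩) fun r hr s hs => hc r hr s hs).continuousOn
  have hext : Continuous (IccExtend hR ((Icc 0 R).domRestrict c)) := hcont.domRestrict.Icc_extend'
  have heq : (fun x => c (ρ x)) = fun x => IccExtend hR ((Icc 0 R).domRestrict c) (ρ x) := by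
    funext x
    rw [IccExtend_of_mem _ _ (hr x), domRestrict_apply]
  rw [heq]
  exact hext.measurable.comp hρ

/-- Two balance points of weights `a ≥ 1` and `b` on an interval, ordered as `ξ ≤ η`, differ by at
most half of the `L¹` distance of the weights. -/
lemma two_mul_sub_le_integral_abs_sub {a b : ℝ → ℝ} {p q ξ η : ℝ}
    (ha : ∀ s t, IntervalIntegrable a volume s t) (hb : ∀ s t, IntervalIntegrable b volume s t)
    (ha1 : ∀ x, 1 ≤ a x) (hξη : ξ ≤ η) (hpη : p ≤ η) (hηq : η ≤ q)
    (hξ : ∫ y in p..ξ, a y = ∫ y in ξ..q, a y) (hη : ∫ y in p..η, b y = ∫ y in η..q, b y) :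
    2 * (η - ξ) ≤ ∫ y in p..q, |a y - b y| := by
  have hab s t : IntervalIntegrable (fun y => |a y - b y|) volume s t := ((ha s t).sub (hb s t)).abs
  have hlow : η - ξ ≤ ∫ y in ξ..η, a y := by
    simpa using intervalIntegral.integral_mono_on hξη intervalIntegrable_const (ha ξ η)
      fun x _ => ha1 x
  have hleft := intervalIntegral.abs_integral_le_integral_abs (μ := volume)
    (f := fun y => a y - b y) hpη
  have hright := intervalIntegral.abs_integral_le_integral_abs (μ := volume)
    (f := fun y => a y - b y) hηq
  rw [intervalIntegral.integral_sub (ha _ _) (hb _ _)] at hleft hright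
  have hadd₁ := intervalIntegral.integral_add_adjacent_intervals (ha p ξ) (ha ξ η)
  have hadd₂ := intervalIntegral.integral_add_adjacent_intervals (ha ξ η) (ha η q)
  have hadd₃ := intervalIntegral.integral_add_adjacent_intervals (hab p η) (hab η q)
  linarith [(abs_le.1 hleft).2, (abs_le.1 hright).1]

/-- L¹-stability of the turning point: if the cost `c : [0,ρmax] → [1,∞)` is
Lipschitz with constant `L`, then the turning points `ξ₁, ξ₂` of two densities
`ρ₁, ρ₂ : (−1,1) → [0,ρmax]` satisfy `|ξ₁ − ξ₂| ≤ (L/2)·‖ρ₁ − ρ₂‖_{L¹(−1,1)}`. -/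
theorem turning_point_stability
    (ρmax L : ℝ) (hρmax : 0 < ρmax) (hL : 0 ≤ L)
    (c : ℝ → ℝ) (hc1 : ∀ r ∈ Icc (0 : ℝ) ρmax, 1 ≤ c r)
    (hcLip : ∀ r ∈ Icc (0 : ℝ) ρmax, ∀ s ∈ Icc (0 : ℝ) ρmax, |c r - c s| ≤ L * |r - s|)
    (ρ₁ ρ₂ : ℝ → ℝ) (h₁ : Measurable ρ₁) (h₂ : Measurable ρ₂)
    (hr₁ : ∀ x : ℝ, ρ₁ x ∈ Icc (0 : ℝ) ρmax) (hr₂ : ∀ x : ℝ, ρ₂ x ∈ Icc (0 : ℝ) ρmax)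
    (ξ₁ ξ₂ : ℝ) (hξ₁ : ξ₁ ∈ Ioo (-1 : ℝ) 1) (hξ₂ : ξ₂ ∈ Ioo (-1 : ℝ) 1)
    (hb₁ : ∫ y in Ioo (-1 : ℝ) ξ₁, c (ρ₁ y) = ∫ y in Ioo ξ₁ 1, c (ρ₁ y))
    (hb₂ : ∫ y in Ioo (-1 : ℝ) ξ₂, c (ρ₂ y) = ∫ y in Ioo ξ₂ 1, c (ρ₂ y)) :
    |ξ₁ - ξ₂| ≤ L / 2 * ∫ y in Ioo (-1 : ℝ) 1, |ρ₁ y - ρ₂ y| := by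
  have habs (x : ℝ) (hx : x ∈ Icc 0 ρmax) : |c x| ≤ |c 0| + L * ρmax := by
    have h := hcLip x hx 0 ⟨le_rfl, hρmax.le⟩
    rw [sub_zero, abs_of_nonneg hx.1] at h
    linarith [abs_sub_abs_le_abs_sub (c x) (c 0), mul_le_mul_of_nonneg_left hx.2 hL]
  have hint (ρ : ℝ → ℝ) (hρ : Measurable ρ) (hr : ∀ x, ρ x ∈ Icc 0 ρmax) (s t : ℝ) :
      IntervalIntegrable (fun y => c (ρ y)) volume s t :=
    intervalIntegrable_of_measurable_of_abs_le
      (measurable_comp_of_abs_sub_le hρmax.le hL hcLip hρ hr) (fun x => habs _ (hr x)) s t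
  have hρint : IntervalIntegrable (fun y => |ρ₁ y - ρ₂ y|) volume (-1) 1 :=
    intervalIntegrable_of_measurable_of_abs_le (C := ρmax) (h₁.sub h₂).abs (fun x => by
      rw [abs_abs, Pi.sub_apply, abs_le]
      constructor <;> linarith [(hr₁ x).1, (hr₁ x).2, (hr₂ x).1, (hr₂ x).2]) _ _
  have i₁ := hint ρ₁ h₁ hr₁
  have i₂ := hint ρ₂ h₂ hr₂
  simp only [← integral_Ioc_eq_integral_Ioo] at hb₁ hb₂ ⊢
  rw [← intervalIntegral.integral_of_le hξ₁.1.le, ← intervalIntegral.integral_of_le hξ₁.2.le] at hb₁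
  rw [← intervalIntegral.integral_of_le hξ₂.1.le, ← intervalIntegral.integral_of_le hξ₂.2.le] at hb₂
  rw [← intervalIntegral.integral_of_le (by norm_num)]
  have hcost : ∫ y in (-1 : ℝ)..1, |c (ρ₁ y) - c (ρ₂ y)| ≤
      L * ∫ y in (-1 : ℝ)..1, |ρ₁ y - ρ₂ y| := by
    rw [← intervalIntegral.integral_const_mul]
    exact intervalIntegral.integral_mono_on (by norm_num) ((i₁ _ _).sub (i₂ _ _)).abs
      (hρint.const_mul L) fun x _ => hcLip _ (hr₁ x) _ (hr₂ x)
  rcases le_total ξ₁ ξ₂ with h | h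
  · have := two_mul_sub_le_integral_abs_sub i₁ i₂ (fun x => hc1 _ (hr₁ x)) h hξ₂.1.le hξ₂.2.le
      hb₁ hb₂
    rw [abs_of_nonpos (sub_nonpos.2 h)]
    linarith
  · have := two_mul_sub_le_integral_abs_sub i₂ i₁ (fun x => hc1 _ (hr₂ x)) h hξ₁.1.le hξ₁.2.le
      hb₂ hb₁
    simp only [abs_sub_comm (c (ρ₂ _))] at this
    rw [abs_of_nonneg (sub_nonneg.2 h)]
    linarith
end

section
/- Let m > 0, v_max > 0, K ∈ ℕ with K ≥ 1, and let v : (0,∞) → [0,v_max] be continuous and non-increasing. Let x₀,…,x_K : [0,T] → ℝ be C¹ functions with x_i(t) < x_{i+1}(t) for all t ∈ [0,T] and all i ∈ {0,…,K−1}, satisfying the forward follow-the-leader system: ẋ_i(t) = v( m/(x_{i+1}(t) − x_i(t)) ) for i ∈ {0,…,K−1}, and ẋ_K(t) = v_max. Define the discrete densities R_{i+1/2}(t) := m/(x_{i+1}(t) − x_i(t)) for i ∈ {0,…,K−1}. Then max_{0 ≤ i ≤ K−1} R_{i+1/2}(t) ≤ max_{0 ≤ i ≤ K−1} R_{i+1/2}(0)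 for every t ∈ [0,T] (discrete maximum principle). -/
open Set

/-- A function on `[0, T]` that starts above `d` and whose derivative is nonnegative wherever its
value is at most `d` stays above `d`. -/
lemma le_of_deriv_nonneg_of_le {g g' : ℝ → ℝ} {d T : ℝ}
    (hg : ∀ t ∈ Icc (0 : ℝ) T, HasDerivAt g (g' t) t) (h0 : d ≤ g 0)
    (hd : ∀ t ∈ Icc (0 : ℝ) T, g t ≤ d → 0 ≤ g' t) :
    ∀ t ∈ Icc (0 : ℝ) T, d ≤ g t := by
  have key : ∀ ε > 0, ∀ t ∈ Icc (0 : ℝ) T, -g t ≤ -d + ε * t := by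
    intro ε hε t ht
    refine image_le_of_deriv_right_lt_deriv_boundary (f := fun t => -g t) (f' := fun t => -g' t)
      (B := fun t => -d + ε * t) (B' := fun _ => ε) (a := 0) (b := T) ?_ ?_ ?_ ?_ ?_ ht
    · exact fun s hs => (hg s hs).continuousAt.neg.continuousWithinAt
    · exact fun s hs => (hg s (Ico_subset_Icc_self hs)).neg.hasDerivWithinAt
    · simpa using h0
    · intro s
      simpa using ((hasDerivAt_id s).const_mul ε).const_add (-d)
    · intro s hs h
      have h1 : 0 ≤ ε * s := mul_nonneg hε.le hs.1
      have h2 := hd s (Ico_subset_Icc_self hs) (by linarith)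
      linarith
  intro t ht
  refine le_of_forall_pos_le_add fun δ hδ => ?_
  have ht1 : 0 < t + 1 := by linarith [ht.1]
  have h1 := key (δ / (t + 1)) (div_pos hδ ht1) t ht
  have h2 : δ / (t + 1) * t ≤ δ := by
    rw [div_mul_eq_mul_div, div_le_iff₀ ht1]
    nlinarith
  linarith

/-- In the follow-the-leader system a lower bound on all initial gaps persists in time. -/
lemma follow_the_leader_gap_bound {m vmax T d : ℝ} (hm : 0 < m) {K : ℕ}
    {v : ℝ → ℝ} (hva : AntitoneOn v (Ioi 0)) (hvr : ∀ r ∈ Ioi (0 : ℝ), v r ≤ vmax)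
    {x : ℕ → ℝ → ℝ}
    (horder : ∀ t ∈ Icc (0 : ℝ) T, ∀ i < K, x i t < x (i + 1) t)
    (hode : ∀ i < K, ∀ t ∈ Icc (0 : ℝ) T,
      HasDerivAt (x i) (v (m / (x (i + 1) t - x i t))) t)
    (hlead : ∀ t ∈ Icc (0 : ℝ) T, HasDerivAt (x K) vmax t)
    (h0 : ∀ i < K, d ≤ x (i + 1) 0 - x i 0) {i : ℕ} (hi : i < K) :
    ∀ t ∈ Icc (0 : ℝ) T, d ≤ x (i + 1) t - x i t := by
  have hpos : ∀ t ∈ Icc (0 : ℝ) T, ∀ j < K, 0 < m / (x (j + 1) t - x j t) :=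
    fun t ht j hj => div_pos hm (sub_pos.2 (horder t ht j hj))
  induction hn : K - 1 - i generalizing i with
  | zero =>
    obtain rfl : K = i + 1 := by omega
    exact le_of_deriv_nonneg_of_le (fun t ht => (hlead t ht).sub (hode i hi t ht)) (h0 i hi)
      fun t ht _ => sub_nonneg.2 (hvr _ (hpos t ht i hi))
  | succ n ih =>
    have hi' : i + 1 < K := by omega
    have hnext := ih hi' (by omega)
    refine le_of_deriv_nonneg_of_le
      (fun t ht => (hode (i + 1) hi' t ht).sub (hode i hi t ht)) (h0 i hi) ?_
    intro t ht hle
    have hgap := sub_pos.2 (horder t ht i hi)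
    exact sub_nonneg.2 (hva (hpos t ht _ hi') (hpos t ht i hi)
      (div_le_div_of_nonneg_left hm.le hgap (hle.trans (hnext t ht))))

/-- Discrete maximum principle for the forward follow-the-leader scheme: the
maximal discrete density `max_i m/(x_{i+1}(t) − x_i(t))` does not exceed its
initial value. -/
theorem follow_the_leader_max_principle
    (m vmax T : ℝ) (hm : 0 < m) (hvmax : 0 < vmax) (hT : 0 ≤ T)
    (K : ℕ) (hK : 1 ≤ K)
    (v : ℝ → ℝ) (hvc : ContinuousOn v (Ioi 0))
    (hva : AntitoneOn v (Ioi 0))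
    (hvr : ∀ r ∈ Ioi (0 : ℝ), v r ∈ Icc 0 vmax)
    (x : ℕ → ℝ → ℝ)
    (horder : ∀ t ∈ Icc (0 : ℝ) T, ∀ i < K, x i t < x (i + 1) t)
    (hode : ∀ i < K, ∀ t ∈ Icc (0 : ℝ) T,
      HasDerivAt (x i) (v (m / (x (i + 1) t - x i t))) t)
    (hlead : ∀ t ∈ Icc (0 : ℝ) T, HasDerivAt (x K) vmax t) :
    ∀ t ∈ Icc (0 : ℝ) T,
      (Finset.range K).sup' (Finset.nonempty_range_iff.mpr (by omega))
          (fun i => m / (x (i + 1) t - x i t))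
        ≤ (Finset.range K).sup' (Finset.nonempty_range_iff.mpr (by omega))
          (fun i => m / (x (i + 1) 0 - x i 0)) := by
  intro t ht
  set M := (Finset.range K).sup' (Finset.nonempty_range_iff.mpr (by omega))
    (fun i => m / (x (i + 1) 0 - x i 0)) with hM
  have h0T : (0 : ℝ) ∈ Icc (0 : ℝ) T := ⟨le_rfl, hT⟩
  have hle : ∀ i < K, m / (x (i + 1) 0 - x i 0) ≤ M := fun i hi =>
    Finset.le_sup' (fun i => m / (x (i + 1) 0 - x i 0)) (Finset.mem_range.2 hi)
  have hMpos : 0 < M :=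
    (div_pos hm (sub_pos.2 (horder 0 h0T 0 hK))).trans_le (hle 0 hK)
  refine Finset.sup'_le _ _ fun i hi => ?_
  have hiK := Finset.mem_range.1 hi
  rw [div_le_comm₀ (sub_pos.2 (horder t ht i hiK)) hMpos]
  refine follow_the_leader_gap_bound hm hva (fun r hr => (hvr r hr).2)
    horder hode hlead (fun j hj => ?_) hiK t ht
  exact (div_le_comm₀ (sub_pos.2 (horder 0 h0T j hj)) hMpos).1 (hle j hj)
end

section
/- Let m > 0, v_max > 0, K ∈ ℕ with K ≥ 2, and let v : (0,∞) → [0,v_max] be continuous and non-increasing. Let x₀,…,x_K : [0,T] → ℝ be C¹ functions with x_i(t) < x_{i+1}(t) for all t ∈ [0,T] and all i ∈ {0,…,K−1}, satisfying the forward follow-the-leader system: ẋ_i(t) = v( m/(x_{i+1}(t) − x_i(t)) ) for i ∈ {0,…,K−1}, and ẋ_K(t) = v_max. With R_{i+1/2}(t) := m/(x_{i+1}(t) − x_i(t)), define the discrete total variation TV(t) := R_{1/2}(t) + Σ_{i=1}^{K−1} |R_{i+1/2}(t) − R_{i−1/2}(t)| + R_{K−1/2}(t). Then TV(t) ≤ TV(0)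 for every t ∈ [0,T]. -/
open Set

/-- The right derivative of `|f|` at a point where `f` is differentiable. -/
theorem hasDerivWithinAt_abs_comp_Ici {f : ℝ → ℝ} {f' t : ℝ} (hf : HasDerivAt f f' t) :
    HasDerivWithinAt (fun s => |f s|)
      (if 0 < f t then f' else if f t < 0 then -f' else |f'|) (Ici t) t := by
  split_ifs with hpos hneg
  · refine (hf.congr_of_eventuallyEq ?_).hasDerivWithinAt
    filter_upwards [hf.continuousAt.eventually (lt_mem_nhds hpos)] with s hs
    exact abs_of_pos hs
  · refine (hf.neg.congr_of_eventuallyEq ?_).hasDerivWithinAt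
    filter_upwards [hf.continuousAt.eventually (gt_mem_nhds hneg)] with s hs
    exact abs_of_neg hs
  · have hzero : f t = 0 := le_antisymm (not_lt.mp hpos) (not_lt.mp hneg)
    rw [← hasDerivWithinAt_Ioi_iff_Ici, hasDerivWithinAt_iff_tendsto_slope' self_notMem_Ioi]
    have hslope := (hasDerivWithinAt_iff_tendsto_slope' self_notMem_Ioi).mp
      (hf.hasDerivWithinAt (s := Ioi t))
    refine hslope.abs.congr' ?_
    filter_upwards [self_mem_nhdsWithin] with s hs
    simp [slope_def_field, hzero, abs_div, abs_of_pos (sub_pos.mpr (mem_Ioi.mp hs))]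

/-- If `a = c * (v p - v q)` is the velocity of `p`, with `v` non-increasing and `c ≥ 0`, then the
right derivative of `|q - p|` is at most `|b| - |a|`, where `b` is the velocity of `q`. -/
theorem rightDeriv_abs_sub_le {v : ℝ → ℝ} (hv : AntitoneOn v (Ioi 0)) {p q c : ℝ} (hp : 0 < p)
    (hq : 0 < q) (hc : 0 ≤ c) (b : ℝ) :
    (if 0 < q - p then b - c * (v p - v q)
      else if q - p < 0 then -(b - c * (v p - v q)) else |b - c * (v p - v q)|)
      ≤ |b| - |c * (v p - v q)| := by
  split_ifs with hpos hneg
  · have hle : v q ≤ v p := hv hp hq (by linarith)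
    rw [abs_of_nonneg (mul_nonneg hc (sub_nonneg.mpr hle))]
    linarith [le_abs_self b]
  · have hle : v p ≤ v q := hv hq hp (by linarith)
    rw [abs_of_nonpos (mul_nonpos_of_nonneg_of_nonpos hc (sub_nonpos.mpr hle))]
    linarith [neg_le_abs b]
  · have heq : q = p := by linarith
    simp [heq]

/-- Time derivative of the discrete density `m / (y - x)` between two particles. -/
theorem hasDerivAt_discrete_density {x y : ℝ → ℝ} {m a b t : ℝ} (hm : m ≠ 0)
    (hx : HasDerivAt x a t) (hy : HasDerivAt y b t) (hxy : x t < y t) :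
    HasDerivAt (fun s => m / (y s - x s)) ((m / (y t - x t)) ^ 2 / m * (a - b)) t := by
  have hne : y t - x t ≠ 0 := (sub_pos.mpr hxy).ne'
  refine ((hasDerivAt_const t m).fun_div (hy.fun_sub hx) hne).congr_deriv ?_
  field_simp
  ring

/-- Discrete total variation estimate for the forward follow-the-leader scheme:
with `R_{i+1/2}(t) = m/(x_{i+1}(t) − x_i(t))`, the discrete total variation
`TV(t) = R_{1/2}(t) + Σ_{i=1}^{K−1} |R_{i+1/2}(t) − R_{i−1/2}(t)| + R_{K−1/2}(t)`
does not increase in time. -/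
theorem follow_the_leader_TV_estimate
    (m vmax T : ℝ) (hm : 0 < m) (hvmax : 0 < vmax) (hT : 0 ≤ T)
    (K : ℕ) (hK : 2 ≤ K)
    (v : ℝ → ℝ) (hvc : ContinuousOn v (Ioi 0))
    (hva : AntitoneOn v (Ioi 0))
    (hvr : ∀ r ∈ Ioi (0 : ℝ), v r ∈ Icc 0 vmax)
    (x : ℕ → ℝ → ℝ)
    (horder : ∀ t ∈ Icc (0 : ℝ) T, ∀ i < K, x i t < x (i + 1) t)
    (hode : ∀ i < K, ∀ t ∈ Icc (0 : ℝ) T,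
      HasDerivAt (x i) (v (m / (x (i + 1) t - x i t))) t)
    (hlead : ∀ t ∈ Icc (0 : ℝ) T, HasDerivAt (x K) vmax t) :
    ∀ t ∈ Icc (0 : ℝ) T,
      m / (x 1 t - x 0 t)
        + (∑ i ∈ Finset.range (K - 1),
            |m / (x (i + 2) t - x (i + 1) t) - m / (x (i + 1) t - x i t)|)
        + m / (x K t - x (K - 1) t)
      ≤ m / (x 1 0 - x 0 0)
        + (∑ i ∈ Finset.range (K - 1),
            |m / (x (i + 2) 0 - x (i + 1) 0) - m / (x (i + 1) 0 - x i 0)|)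
        + m / (x K 0 - x (K - 1) 0) := by
  obtain ⟨n, rfl⟩ : ∃ n, K = n + 1 := ⟨K - 1, by omega⟩
  simp only [Nat.add_sub_cancel]
  set R : ℕ → ℝ → ℝ := fun i t => m / (x (i + 1) t - x i t) with hR
  have hRpos : ∀ t ∈ Icc (0 : ℝ) T, ∀ i < n + 1, 0 < R i t := fun t ht i hi =>
    div_pos hm (sub_pos.mpr (horder t ht i hi))
  set R' : ℕ → ℝ → ℝ := fun i t =>
    R i t ^ 2 / m * (v (R i t) - if i < n then v (R (i + 1) t) else vmax) with hR'
  have hderiv : ∀ t ∈ Icc (0 : ℝ) T, ∀ i < n + 1, HasDerivAt (R i) (R' i t) t := by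
    intro t ht i hi
    refine hasDerivAt_discrete_density hm.ne' (hode i hi t ht) ?_ (horder t ht i hi)
    split_ifs with hin
    · exact hode (i + 1) (by omega) t ht
    · obtain rfl : i = n := by omega
      exact hlead t ht
  have hinner : ∀ t, ∀ i < n, R' i t = R i t ^ 2 / m * (v (R i t) - v (R (i + 1) t)) := by
    intro t i hi
    simp only [hR', if_pos hi]
  have hlast : ∀ t ∈ Icc (0 : ℝ) T, R' n t ≤ 0 := by
    intro t ht
    simp only [hR', lt_irrefl, if_false]
    exact mul_nonpos_of_nonneg_of_nonpos (by positivity)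
      (sub_nonpos.mpr (hvr _ (hRpos t ht n (by omega))).2)
  set TV : ℝ → ℝ := fun t =>
    R 0 t + (∑ i ∈ Finset.range n, |R (i + 1) t - R i t|) + R n t with hTV
  set D : ℕ → ℝ → ℝ := fun i t =>
    if 0 < R (i + 1) t - R i t then R' (i + 1) t - R' i t
    else if R (i + 1) t - R i t < 0 then -(R' (i + 1) t - R' i t)
    else |R' (i + 1) t - R' i t| with hD
  have hDle : ∀ t ∈ Icc (0 : ℝ) T, ∀ i < n, D i t ≤ |R' (i + 1) t| - |R' i t| := by
    intro t ht i hi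
    simp only [hD]
    rw [hinner t i hi]
    exact rightDeriv_abs_sub_le hva (hRpos t ht i (by omega)) (hRpos t ht (i + 1) (by omega))
      (by positivity) _
  have hTVcont : ContinuousOn TV (Icc 0 T) := by
    have hcont : ∀ i < n + 1, ContinuousOn (R i) (Icc 0 T) := fun i hi t ht =>
      (hderiv t ht i hi).continuousAt.continuousWithinAt
    refine ((hcont 0 (by omega)).add (continuousOn_finsetSum _ fun i hi => ?_)).add
      (hcont n (by omega))
    have hin := Finset.mem_range.mp hi
    exact ((hcont (i + 1) (by omega)).sub (hcont i (by omega))).abs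
  have hTVderiv : ∀ t ∈ Ico (0 : ℝ) T, HasDerivWithinAt TV
      (R' 0 t + (∑ i ∈ Finset.range n, D i t) + R' n t) (Ici t) t := by
    intro t ht
    have htI := Ico_subset_Icc_self ht
    refine ((hderiv t htI 0 (by omega)).hasDerivWithinAt.fun_add
      (HasDerivWithinAt.fun_sum fun i hi => ?_)).fun_add
      (hderiv t htI n (by omega)).hasDerivWithinAt
    have hin := Finset.mem_range.mp hi
    exact hasDerivWithinAt_abs_comp_Ici
      ((hderiv t htI (i + 1) (by omega)).fun_sub (hderiv t htI i (by omega)))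
  have hbound : ∀ t ∈ Ico (0 : ℝ) T,
      R' 0 t + (∑ i ∈ Finset.range n, D i t) + R' n t ≤ 0 := by
    intro t ht
    have htI := Ico_subset_Icc_self ht
    have hsum : ∑ i ∈ Finset.range n, D i t ≤ |R' n t| - |R' 0 t| := by
      rw [← Finset.sum_range_sub (fun i => |R' i t|)]
      exact Finset.sum_le_sum fun i hi => hDle t htI i (Finset.mem_range.mp hi)
    rw [abs_of_nonpos (hlast t htI)] at hsum
    linarith [le_abs_self (R' 0 t)]
  exact fun t ht => image_le_of_deriv_right_le_deriv_boundary hTVcont hTVderiv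
    (B := fun _ => TV 0) le_rfl continuousOn_const
    (fun s _ => hasDerivWithinAt_const s _ _) hbound ht
end

section
/- Let m > 0, v_max > 0, N ∈ ℕ, I₀ ∈ {1,…,N−2}, and let v : (0,∞) → [0,v_max] be continuous and non-increasing. Let x₀,…,x_N : [0,T] → ℝ be C¹ functions with x_i(t) < x_{i+1}(t) for all t and i, satisfying the two-sided follow-the-leader system of Hughes' deterministic particle approximation: ẋ₀ = −v_max, ẋ_i(t) = −v( m/(x_i(t) − x_{i−1}(t)) ) for i ∈ {1,…,I₀}, ẋ_i(t) = v( m/(x_{i+1}(t) − x_i(t)) ) for i ∈ {I₀+1,…,N−1}, and ẋ_N = v_max. Suppose R̄ > 0 is such that m/(x_{i+1}(0) − x_i(0)) ≤ R̄ for every i ∈ {0,…,N−1} with i ≠ I₀. Then for every t ∈ [0,T] one has ẋ_{I₀}(t) ≤ −v(R̄) and ẋ_{I₀+1}(t) ≥ v(R̄); consequently x_{I₀+1}(t) − x_{I₀}(t) ≥ x_{I₀+1}(0) − x_{I₀}(0) + 2·v(R̄)·t, so the two groups of particles separate at least at rate 2·v(R̄). -/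
open Set

/-- A function that starts at or above `L`, and whose derivative is nonnegative wherever it is
below `L`, stays at or above `L`. -/
theorem le_of_hasDerivAt_nonneg_of_lt {d d' : ℝ → ℝ} {T L : ℝ}
    (hd : ∀ t ∈ Icc (0 : ℝ) T, HasDerivAt d (d' t) t) (h0 : L ≤ d 0)
    (h : ∀ t ∈ Icc (0 : ℝ) T, d t < L → 0 ≤ d' t) :
    ∀ t ∈ Icc (0 : ℝ) T, L ≤ d t := by
  intro t ht
  have key : ∀ ε > 0, -d t ≤ -L + ε * (t + 1) := by
    intro ε hε
    refine image_le_of_deriv_right_lt_deriv_boundary (f := fun s => -d s) (f' := fun s => -d' s)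
      (B := fun s => -L + ε * (s + 1)) (B' := fun _ => ε) (a := 0) (b := T)
      (fun s hs => (hd s hs).continuousAt.neg.continuousWithinAt)
      (fun s hs => (hd s (Ico_subset_Icc_self hs)).neg.hasDerivWithinAt)
      (by linarith) (fun s => ?_) (fun s hs heq => ?_) ht
    · simpa using (((hasDerivAt_id s).add_const 1).const_mul ε).const_add (-L)
    · have hpos : 0 < ε * (s + 1) := mul_pos hε (by linarith [hs.1])
      have := h s (Ico_subset_Icc_self hs) (by linarith)
      linarith
  by_contra! hlt
  have ht1 : 0 < t + 1 := by linarith [ht.1]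
  have := key ((L - d t) / (2 * (t + 1))) (by apply div_pos <;> linarith)
  have heq : (L - d t) / (2 * (t + 1)) * (t + 1) = (L - d t) / 2 := by field_simp
  linarith

/-- Maximum principle for one follower: if the leader moves at speed at least `v R`, the density
bound `m / g ≤ R` on the gap `g` between follower and leader is preserved. -/
theorem density_le_of_follow_leader {m T R : ℝ} (hm : 0 < m) (hR : 0 < R)
    {v : ℝ → ℝ} (hva : AntitoneOn v (Ioi 0)) {g u : ℝ → ℝ}
    (hpos : ∀ t ∈ Icc (0 : ℝ) T, 0 < g t) (hg0 : 0 < g 0)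
    (hg : ∀ t ∈ Icc (0 : ℝ) T, HasDerivAt g (u t - v (m / g t)) t)
    (hu : ∀ t ∈ Icc (0 : ℝ) T, v R ≤ u t) (hinit : m / g 0 ≤ R) :
    ∀ t ∈ Icc (0 : ℝ) T, m / g t ≤ R := by
  intro t ht
  have hmain := le_of_hasDerivAt_nonneg_of_lt (L := m / R) hg ((div_le_comm₀ hg0 hR).1 hinit)
    (fun s hs hlt => by
      have hle : R ≤ m / g s := ((lt_div_comm₀ (hpos s hs) hR).1 hlt).le
      have := hva hR (div_pos hm (hpos s hs)) hle
      linarith [hu s hs]) t ht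
  exact (div_le_comm₀ hR (hpos t ht)).1 hmain

/-- In the two-sided follow-the-leader approximation of Hughes' model, if all
initial discrete densities except the middle one are bounded by `R̄`, then the
two particles adjacent to the middle gap move away from each other with speeds
at least `v(R̄)`, so the two groups separate at least at rate `2·v(R̄)`. -/
theorem hughes_particles_separation
    (m vmax T Rbar : ℝ) (hm : 0 < m) (hvmax : 0 < vmax) (hT : 0 ≤ T) (hRbar : 0 < Rbar)
    (N I₀ : ℕ) (hN : 3 ≤ N) (hI₀ : 1 ≤ I₀) (hI₀N : I₀ ≤ N - 2)
    (v : ℝ → ℝ) (hvc : ContinuousOn v (Ioi 0))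
    (hva : AntitoneOn v (Ioi 0))
    (hvr : ∀ r ∈ Ioi (0 : ℝ), v r ∈ Icc 0 vmax)
    (x : ℕ → ℝ → ℝ)
    (horder : ∀ t ∈ Icc (0 : ℝ) T, ∀ i < N, x i t < x (i + 1) t)
    (h0 : ∀ t ∈ Icc (0 : ℝ) T, HasDerivAt (x 0) (-vmax) t)
    (hleft : ∀ i, 1 ≤ i → i ≤ I₀ → ∀ t ∈ Icc (0 : ℝ) T,
      HasDerivAt (x i) (-(v (m / (x i t - x (i - 1) t)))) t)
    (hright : ∀ i, I₀ + 1 ≤ i → i ≤ N - 1 → ∀ t ∈ Icc (0 : ℝ) T,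
      HasDerivAt (x i) (v (m / (x (i + 1) t - x i t))) t)
    (hlead : ∀ t ∈ Icc (0 : ℝ) T, HasDerivAt (x N) vmax t)
    (hinit : ∀ i < N, i ≠ I₀ → m / (x (i + 1) 0 - x i 0) ≤ Rbar) :
    ∀ t ∈ Icc (0 : ℝ) T,
      deriv (x I₀) t ≤ -(v Rbar) ∧
      v Rbar ≤ deriv (x (I₀ + 1)) t ∧
      x (I₀ + 1) 0 - x I₀ 0 + 2 * v Rbar * t ≤ x (I₀ + 1) t - x I₀ t := by
  have hzero : (0 : ℝ) ∈ Icc (0 : ℝ) T := ⟨le_rfl, hT⟩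
  have hvR : v Rbar ≤ vmax := (hvr Rbar hRbar).2
  have hgap : ∀ i < N, ∀ t ∈ Icc (0 : ℝ) T, 0 < x (i + 1) t - x i t :=
    fun i hi t ht => sub_pos.2 (horder t ht i hi)
  have hspeed : ∀ i < N, ∀ t ∈ Icc (0 : ℝ) T, m / (x (i + 1) t - x i t) ≤ Rbar →
      v Rbar ≤ v (m / (x (i + 1) t - x i t)) :=
    fun i hi t ht hle => hva (div_pos hm (hgap i hi t ht)) hRbar hle
  have hL : ∀ k < I₀, ∀ t ∈ Icc (0 : ℝ) T, m / (x (k + 1) t - x k t) ≤ Rbar := by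
    intro k
    induction k with
    | zero =>
      intro hk
      refine density_le_of_follow_leader (u := fun _ => vmax) hm hRbar hva
        (hgap 0 (by omega)) (hgap 0 (by omega) 0 hzero) (fun t ht => ?_) (fun _ _ => hvR)
        (hinit 0 (by omega) (by omega))
      refine ((hleft 1 le_rfl hI₀ t ht).sub (h0 t ht)).congr_deriv ?_
      simp only [Nat.sub_self, zero_add]
      ring
    | succ k ih =>
      intro hk
      refine density_le_of_follow_leader (u := fun t => v (m / (x (k + 1) t - x k t)))
        hm hRbar hva (hgap (k + 1) (by omega)) (hgap (k + 1) (by omega) 0 hzero)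
        (fun t ht => ?_) (fun t ht => hspeed k (by omega) t ht (ih (by omega) t ht))
        (hinit (k + 1) (by omega) (by omega))
      refine ((hleft (k + 1 + 1) (by omega) (by omega) t ht).sub
        (hleft (k + 1) (by omega) (by omega) t ht)).congr_deriv ?_
      simp only [Nat.add_sub_cancel]
      ring
  have hR : ∀ k i, i + 1 + k = N → I₀ < i →
      ∀ t ∈ Icc (0 : ℝ) T, m / (x (i + 1) t - x i t) ≤ Rbar := by
    intro k
    induction k with
    | zero =>
      rintro i hiN hi
      refine density_le_of_follow_leader (u := fun _ => vmax) hm hRbar hva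
        (hgap i (by omega)) (hgap i (by omega) 0 hzero) (fun t ht => ?_) (fun _ _ => hvR)
        (hinit i (by omega) (by omega))
      obtain rfl : i + 1 = N := hiN
      exact (hlead t ht).sub (hright i (by omega) (by omega) t ht)
    | succ k ih =>
      intro i hiN hi
      refine density_le_of_follow_leader
        (u := fun t => v (m / (x (i + 1 + 1) t - x (i + 1) t)))
        hm hRbar hva (hgap i (by omega)) (hgap i (by omega) 0 hzero)
        (fun t ht => ?_)
        (fun t ht => hspeed (i + 1) (by omega) t ht (ih (i + 1) (by omega) (by omega) t ht))
        (hinit i (by omega) (by omega))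
      exact (hright (i + 1) (by omega) (by omega) t ht).sub
        (hright i (by omega) (by omega) t ht)
  have hdL := hleft I₀ hI₀ le_rfl
  have hdR := hright (I₀ + 1) le_rfl (by omega)
  have hvL : ∀ t ∈ Icc (0 : ℝ) T, v Rbar ≤ v (m / (x I₀ t - x (I₀ - 1) t)) := by
    intro t ht
    have := hspeed (I₀ - 1) (by omega) t ht (hL (I₀ - 1) (by omega) t ht)
    rwa [Nat.sub_add_cancel hI₀] at this
  have hvRt : ∀ t ∈ Icc (0 : ℝ) T, v Rbar ≤ v (m / (x (I₀ + 1 + 1) t - x (I₀ + 1) t)) :=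
    fun t ht => hspeed (I₀ + 1) (by omega) t ht
      (hR (N - (I₀ + 2)) (I₀ + 1) (by omega) (by omega) t ht)
  intro t ht
  refine ⟨?_, ?_, ?_⟩
  · rw [(hdL t ht).deriv]
    exact neg_le_neg (hvL t ht)
  · rw [(hdR t ht).deriv]
    exact hvRt t ht
  · have hsep := le_of_hasDerivAt_nonneg_of_lt
      (d := fun s => x (I₀ + 1) s - x I₀ s - 2 * v Rbar * s) (L := x (I₀ + 1) 0 - x I₀ 0)
      (fun s hs => ((hdR s hs).sub (hdL s hs)).sub ((hasDerivAt_id s).const_mul (2 * v Rbar)))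
      (by simp) (fun s hs _ => by linarith [hvL s hs, hvRt s hs]) t ht
    linarith
end

section
/- Let δ > 0, ρ_max > 0, and let ρ : ℝ×(−1,1) → [0,ρ_max] be measurable. Define the subjective (memory) density 𝓡[ρ](t,x) := δ·∫_{−∞}^{t} ρ(s,x)·e^{−δ(t−s)} ds. Then: (i) 0 ≤ 𝓡[ρ](t,x) ≤ ρ_max for all t and a.e. x; (ii) for a.e. x ∈ (−1,1), the map t ↦ 𝓡[ρ](t,x) is Lipschitz continuous with Lipschitz constant at most δ·ρ_max; (iii) if c : [0,ρ_max] → [1,∞) is Lipschitz with constant L, then the curve ξ_δ defined by letting ξ_δ(t) be the unique point of (−1,1) with ∫_{−1}^{ξ_δ(t)} c(𝓡[ρ](t,x)) dx = ∫_{ξ_δ(t)}^{1} c(𝓡[ρ](t,x)) dx is Lipschitz continuous on ℝ with Lipschitz constant at most L·δ·ρ_max. -/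
open MeasureTheory Set

/-- A bounded measurable density is integrable against the exponential weight on a left half-line. -/
lemma integrableOn_mul_exp_Iic {δ M : ℝ} (hδ : 0 < δ) {u : ℝ → ℝ} (hu : Measurable u)
    (hM : ∀ s, u s ∈ Icc 0 M) (t : ℝ) :
    IntegrableOn (fun s => u s * Real.exp (δ * s)) (Iic t) := by
  refine (integrableOn_exp_mul_Iic hδ t).bdd_mul (c := M) hu.aestronglyMeasurable ?_
  filter_upwards with s
  rw [Real.norm_of_nonneg (hM s).1]
  exact (hM s).2

lemma setIntegral_mul_exp_Iic_mem_Icc {δ M : ℝ} (hδ : 0 < δ) {u : ℝ → ℝ} (hu : Measurable u)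
    (hM : ∀ s, u s ∈ Icc 0 M) (t : ℝ) :
    ∫ s in Iic t, u s * Real.exp (δ * s) ∈ Icc 0 (M * (Real.exp (δ * t) / δ)) := by
  refine ⟨integral_nonneg fun s => mul_nonneg (hM s).1 (Real.exp_nonneg _), ?_⟩
  rw [← integral_exp_mul_Iic hδ, ← integral_const_mul]
  refine integral_mono (integrableOn_mul_exp_Iic hδ hu hM t)
    ((integrableOn_exp_mul_Iic hδ t).const_mul M) fun s => ?_
  exact mul_le_mul_of_nonneg_right (hM s).2 (Real.exp_nonneg _)

lemma setIntegral_mul_exp_Iic_sub_mem_Icc {δ M : ℝ} (hδ : 0 < δ) {u : ℝ → ℝ}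
    (hu : Measurable u) (hM : ∀ s, u s ∈ Icc 0 M) {t t' : ℝ} (h : t ≤ t') :
    (∫ s in Iic t', u s * Real.exp (δ * s)) - ∫ s in Iic t, u s * Real.exp (δ * s) ∈
      Icc 0 (M * ((Real.exp (δ * t') - Real.exp (δ * t)) / δ)) := by
  have hi := integrableOn_mul_exp_Iic hδ hu hM
  have he := integrableOn_exp_mul_Iic hδ
  rw [sub_div, ← integral_exp_mul_Iic hδ, ← integral_exp_mul_Iic hδ,
    intervalIntegral.integral_Iic_sub_Iic (hi t) (hi t'),
    intervalIntegral.integral_Iic_sub_Iic (he t) (he t'), ← intervalIntegral.integral_const_mul]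
  refine ⟨intervalIntegral.integral_nonneg h fun s _ =>
    mul_nonneg (hM s).1 (Real.exp_nonneg _), ?_⟩
  refine intervalIntegral.integral_mono_on h ?_ ?_ fun s _ =>
    mul_le_mul_of_nonneg_right (hM s).2 (Real.exp_nonneg _)
  · rw [intervalIntegrable_iff_integrableOn_Ioc_of_le h]
    exact (hi t').mono_set Ioc_subset_Iic_self
  · exact Continuous.intervalIntegrable (by fun_prop) _ _

lemma exponentialAverage_eq (δ t : ℝ) (u : ℝ → ℝ) :
    δ * ∫ s in Iic t, u s * Real.exp (-δ * (t - s)) =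
      δ * Real.exp (-(δ * t)) * ∫ s in Iic t, u s * Real.exp (δ * s) := by
  rw [mul_assoc, ← integral_const_mul (Real.exp (-(δ * t)))]
  congr 2 with s
  rw [mul_left_comm, ← Real.exp_add]
  congr 2
  ring

lemma exponentialAverage_mem_Icc {δ M : ℝ} (hδ : 0 < δ) {u : ℝ → ℝ} (hu : Measurable u)
    (hM : ∀ s, u s ∈ Icc 0 M) (t : ℝ) :
    δ * ∫ s in Iic t, u s * Real.exp (-δ * (t - s)) ∈ Icc 0 M := by
  obtain ⟨h0, h1⟩ := setIntegral_mul_exp_Iic_mem_Icc hδ hu hM t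
  rw [exponentialAverage_eq]
  refine ⟨by positivity, ?_⟩
  calc _ ≤ δ * Real.exp (-(δ * t)) * (M * (Real.exp (δ * t) / δ)) := by gcongr
    _ = M := by
      rw [Real.exp_neg]
      field_simp

lemma abs_exponentialAverage_sub_le {δ M : ℝ} (hδ : 0 < δ) {u : ℝ → ℝ} (hu : Measurable u)
    (hM : ∀ s, u s ∈ Icc 0 M) {t t' : ℝ} (h : t ≤ t') :
    |(δ * ∫ s in Iic t', u s * Real.exp (-δ * (t' - s))) -
      δ * ∫ s in Iic t, u s * Real.exp (-δ * (t - s))| ≤ δ * M * (t' - t) := by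
  obtain ⟨h0, h1⟩ := setIntegral_mul_exp_Iic_mem_Icc hδ hu hM t
  obtain ⟨h2, h3⟩ := setIntegral_mul_exp_Iic_sub_mem_Icc hδ hu hM h
  rw [exponentialAverage_eq, exponentialAverage_eq]
  set G := ∫ s in Iic t, u s * Real.exp (δ * s)
  set G' := ∫ s in Iic t', u s * Real.exp (δ * s)
  have hM0 : 0 ≤ M := (hM 0).1.trans (hM 0).2
  have hle : Real.exp (-(δ * t')) ≤ Real.exp (-(δ * t)) := by gcongr
  have hexp : Real.exp (-(δ * t')) * Real.exp (δ * t) = Real.exp (-(δ * (t' - t))) := by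
    rw [← Real.exp_add]
    congr 1
    ring
  have hone (r : ℝ) : Real.exp (-(δ * r)) * Real.exp (δ * r) = 1 := by
    rw [← Real.exp_add, neg_add_cancel, Real.exp_zero]
  have hgain : δ * Real.exp (-(δ * t')) * (G' - G) ≤ M * (1 - Real.exp (-(δ * (t' - t)))) := by
    calc _ ≤ δ * Real.exp (-(δ * t')) *
          (M * ((Real.exp (δ * t') - Real.exp (δ * t)) / δ)) := by gcongr
      _ = M * (Real.exp (-(δ * t')) * Real.exp (δ * t') -
          Real.exp (-(δ * t')) * Real.exp (δ * t)) := by field_simp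
      _ = _ := by rw [hone, hexp]
  have hloss : δ * (Real.exp (-(δ * t)) - Real.exp (-(δ * t'))) * G ≤
      M * (1 - Real.exp (-(δ * (t' - t)))) := by
    calc _ ≤ δ * (Real.exp (-(δ * t)) - Real.exp (-(δ * t'))) *
          (M * (Real.exp (δ * t) / δ)) :=
          mul_le_mul_of_nonneg_left h1 (mul_nonneg hδ.le (sub_nonneg.2 hle))
      _ = M * (Real.exp (-(δ * t)) * Real.exp (δ * t) -
          Real.exp (-(δ * t')) * Real.exp (δ * t)) := by field_simp
      _ = _ := by rw [hone, hexp]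
  have hgain0 : 0 ≤ δ * Real.exp (-(δ * t')) * (G' - G) := by positivity
  have hloss0 : 0 ≤ δ * (Real.exp (-(δ * t)) - Real.exp (-(δ * t'))) * G :=
    mul_nonneg (mul_nonneg hδ.le (sub_nonneg.2 hle)) h0
  have hlin : M * (1 - Real.exp (-(δ * (t' - t)))) ≤ δ * M * (t' - t) := by
    have := mul_le_mul_of_nonneg_left (Real.add_one_le_exp (-(δ * (t' - t)))) hM0
    linarith
  rw [abs_le]
  constructor <;> linarith

/-- The turning point depends on the cost in a `1`-Lipschitz way for the uniform distance. -/
lemma turningPoint_sub_le {f g : ℝ → ℝ} {K a b : ℝ}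
    (hf : IntegrableOn f (Ioo (-1) 1)) (hg : IntegrableOn g (Ioo (-1) 1))
    (hf1 : ∀ x ∈ Ioo (-1 : ℝ) 1, 1 ≤ f x) (hg1 : ∀ x ∈ Ioo (-1 : ℝ) 1, 1 ≤ g x)
    (hfg : ∀ x ∈ Ioo (-1 : ℝ) 1, |f x - g x| ≤ K)
    (ha : a ∈ Ioo (-1 : ℝ) 1) (hb : b ∈ Ioo (-1 : ℝ) 1)
    (hfa : ∫ x in Ioo (-1) a, f x = ∫ x in Ioo a 1, f x)
    (hgb : ∫ x in Ioo (-1) b, g x = ∫ x in Ioo b 1, g x) : b - a ≤ K := by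
  have hK : 0 ≤ K := (abs_nonneg _).trans (hfg a ha)
  rcases le_total b a with hba | hab
  · linarith
  have toInterval (φ : ℝ → ℝ) {p q : ℝ} (hpq : p ≤ q) :
      ∫ x in Ioo p q, φ x = ∫ x in p..q, φ x := by
    rw [intervalIntegral.integral_of_le hpq, integral_Ioc_eq_integral_Ioo]
  have hint {φ : ℝ → ℝ} (hφ : IntegrableOn φ (Ioo (-1) 1)) {p q : ℝ} (hp : -1 ≤ p)
      (hpq : p ≤ q) (hq : q ≤ 1) : IntervalIntegrable φ volume p q := by
    rw [intervalIntegrable_iff_integrableOn_Ioo_of_le hpq]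
    exact hφ.mono_set (Ioo_subset_Ioo hp hq)
  have hconst {φ : ℝ → ℝ} {m p q : ℝ} (hφ : IntegrableOn φ (Ioo (-1) 1)) (hp : -1 ≤ p)
      (hpq : p ≤ q) (hq : q ≤ 1) (hm : ∀ x ∈ Ioo (-1 : ℝ) 1, m ≤ φ x) :
      (q - p) * m ≤ ∫ x in p..q, φ x := by
    rw [← smul_eq_mul, ← intervalIntegral.integral_const]
    exact intervalIntegral.integral_mono_on_of_le_Ioo hpq intervalIntegrable_const
      (hint hφ hp hpq hq) fun x hx => hm x (Ioo_subset_Ioo hp hq hx)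
  rw [toInterval f ha.1.le, toInterval f ha.2.le, ← intervalIntegral.integral_add_adjacent_intervals
    (hint hf ha.1.le hab hb.2.le) (hint hf hb.1.le hb.2.le le_rfl)] at hfa
  rw [toInterval g hb.1.le, toInterval g hb.2.le, ← intervalIntegral.integral_add_adjacent_intervals
    (hint hg le_rfl ha.1.le ha.2.le) (hint hg ha.1.le hab hb.2.le)] at hgb
  have hleft := hconst (m := -K) (hg.sub hf) le_rfl ha.1.le ha.2.le fun x hx => by
    have := (abs_le.1 (hfg x hx)).2
    simp only [Pi.sub_apply]
    linarith
  have hright := hconst (m := -K) (hf.sub hg) hb.1.le hb.2.le le_rfl fun x hx => by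
    have := (abs_le.1 (hfg x hx)).1
    simpa only [Pi.sub_apply]
  simp only [Pi.sub_apply] at hleft hright
  rw [intervalIntegral.integral_sub (hint hg le_rfl ha.1.le ha.2.le)
    (hint hf le_rfl ha.1.le ha.2.le)] at hleft
  rw [intervalIntegral.integral_sub (hint hf hb.1.le hb.2.le le_rfl)
    (hint hg hb.1.le hb.2.le le_rfl)] at hright
  have hmidf := hconst hf ha.1.le hab hb.2.le hf1
  have hmidg := hconst hg ha.1.le hab hb.2.le hg1
  have hshrink : 0 ≤ (b - a) * K := mul_nonneg (sub_nonneg.2 hab) hK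
  linarith

/-- A cost that is continuous on `[0, M]` is integrable along a measurable `[0, M]`-valued
density. -/
lemma ContinuousOn.integrableOn_comp_of_mem_Icc {c σ : ℝ → ℝ} {M : ℝ} (hM : 0 ≤ M)
    (hc : ContinuousOn c (Icc 0 M)) (hσ : Measurable σ) {s : Set ℝ} (hs : MeasurableSet s)
    (hs' : volume s ≠ ⊤) (hσs : ∀ x ∈ s, σ x ∈ Icc 0 M) :
    IntegrableOn (fun x => c (σ x)) s := by
  have hext : Continuous (IccExtend hM ((Icc 0 M).domRestrict c)) :=
    (continuousOn_iff_continuous_domRestrict.1 hc).Icc_extend'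
  have heq : EqOn (fun x => IccExtend hM ((Icc 0 M).domRestrict c) (σ x)) (fun x => c (σ x)) s :=
    fun x hx => IccExtend_of_mem hM _ (hσs x hx)
  obtain ⟨C, hC⟩ := isCompact_Icc.exists_bound_of_continuousOn hc
  refine IntegrableOn.congr_fun (Measure.integrableOn_of_bounded (M := C) hs'
    (hext.measurable.comp hσ).aestronglyMeasurable ?_) heq hs
  filter_upwards [ae_restrict_mem hs] with x hx
  simpa only [Function.comp_apply, heq hx] using! hC _ (hσs x hx)

/-- Properties of the subjective (memory) density
`𝓡[ρ](t,x) = δ·∫_{−∞}^t ρ(s,x)·e^{−δ(t−s)} ds` of the generalised Hughes model: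
(i) `0 ≤ 𝓡[ρ] ≤ ρmax`; (ii) `t ↦ 𝓡[ρ](t,x)` is Lipschitz with constant `δ·ρmax`;
(iii) if the cost `c` is Lipschitz with constant `L`, the associated turning
curve `ξ_δ` is Lipschitz with constant at most `L·δ·ρmax`. -/
theorem memory_density_properties
    (δ ρmax L : ℝ) (hδ : 0 < δ) (hρmax : 0 < ρmax) (hL : 0 ≤ L)
    (ρ : ℝ → ℝ → ℝ) (hmeas : Measurable (Function.uncurry ρ))
    (hrange : ∀ t : ℝ, ∀ x ∈ Ioo (-1 : ℝ) 1, ρ t x ∈ Icc 0 ρmax)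
    (R : ℝ → ℝ → ℝ)
    (hR : ∀ t x : ℝ, R t x = δ * ∫ s in Iic t, ρ s x * Real.exp (-δ * (t - s)))
    (c : ℝ → ℝ) (hc1 : ∀ r ∈ Icc (0 : ℝ) ρmax, 1 ≤ c r)
    (hcLip : ∀ r ∈ Icc (0 : ℝ) ρmax, ∀ s ∈ Icc (0 : ℝ) ρmax, |c r - c s| ≤ L * |r - s|)
    (ξ : ℝ → ℝ) (hξ : ∀ t : ℝ, ξ t ∈ Ioo (-1 : ℝ) 1)
    (hbal : ∀ t : ℝ,
      ∫ x in Ioo (-1 : ℝ) (ξ t), c (R t x) = ∫ x in Ioo (ξ t) 1, c (R t x)) :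
    (∀ t : ℝ, ∀ x ∈ Ioo (-1 : ℝ) 1, R t x ∈ Icc 0 ρmax) ∧
    (∀ x ∈ Ioo (-1 : ℝ) 1, LipschitzWith (Real.toNNReal (δ * ρmax)) (fun t => R t x)) ∧
    LipschitzWith (Real.toNNReal (L * δ * ρmax)) ξ := by
  have hρx (x : ℝ) : Measurable fun s => ρ s x := hmeas.comp measurable_prodMk_right
  have hRmem : ∀ t : ℝ, ∀ x ∈ Ioo (-1 : ℝ) 1, R t x ∈ Icc 0 ρmax := fun t x hx => by
    rw [hR]
    exact exponentialAverage_mem_Icc hδ (hρx x) (fun s => hrange s x hx) t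
  have hRlip : ∀ x ∈ Ioo (-1 : ℝ) 1,
      LipschitzWith (Real.toNNReal (δ * ρmax)) (fun t => R t x) := fun x hx => by
    have key {t t' : ℝ} (h : t ≤ t') : |R t' x - R t x| ≤ δ * ρmax * (t' - t) := by
      rw [hR, hR]
      exact abs_exponentialAverage_sub_le hδ (hρx x) (fun s => hrange s x hx) h
    refine LipschitzWith.of_dist_le' fun t t' => ?_
    rcases le_total t t' with h | h
    · rw [dist_comm (R t x), dist_comm t, Real.dist_eq, Real.dist_eq, abs_of_nonneg (sub_nonneg.2 h)]
      exact key h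
    · rw [Real.dist_eq, Real.dist_eq, abs_of_nonneg (sub_nonneg.2 h)]
      exact key h
  refine ⟨hRmem, hRlip, LipschitzWith.of_le_add_mul' _ fun t t' => ?_⟩
  have hRmeas (t : ℝ) : Measurable (R t) := by
    have h : StronglyMeasurable fun p : ℝ × ℝ => ρ p.2 p.1 * Real.exp (-δ * (t - p.2)) :=
      ((hmeas.comp measurable_swap).mul (by fun_prop)).stronglyMeasurable
    rw [show R t = _ from funext (hR t)]
    exact (h.integral_prod_right' (ν := volume.restrict (Iic t))).measurable.const_mul δ
  have hc : ContinuousOn c (Icc 0 ρmax) :=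
    (LipschitzOnWith.of_dist_le' (K := L) fun r hr s hs => hcLip r hr s hs).continuousOn
  have hint (r : ℝ) : IntegrableOn (fun x => c (R r x)) (Ioo (-1) 1) :=
    hc.integrableOn_comp_of_mem_Icc hρmax.le (hRmeas r) measurableSet_Ioo (by simp) (hRmem r)
  have h := turningPoint_sub_le (K := L * δ * ρmax * dist t t') (hint t') (hint t)
    (fun x hx => hc1 _ (hRmem t' x hx)) (fun x hx => hc1 _ (hRmem t x hx)) (fun x hx => ?_)
    (hξ t') (hξ t) (hbal t') (hbal t)
  · linarith
  · refine (hcLip _ (hRmem t' x hx) _ (hRmem t x hx)).trans ?_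
    have := (hRlip x hx).dist_le_mul t' t
    rw [Real.coe_toNNReal _ (by positivity), Real.dist_eq, dist_comm] at this
    calc _ ≤ L * (δ * ρmax * dist t t') := by gcongr
      _ = _ := by ring
end

section
/- Let δ₁ > 0 and let F : [−1,1] → ℝ be measurable with F₀ ≤ F(x) ≤ F₁ for a.e. x ∈ [−1,1], where 0 < F₀ ≤ F₁. Suppose ψ : [−1,1] → ℝ is C¹ with Lipschitz continuous derivative (so ψ'' exists a.e.) and satisfies the Hopf–Cole transformed boundary value problem δ₁²·ψ''(x) = ψ(x)·F(x) for a.e. x ∈ (−1,1), with ψ(−1) = ψ(1) = 1. Then 0 < ψ(x) ≤ 1 for every x ∈ [−1,1], and consequently |ψ''(x)| ≤ F₁/δ₁² for a.e. x ∈ (−1,1). -/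
open MeasureTheory Set

/-- An absolutely continuous function whose derivative is nonnegative a.e. is monotone. -/
theorem AbsolutelyContinuousOnInterval.monotoneOn_of_ae_deriv_nonneg {f : ℝ → ℝ} {a b : ℝ}
    (hab : a ≤ b) (hf : AbsolutelyContinuousOnInterval f a b)
    (h : ∀ᵐ x ∂(volume.restrict (Ioo a b)), 0 ≤ deriv f x) : MonotoneOn f (Icc a b) := by
  intro x hx y hy hxy
  have hsub : uIcc x y ⊆ uIcc a b := by
    rw [uIcc_of_le hxy, uIcc_of_le hab]
    exact Icc_subset_Icc hx.1 hy.2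
  rw [← sub_nonneg, ← (hf.mono hsub).integral_deriv_eq_sub]
  apply intervalIntegral.integral_nonneg_of_ae_restrict hxy
  rw [← Measure.restrict_congr_set Ioo_ae_eq_Icc]
  exact ae_restrict_of_ae_restrict_of_subset (Ioo_subset_Ioo hx.1 hy.2) h

/-- A function with a continuous derivative on a compact interval is absolutely continuous there. -/
theorem absolutelyContinuousOnInterval_of_hasDerivWithinAt {u u' : ℝ → ℝ} {a b : ℝ} (hab : a ≤ b)
    (hu : ∀ x ∈ Icc a b, HasDerivWithinAt u (u' x) (Icc a b) x)
    (hu' : ContinuousOn u' (Icc a b)) : AbsolutelyContinuousOnInterval u a b := by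
  obtain ⟨M, hM⟩ := isCompact_Icc.exists_bound_of_continuousOn hu'
  refine LipschitzOnWith.absolutelyContinuousOnInterval (K := M.toNNReal) ?_
  rw [uIcc_of_le hab]
  refine (convex_Icc a b).lipschitzOnWith_of_nnnorm_hasDerivWithin_le hu fun x hx => ?_
  rw [← NNReal.coe_le_coe, coe_nnnorm]
  exact (hM x hx).trans (Real.le_coe_toNNReal M)

/-- If `u` satisfies `u'' ≤ k² u` a.e. with vanishing initial value and slope, then
`u ≤ 0` at the right endpoint. -/
theorem nonpos_of_second_deriv_le {u u' u'' : ℝ → ℝ} {a b k : ℝ} (hab : a ≤ b)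
    (hu : ∀ x ∈ Icc a b, HasDerivWithinAt u (u' x) (Icc a b) x)
    (hac : AbsolutelyContinuousOnInterval u' a b)
    (hu'' : ∀ᵐ x ∂(volume.restrict (Ioo a b)), HasDerivAt u' (u'' x) x)
    (hle : ∀ᵐ x ∂(volume.restrict (Ioo a b)), u'' x ≤ k ^ 2 * u x)
    (ha : u a = 0) (ha' : u' a = 0) : u b ≤ 0 := by
  have hcont : ContinuousOn u (Icc a b) := fun x hx => (hu x hx).continuousWithinAt
  have hderiv : ∀ x ∈ Ioo a b, HasDerivAt u (u' x) x := fun x hx =>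
    (hu x (Ioo_subset_Icc_self hx)).hasDerivAt (Icc_mem_nhds hx.1 hx.2)
  have huac : AbsolutelyContinuousOnInterval u a b :=
    absolutelyContinuousOnInterval_of_hasDerivWithinAt hab hu
      (by simpa [uIcc_of_le hab] using hac.continuousOn)
  have hexp : AbsolutelyContinuousOnInterval (fun x => -Real.exp (-k * x)) a b :=
    ContDiffOn.absolutelyContinuousOnInterval (ContDiff.contDiffOn (by fun_prop))
  have hmono : MonotoneOn (fun x => (u' x + k * u x) * -Real.exp (-k * x)) (Icc a b) := by
    refine ((hac.fun_add (huac.const_mul k)).fun_mul hexp).monotoneOn_of_ae_deriv_nonneg hab ?_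
    filter_upwards [hu'', hle, ae_restrict_mem measurableSet_Ioo] with x h1 h2 hx
    have he : HasDerivAt (fun x => -Real.exp (-k * x)) (-(Real.exp (-k * x) * (-k * 1))) x :=
      (((hasDerivAt_id x).const_mul (-k)).exp).neg
    have hd := ((h1.add ((hderiv x hx).const_mul k)).mul he).deriv
    refine le_of_le_of_eq ?_ hd.symm
    have : 0 ≤ Real.exp (-k * x) * (k ^ 2 * u x - u'' x) :=
      mul_nonneg (Real.exp_pos _).le (by linarith)
    simp only [Pi.add_apply]
    linarith
  have hslope : ∀ x ∈ Icc a b, u' x + k * u x ≤ 0 := by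
    intro x hx
    have h := hmono (left_mem_Icc.2 hab) hx hx.1
    simp only [ha, ha'] at h
    have := Real.exp_pos (-k * x)
    by_contra! hc
    nlinarith [mul_pos hc this]
  have hanti : AntitoneOn (fun x => u x * Real.exp (k * x)) (Icc a b) := by
    refine antitoneOn_of_hasDerivWithinAt_nonpos
      (f' := fun x => u' x * Real.exp (k * x) + u x * (Real.exp (k * x) * (k * 1)))
      (convex_Icc a b) (hcont.mul (by fun_prop)) (fun x hx => ?_) (fun x hx => ?_)
    · rw [interior_Icc] at hx
      exact ((hderiv x hx).mul ((hasDerivAt_id x).const_mul k).exp).hasDerivWithinAt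
    · have := mul_nonneg (Real.exp_pos (k * x)).le
        (neg_nonneg.2 (hslope x (interior_subset hx)))
      linarith
  have h := hanti (left_mem_Icc.2 hab) (right_mem_Icc.2 hab) hab
  simp only [ha, zero_mul] at h
  exact nonpos_of_mul_nonpos_left h (Real.exp_pos _)

/-- Strong minimum principle for `u'' = q u` with `0 ≤ q ≤ k²` a.e. and positive boundary values. -/
theorem pos_of_second_deriv_eq_mul {u u' u'' q : ℝ → ℝ} {a b k : ℝ} (hab : a ≤ b)
    (hu : ∀ x ∈ Icc a b, HasDerivWithinAt u (u' x) (Icc a b) x)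
    (hac : AbsolutelyContinuousOnInterval u' a b)
    (hu'' : ∀ᵐ x ∂(volume.restrict (Ioo a b)), HasDerivAt u' (u'' x) x)
    (hq : ∀ᵐ x ∂(volume.restrict (Ioo a b)), q x ∈ Icc 0 (k ^ 2))
    (heq : ∀ᵐ x ∂(volume.restrict (Ioo a b)), u'' x = q x * u x)
    (ha : 0 < u a) (hb : 0 < u b) : ∀ x ∈ Icc a b, 0 < u x := by
  have hcont : ContinuousOn u (Icc a b) := fun x hx => (hu x hx).continuousWithinAt
  have hderiv : ∀ x ∈ Ioo a b, HasDerivAt u (u' x) x := fun x hx =>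
    (hu x (Ioo_subset_Icc_self hx)).hasDerivAt (Icc_mem_nhds hx.1 hx.2)
  have huac : AbsolutelyContinuousOnInterval u a b :=
    absolutelyContinuousOnInterval_of_hasDerivWithinAt hab hu
      (by simpa [uIcc_of_le hab] using hac.continuousOn)
  obtain ⟨c, hc, hmin⟩ := isCompact_Icc.exists_isMinOn (nonempty_Icc.2 hab) hcont
  suffices hcpos : 0 < u c from fun x hx => hcpos.trans_le (hmin hx)
  by_contra! hc0
  have hac' : a < c := lt_of_le_of_ne hc.1 (by rintro rfl; linarith)
  have hcb : c < b := lt_of_le_of_ne hc.2 (by rintro rfl; linarith)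
  have hc' : u' c = 0 :=
    (hmin.isLocalMin (Icc_mem_nhds hac' hcb)).hasDerivAt_eq_zero (hderiv c ⟨hac', hcb⟩)
  have hmono : MonotoneOn (fun x => u x * u' x) (Icc a b) := by
    refine (huac.fun_mul hac).monotoneOn_of_ae_deriv_nonneg hab ?_
    filter_upwards [hu'', hq, heq, ae_restrict_mem measurableSet_Ioo] with x h1 h2 h3 hx
    refine le_of_le_of_eq ?_ ((hderiv x hx).mul h1).deriv.symm
    rw [h3]
    nlinarith [mul_self_nonneg (u' x), mul_nonneg h2.1 (mul_self_nonneg (u x))]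
  obtain ⟨z, hz, hz0⟩ : ∃ z ∈ Icc c b, u z = 0 :=
    intermediate_value_Icc hc.2 (hcont.mono (Icc_subset_Icc_left hc.1)) ⟨hc0, hb.le⟩
  have hsq : MonotoneOn (fun x => u x ^ 2) (Icc c b) := by
    refine monotoneOn_of_hasDerivWithinAt_nonneg (f' := fun x => 2 * u x ^ 1 * u' x)
      (convex_Icc c b) ((hcont.mono (Icc_subset_Icc_left hc.1)).pow 2)
      (fun x hx => ?_) (fun x hx => ?_)
    · rw [interior_Icc] at hx
      exact ((hderiv x ⟨hac'.trans hx.1, hx.2⟩).pow 2).hasDerivWithinAt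
    · rw [interior_Icc] at hx
      have h := hmono hc ⟨hc.1.trans hx.1.le, hx.2.le⟩ hx.1.le
      simp only [hc', mul_zero] at h
      linarith
  have huc : u c = 0 := by
    have h := hsq (left_mem_Icc.2 hc.2) hz hz.1
    simp only [hz0] at h
    nlinarith [sq_nonneg (u c)]
  have hsub : Icc c b ⊆ Icc a b := Icc_subset_Icc_left hc.1
  have hsub' : Ioo c b ⊆ Ioo a b := Ioo_subset_Ioo_left hc.1
  refine hb.not_ge (nonpos_of_second_deriv_le (k := k) hc.2 (fun x hx => (hu x (hsub hx)).mono hsub)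
    (hac.mono (by rwa [uIcc_of_le hc.2, uIcc_of_le hab]))
    (ae_restrict_of_ae_restrict_of_subset hsub' hu'')
    (ae_restrict_of_ae_restrict_of_subset hsub' ?_) huc hc')
  filter_upwards [hq, heq, ae_restrict_mem measurableSet_Ioo] with x h1 h2 hx
  rw [h2]
  exact mul_le_mul_of_nonneg_right h1.2 (huc ▸ hmin (Ioo_subset_Icc_self hx))

/-- Bounds for the Hopf–Cole transform of the regularised eikonal equation:
if `δ₁² ψ'' = ψ F` a.e. on `(−1,1)` with `ψ(±1) = 1` and `0 < F₀ ≤ F ≤ F₁` a.e.,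
where `ψ` is C¹ on `[−1,1]` with Lipschitz derivative, then `0 < ψ ≤ 1` on
`[−1,1]` and `|ψ''| ≤ F₁/δ₁²` a.e. on `(−1,1)`. -/
theorem hopf_cole_bounds
    (δ₁ F₀ F₁ : ℝ) (hδ₁ : 0 < δ₁) (hF₀ : 0 < F₀) (hF₀₁ : F₀ ≤ F₁)
    (F : ℝ → ℝ) (hFmeas : Measurable F)
    (hFbd : ∀ᵐ x ∂(volume.restrict (Icc (-1 : ℝ) 1)), F x ∈ Icc F₀ F₁)
    (ψ ψ' ψ'' : ℝ → ℝ) (K : NNReal)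
    (hψd : ∀ x ∈ Icc (-1 : ℝ) 1, HasDerivWithinAt ψ (ψ' x) (Icc (-1 : ℝ) 1) x)
    (hψcont : ContinuousOn ψ (Icc (-1 : ℝ) 1))
    (hψ'lip : LipschitzOnWith K ψ' (Icc (-1 : ℝ) 1))
    (hψ'' : ∀ᵐ x ∂(volume.restrict (Ioo (-1 : ℝ) 1)), HasDerivAt ψ' (ψ'' x) x)
    (heq : ∀ᵐ x ∂(volume.restrict (Ioo (-1 : ℝ) 1)), δ₁ ^ 2 * ψ'' x = ψ x * F x)
    (hbc₁ : ψ (-1) = 1) (hbc₂ : ψ 1 = 1) :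
    (∀ x ∈ Icc (-1 : ℝ) 1, 0 < ψ x ∧ ψ x ≤ 1) ∧
    (∀ᵐ x ∂(volume.restrict (Ioo (-1 : ℝ) 1)), |ψ'' x| ≤ F₁ / δ₁ ^ 2) := by
  have hδ : 0 < δ₁ ^ 2 := by positivity
  have hF₁ : 0 ≤ F₁ / δ₁ ^ 2 := div_nonneg (hF₀.le.trans hF₀₁) hδ.le
  have hF : ∀ᵐ x ∂(volume.restrict (Ioo (-1 : ℝ) 1)), F x / δ₁ ^ 2 ∈ Icc 0 (F₁ / δ₁ ^ 2) := by
    filter_upwards [ae_restrict_of_ae_restrict_of_subset Ioo_subset_Icc_self hFbd] with x hx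
    exact ⟨div_nonneg (hF₀.le.trans hx.1) hδ.le, div_le_div_of_nonneg_right hx.2 hδ.le⟩
  have hode : ∀ᵐ x ∂(volume.restrict (Ioo (-1 : ℝ) 1)), ψ'' x = F x / δ₁ ^ 2 * ψ x := by
    filter_upwards [heq] with x hx
    field_simp
    linarith
  have hle : (-1 : ℝ) ≤ 1 := by norm_num
  have hac : AbsolutelyContinuousOnInterval ψ' (-1) 1 :=
    LipschitzOnWith.absolutelyContinuousOnInterval (by rwa [uIcc_of_le hle])
  have hpos : ∀ x ∈ Icc (-1 : ℝ) 1, 0 < ψ x :=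
    pos_of_second_deriv_eq_mul (k := √(F₁ / δ₁ ^ 2)) hle hψd hac hψ''
      (by simpa only [Real.sq_sqrt hF₁] using hF) hode (by simp [hbc₁]) (by simp [hbc₂])
  have hmono : MonotoneOn ψ' (Icc (-1) 1) := by
    refine hac.monotoneOn_of_ae_deriv_nonneg hle ?_
    filter_upwards [hψ'', hF, hode, ae_restrict_mem measurableSet_Ioo] with x h1 h2 h3 hx
    rw [h1.deriv, h3]
    exact mul_nonneg h2.1 (hpos x (Ioo_subset_Icc_self hx)).le
  have hconv : ConvexOn ℝ (Icc (-1) 1) ψ := by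
    have hd : ∀ x ∈ interior (Icc (-1 : ℝ) 1), HasDerivAt ψ (ψ' x) x := fun x hx =>
      (hψd x (interior_subset hx)).hasDerivAt (mem_interior_iff_mem_nhds.1 hx)
    refine MonotoneOn.convexOn_of_deriv (convex_Icc _ _) hψcont
      (fun x hx => (hd x hx).differentiableAt.differentiableWithinAt) fun x hx y hy hxy => ?_
    rw [(hd x hx).deriv, (hd y hy).deriv]
    exact hmono (interior_subset hx) (interior_subset hy) hxy
  have hle_one : ∀ x ∈ Icc (-1 : ℝ) 1, ψ x ≤ 1 := fun x hx => by
    simpa [hbc₁, hbc₂] using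
      hconv.le_max_of_mem_Icc (left_mem_Icc.2 hle) (right_mem_Icc.2 hle) hx
  refine ⟨fun x hx => ⟨hpos x hx, hle_one x hx⟩, ?_⟩
  filter_upwards [hF, hode, ae_restrict_mem measurableSet_Ioo] with x h1 h2 hx
  have hx' := Ioo_subset_Icc_self hx
  rw [h2, abs_of_nonneg (mul_nonneg h1.1 (hpos x hx').le)]
  exact (mul_le_of_le_one_right h1.1 (hle_one x hx')).trans h1.2
end
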